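/- Let (S,N) be a regular local ring which is a G-ring, with regular system of parameters (u_1,...,u_d), and let R := S[y]_{(N,y)}. Let f = y^m + f_1 y^{m−1} + ··· + f_m ∈ S[y] with f_1,...,f_m ∈ N. Then there exists z := y − φ with φ ∈ N such that Δ(f;u_1,...,u_d;z) = Δ(f;u_1,...,u_d). -/

import Mathlib

/-!
Characteristic polyhedra of singularities without completion
(V. Cossart, O. Piltant), formalized statements.
-/

noncomputable section

open IsLocalRing TensorProduct

namespace CharPolyhedra

universe u v

/-! ### Polyhedral notions -/

/-- The nonnegative orthant in `ℝ^d`. -/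
def orthant (d : ℕ) : Set (Fin d → ℝ) := {x | ∀ i, 0 ≤ x i}

/-- An `F`-subset of `ℝ_{≥0}^d`: a closed convex subset stable under translation
by the nonnegative orthant. -/
def IsFSubset {d : ℕ} (Δ : Set (Fin d → ℝ)) : Prop :=
  Δ ⊆ orthant d ∧ IsClosed Δ ∧ Convex ℝ Δ ∧ ∀ v ∈ Δ, ∀ w ∈ orthant d, v + w ∈ Δ

/-- The smallest `F`-subset containing a given set of points. -/
def smallestFSubset {d : ℕ} (X : Set (Fin d → ℝ)) : Set (Fin d → ℝ) :=
  ⋂₀ {Δ | IsFSubset Δ ∧ X ⊆ Δ}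

/-- A vertex of an `F`-subset: a point cut out by a positive linear form. -/
def IsVertex {d : ℕ} (Δ : Set (Fin d → ℝ)) (v : Fin d → ℝ) : Prop :=
  ∃ L : Fin d → ℝ, (∀ i, 0 < L i) ∧ Δ ∩ {x | ∑ i, L i * x i = 1} = {v}

/-- A rational polyhedron: an `F`-subset cut out by finitely many nonnegative
rational linear forms. -/
def IsRationalPolyhedron {d : ℕ} (Δ : Set (Fin d → ℝ)) : Prop :=
  ∃ (n : ℕ) (L : Fin n → Fin d → ℚ), (∀ j i, 0 ≤ L j i) ∧
    Δ = {x | x ∈ orthant d ∧ ∀ j, 1 ≤ ∑ i, (L j i : ℝ) * x i}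

/-- `min {L(a) : a ∈ Δ}` for a linear form with rational coefficients `L`. -/
def ellOf {d : ℕ} (L : Fin d → ℚ) (Δ : Set (Fin d → ℝ)) : ℝ :=
  sInf ((fun x => ∑ i, (L i : ℝ) * x i) '' Δ)

/-! ### Regular local rings, systems of parameters -/

/-- A family `s` of `n` elements is a regular system of parameters of the local
ring `R`: it generates the maximal ideal and `n` equals the Krull dimension. -/
def IsSysOfParams (R : Type u) [CommRing R] [IsLocalRing R] {n : ℕ} (s : Fin n → R) : Prop :=
  Ideal.span (Set.range s) = maximalIdeal R ∧ ringKrullDim R = n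

/-- `(y, u 0, ..., u (d-1))` is a regular system of parameters of `R`. -/
def IsRSP (R : Type u) [CommRing R] [IsLocalRing R] {d : ℕ} (y : R) (u : Fin d → R) : Prop :=
  IsSysOfParams R (Fin.cons y u)

/-- A regular local ring: a Noetherian local ring whose maximal ideal is
generated by a regular system of parameters. -/
def IsRegularLocalRing (R : Type u) [CommRing R] [IsLocalRing R] : Prop :=
  IsNoetherianRing R ∧ ∃ (n : ℕ) (s : Fin n → R), IsSysOfParams R s

/-- A regular ring: a Noetherian ring all of whose localizations at primes are
regular local rings. -/
def IsRegularRing (A : Type u) [CommRing A] : Prop :=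
  IsNoetherianRing A ∧ ∀ (P : Ideal A) [P.IsPrime],
    IsRegularLocalRing (Localization.AtPrime P)

/-! ### Monomial expansions and polyhedra -/

variable {R : Type u} [CommRing R]

/-- The monomial `y^b u^a`, where `ab = (a, b)`. -/
def monomial {d : ℕ} (y : R) (u : Fin d → R) (ab : (Fin d → ℕ) × ℕ) : R :=
  y ^ ab.2 * ∏ i, u i ^ ab.1 i

/-- A finite expansion `f = Σ_{(a,b)} C_{a,b} y^b u^a` with all coefficients units. -/
def IsUnitExpansion {d : ℕ} (f y : R) (u : Fin d → R)
    (c : ((Fin d → ℕ) × ℕ) →₀ R) : Prop :=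
  (∀ ab ∈ c.support, IsUnit (c ab)) ∧ f = c.sum fun ab r => r * monomial y u ab

/-- The projection `(a, b) ↦ a / (m - b)` from the point `(0, m)`. -/
def projPoint {d : ℕ} (m : ℕ) (ab : (Fin d → ℕ) × ℕ) : Fin d → ℝ :=
  fun i => (ab.1 i : ℝ) / ((m : ℝ) - (ab.2 : ℝ))

/-- The projected points attached to (the support of) an expansion. -/
def expPoints {d : ℕ} (m : ℕ) (s : Finset ((Fin d → ℕ) × ℕ)) : Set (Fin d → ℝ) :=
  {x | ∃ ab ∈ s, ab.2 < m ∧ x = projPoint m ab}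

/-- The polyhedron `Δ(f; u; y)` computed with prescribed order `m`: the smallest
`F`-subset containing the projected supports of all finite unit-coefficient
expansions of `f` in the parameters `(y, u)`. -/
def DeltaOf {d : ℕ} (f y : R) (u : Fin d → R) (m : ℕ) : Set (Fin d → ℝ) :=
  smallestFSubset (⋃ c ∈ {c | IsUnitExpansion f y u c}, expPoints m c.support)

/-- The order of the image of `f` in `R/(u_1, ..., u_d)`, i.e. the largest `n`
with `f ∈ M^n + (u_1, ..., u_d)`. -/
def ordRes {d : ℕ} [IsLocalRing R] (f : R) (u : Fin d → R) : ℕ :=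
  sSup {n : ℕ | f ∈ (maximalIdeal R) ^ n ⊔ Ideal.span (Set.range u)}

/-- Hironaka's polyhedron `Δ(f; u_1, ..., u_d; y)`. -/
def Delta {d : ℕ} [IsLocalRing R] (f y : R) (u : Fin d → R) : Set (Fin d → ℝ) :=
  DeltaOf f y u (ordRes f u)

/-! ### Completion and the characteristic polyhedron -/

/-- The `M`-adic completion `R̂` of a local ring `R`. -/
abbrev Completion (R : Type u) [CommRing R] [IsLocalRing R] : Type u :=
  AdicCompletion (maximalIdeal R) R

/-- The canonical map `R → R̂`. -/
def cmpl {R : Type u} [CommRing R] [IsLocalRing R] : R →+* Completion R :=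
  algebraMap R (Completion R)

/-- `(ŷ, u_1, ..., u_d)` is a regular system of parameters of the completion
`R̂`: it generates the maximal ideal `M·R̂` of `R̂`. -/
def IsRSPhat (R : Type u) [CommRing R] [IsLocalRing R] {d : ℕ}
    (yh : Completion R) (u : Fin d → R) : Prop :=
  Ideal.span (insert yh (Set.range fun i => cmpl (u i)))
    = (maximalIdeal R).map (cmpl (R := R))

/-- Hironaka's characteristic polyhedron `Δ(f; u_1, ..., u_d)`: the intersection
of the `Δ(f; u; ŷ)` over all regular systems of parameters `(ŷ, u_1, ..., u_d)`
of the completion `R̂`. -/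
def CharPolyhedron {d : ℕ} [IsLocalRing R] (f : R) (u : Fin d → R) : Set (Fin d → ℝ) :=
  ⋂ yh ∈ {yh : Completion R | IsRSPhat R yh u},
    DeltaOf (cmpl f) yh (fun i => cmpl (u i)) (ordRes f u)

/-! ### G-rings, excellence -/

/-- A `κ`-algebra `A` is geometrically regular if `κ' ⊗[κ] A` is a regular ring
for every finite field extension `κ'/κ`. -/
def IsGeometricallyRegularAlgebra (κ : Type u) [Field κ] (A : Type v) [CommRing A]
    [Algebra κ A] : Prop :=
  ∀ (κ' : Type u) [Field κ'] [Algebra κ κ'] [Module.Finite κ κ'],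
    IsRegularRing (κ' ⊗[κ] A)

/-- A local ring has geometrically regular formal fibers if, for every prime
`P ⊂ R`, the formal fiber `κ(P) ⊗_R R̂` is a geometrically regular
`κ(P)`-algebra. -/
def HasGeomRegularFormalFibers (R : Type u) [CommRing R] [IsLocalRing R] : Prop :=
  ∀ (P : Ideal R) [P.IsPrime],
    IsGeometricallyRegularAlgebra (ResidueField (Localization.AtPrime P))
      (ResidueField (Localization.AtPrime P) ⊗[R] Completion R)

/-- A G-ring: a Noetherian ring all of whose localizations at primes have
geometrically regular formal fibers. -/
def IsGRing (A : Type u) [CommRing A] : Prop :=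
  IsNoetherianRing A ∧ ∀ (P : Ideal A) [P.IsPrime],
    HasGeomRegularFormalFibers (Localization.AtPrime P)

/-- A saturated chain of primes: each step is a covering relation. -/
def IsSaturatedChain {A : Type u} [CommRing A] (c : LTSeries (PrimeSpectrum A)) : Prop :=
  ∀ i : Fin c.length, c.toFun i.castSucc ⋖ c.toFun i.succ

/-- A catenary ring: any two saturated chains of primes with the same endpoints
have the same length. -/
def IsCatenary (A : Type u) [CommRing A] : Prop :=
  ∀ (c₁ c₂ : LTSeries (PrimeSpectrum A)), c₁.head = c₂.head → c₁.last = c₂.last →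
    IsSaturatedChain c₁ → IsSaturatedChain c₂ → c₁.length = c₂.length

/-- Universally catenary: all polynomial rings over `A` are catenary. -/
def IsUniversallyCatenary (A : Type u) [CommRing A] : Prop :=
  ∀ n : ℕ, IsCatenary (MvPolynomial (Fin n) A)

/-- The regular locus of any domain finite over `A` is open. -/
def HasOpenRegularLocus (A : Type u) [CommRing A] : Prop :=
  ∀ (B : Type u) [CommRing B] [IsDomain B] [Algebra A B] [Module.Finite A B],
    IsOpen {P : PrimeSpectrum B | IsRegularLocalRing (Localization.AtPrime P.asIdeal)}

/-- Quasi-excellent: a G-ring with open regular loci for finite domains over it. -/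
def IsQuasiExcellent (A : Type u) [CommRing A] : Prop :=
  IsGRing A ∧ HasOpenRegularLocus A

/-- Excellent: universally catenary and quasi-excellent. -/
def IsExcellent (A : Type u) [CommRing A] : Prop :=
  IsUniversallyCatenary A ∧ IsQuasiExcellent A

/-! ### Monomial valuations and associated graded rings -/

/-- The weight `l·b + L(a)` of the monomial `y^b u^a`. -/
def weight {d : ℕ} (l : ℝ) (L : Fin d → ℝ) (ab : (Fin d → ℕ) × ℕ) : ℝ :=
  l * (ab.2 : ℝ) + ∑ i, L i * (ab.1 i : ℝ)

/-- The ideal `I_λ` generated by the monomials `y^b u^a` with `l·b + L(a) ≥ λ`. -/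
def monIdeal {d : ℕ} (y : R) (u : Fin d → R) (l : ℝ) (L : Fin d → ℝ) (lam : ℝ) :
    Ideal R :=
  Ideal.span {g | ∃ ab : (Fin d → ℕ) × ℕ, g = monomial y u ab ∧ lam ≤ weight l L ab}

/-- The monomial valuation `v(g) := max {λ : g ∈ I_λ}`. -/
def vval {d : ℕ} (y : R) (u : Fin d → R) (l : ℝ) (L : Fin d → ℝ) (g : R) : ℝ :=
  sSup {lam : ℝ | g ∈ monIdeal y u l L lam}

/-- The Rees algebra `⊕_λ I_λ` of the filtration `(I_λ)`, realized inside the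
monoid algebra `R[ℝ]`. -/
def ReesAlgebra {d : ℕ} (y : R) (u : Fin d → R) (l : ℝ) (L : Fin d → ℝ) :
    Subalgebra R (AddMonoidAlgebra R ℝ) :=
  Algebra.adjoin R {p | ∃ (lam : ℝ) (x : R), x ∈ monIdeal y u l L lam ∧
    p = AddMonoidAlgebra.single lam x}

/-- The ideal `⊕_λ I_{λ⁺}` of the Rees algebra. -/
def grIdeal {d : ℕ} (y : R) (u : Fin d → R) (l : ℝ) (L : Fin d → ℝ) :
    Ideal (ReesAlgebra y u l L) :=
  Ideal.span {p | ∃ (lam : ℝ) (x : R), (∃ lam' > lam, x ∈ monIdeal y u l L lam') ∧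
    (p : AddMonoidAlgebra R ℝ) = AddMonoidAlgebra.single lam x}

/-- The associated graded ring `gr_v(R) = ⊕_λ I_λ / I_{λ⁺}` of `R` with respect
to the monomial valuation `v`, realized as `(⊕_λ I_λ) / (⊕_λ I_{λ⁺})`. -/
abbrev GrRing {d : ℕ} (y : R) (u : Fin d → R) (l : ℝ) (L : Fin d → ℝ) : Type u :=
  ReesAlgebra y u l L ⧸ grIdeal y u l L

/-- `x ∈ gr_v(R)` is the initial form of `g ∈ R`: the class of `g` placed in
degree `v(g)`. -/
def IsInitialForm {d : ℕ} (y : R) (u : Fin d → R) (l : ℝ) (L : Fin d → ℝ) (g : R)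
    (x : GrRing y u l L) : Prop :=
  ∃ h : AddMonoidAlgebra.single (vval y u l L g) g ∈ ReesAlgebra y u l L,
    x = Ideal.Quotient.mk (grIdeal y u l L)
      ⟨AddMonoidAlgebra.single (vval y u l L g) g, h⟩

set_option linter.unusedSectionVars false

section MonIdeals

variable {A : Type*} [CommRing A] {ι : Type*} [Fintype ι]

def mon (w : ι → A) (e : ι → ℕ) : A := ∏ i, w i ^ e i

def mI (w : ι → A) (E : Set (ι → ℕ)) : Ideal A := Ideal.span (mon w '' E)

def bx (e : ι → ℕ) : Set (ι → ℕ) := {e' | ¬ e' ≤ e}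

def dg (e : ι → ℕ) : ℕ := ∑ i, e i

lemma mon_zero (w : ι → A) : mon w 0 = 1 := by simp [mon]

lemma mon_add (w : ι → A) (a b : ι → ℕ) : mon w (a + b) = mon w a * mon w b := by
  simp [mon, pow_add, Finset.prod_mul_distrib]

lemma mon_nsmul (w : ι → A) (n : ℕ) (a : ι → ℕ) : mon w (n • a) = mon w a ^ n := by
  induction n with
  | zero => simp [mon_zero]
  | succ n ih => rw [succ_nsmul, mon_add, ih, pow_succ]

lemma mon_single [DecidableEq ι] (w : ι → A) (i : ι) : mon w (Pi.single i 1) = w i := by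
  unfold mon
  rw [Finset.prod_eq_single i]
  · simp
  · intro j _ hj; simp [hj]
  · simp

lemma mon_mem {w : ι → A} {E : Set (ι → ℕ)} {e : ι → ℕ} (h : e ∈ E) : mon w e ∈ mI w E :=
  Ideal.subset_span ⟨e, h, rfl⟩

lemma mI_le {w : ι → A} {E : Set (ι → ℕ)} {I : Ideal A} (h : ∀ e ∈ E, mon w e ∈ I) :
    mI w E ≤ I := by
  unfold mI
  rw [Ideal.span_le]
  rintro _ ⟨e, he, rfl⟩
  exact h e he

lemma mI_mono {w : ι → A} {E F : Set (ι → ℕ)} (h : E ⊆ F) : mI w E ≤ mI w F :=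
  mI_le fun _ he => mon_mem (h he)

lemma mI_dom {w : ι → A} {E F : Set (ι → ℕ)} (h : ∀ e ∈ E, ∃ f ∈ F, f ≤ e) :
    mI w E ≤ mI w F := by
  refine mI_le fun e he => ?_
  obtain ⟨f, hf, hfe⟩ := h e he
  have : e = (e - f) + f := (tsub_add_cancel_of_le hfe).symm
  rw [this, mon_add]
  exact Ideal.mul_mem_left _ _ (mon_mem hf)

lemma mI_mul {w : ι → A} {E F G : Set (ι → ℕ)} (h : ∀ a ∈ E, ∀ b ∈ F, a + b ∈ G)
    {x y : A} (hx : x ∈ mI w E) (hy : y ∈ mI w F) : x * y ∈ mI w G := by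
  have : x * y ∈ mI w E * mI w F := Ideal.mul_mem_mul hx hy
  unfold mI at this
  rw [Ideal.span_mul_span'] at this
  refine Ideal.span_le.2 ?_ this
  rintro _ ⟨_, ⟨a, ha, rfl⟩, _, ⟨b, hb, rfl⟩, rfl⟩
  simp only [← mon_add]
  exact mon_mem (h a ha b hb)

lemma mI_union (w : ι → A) (E F : Set (ι → ℕ)) : mI w (E ∪ F) = mI w E ⊔ mI w F := by
  unfold mI; rw [Set.image_union, Ideal.span_union]

lemma mI_univ (w : ι → A) : mI w Set.univ = ⊤ := by
  rw [Ideal.eq_top_iff_one, ← mon_zero w]; exact mon_mem trivial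

lemma map_mon {B : Type*} [CommRing B] (ψ : A →+* B) (w : ι → A) (e : ι → ℕ) :
    ψ (mon w e) = mon (fun i => ψ (w i)) e := by simp [mon]

lemma map_mI {B : Type*} [CommRing B] (ψ : A →+* B) (w : ι → A) (E : Set (ι → ℕ)) :
    (mI w E).map ψ = mI (fun i => ψ (w i)) E := by
  unfold mI
  rw [Ideal.map_span, Set.image_image]
  simp only [map_mon]

lemma mI_exp {w : ι → A} {E : Set (ι → ℕ)} {x : A} (h : x ∈ mI w E) :
    ∃ (F : Finset (ι → ℕ)) (c : (ι → ℕ) → A), (∀ e ∈ F, e ∈ E) ∧ x = ∑ e ∈ F, c e * mon w e := by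
  unfold mI Ideal.span at h
  rw [Finsupp.mem_span_image_iff_linearCombination] at h
  obtain ⟨l, hl, rfl⟩ := h
  refine ⟨l.support, l, fun e he => hl he, ?_⟩
  simp [Finsupp.linearCombination_apply, Finsupp.sum]

lemma dg_add (a b : ι → ℕ) : dg (a + b) = dg a + dg b := by simp [dg, Finset.sum_add_distrib]

lemma dg_single [DecidableEq ι] (i : ι) : dg (Pi.single i 1) = 1 := by simp [dg]

lemma dg_mono {a b : ι → ℕ} (h : a ≤ b) : dg a ≤ dg b := Finset.sum_le_sum fun i _ => h i

lemma eq_of_dg {a b : ι → ℕ} (h : a ≤ b) (hd : dg b ≤ dg a) : a = b := by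
  have h1 : dg a = dg b := le_antisymm (dg_mono h) hd
  funext i
  exact (Finset.sum_eq_sum_iff_of_le (fun i _ => h i)).1 h1 i (Finset.mem_univ _)

lemma exists_split [DecidableEq ι] {e : ι → ℕ} {k : ℕ} (h : dg e = k + 1) :
    ∃ e' i, dg e' = k ∧ e = e' + Pi.single i 1 := by
  have : ∃ i, e i ≠ 0 := by
    by_contra hc
    push Not at hc
    have : dg e = 0 := by simp [dg, hc]
    omega
  obtain ⟨i, hi⟩ := this
  have he : e = (e - Pi.single i 1) + Pi.single i 1 := by
    refine (tsub_add_cancel_of_le ?_).symm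
    intro j
    by_cases hj : j = i
    · subst hj; simp; omega
    · simp [hj]
  refine ⟨e - Pi.single i 1, i, ?_, he⟩
  have := congrArg dg he
  rw [dg_add, dg_single] at this
  omega

variable [IsLocalRing A]

lemma pow_eq_mI {w : ι → A} (hw : Ideal.span (Set.range w) = maximalIdeal A) (k : ℕ) :
    maximalIdeal A ^ k = mI w {e | dg e = k} := by
  classical
  induction k with
  | zero =>
    rw [pow_zero, Ideal.one_eq_top, eq_comm, Ideal.eq_top_iff_one, ← mon_zero w]
    exact mon_mem (by simp [dg])
  | succ k ih =>
    apply le_antisymm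
    · rw [pow_succ, ih, ← hw]
      unfold mI
      rw [Ideal.span_mul_span', Ideal.span_le]
      rintro _ ⟨_, ⟨a, ha, rfl⟩, _, ⟨i, rfl⟩, rfl⟩
      simp only
      rw [← mon_single w i, ← mon_add]
      refine mon_mem ?_
      simp only [Set.mem_ofPred_eq] at ha ⊢
      rw [dg_add, ha, dg_single]
    · refine mI_le fun e he => ?_
      obtain ⟨e', i, he', rfl⟩ := exists_split he
      rw [mon_add, pow_succ, mon_single]
      refine Ideal.mul_mem_mul ?_ ?_
      · rw [ih]; exact mon_mem he'
      · rw [← hw]; exact Ideal.subset_span ⟨i, rfl⟩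

lemma mon_mem_pow {w : ι → A} (hw : Ideal.span (Set.range w) = maximalIdeal A) {k : ℕ}
    {e : ι → ℕ} (h : k ≤ dg e) : mon w e ∈ maximalIdeal A ^ k := by
  refine Ideal.pow_le_pow_right h ?_
  rw [pow_eq_mI hw]; exact mon_mem rfl

lemma pow_le_bx {w : ι → A} (hw : Ideal.span (Set.range w) = maximalIdeal A) {k : ℕ}
    {e : ι → ℕ} (h : dg e < k) : maximalIdeal A ^ k ≤ mI w (bx e) := by
  rw [pow_eq_mI hw]
  refine mI_mono fun a ha hle => ?_
  have := dg_mono hle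
  simp only [Set.mem_ofPred_eq] at ha
  omega

lemma mul_mon_mem_bx {w : ι → A} (hw : Ideal.span (Set.range w) = maximalIdeal A)
    {x : A} (hx : x ∈ maximalIdeal A) (e : ι → ℕ) : x * mon w e ∈ mI w (bx e) := by
  classical
  rw [← hw] at hx
  have hle : Ideal.span (Set.range w) ≤ mI w {a | ∃ i, a = Pi.single i 1} := by
    rw [Ideal.span_le]
    rintro _ ⟨i, rfl⟩
    rw [← mon_single w i]
    exact mon_mem ⟨i, rfl⟩
  refine mI_mul (F := {e}) ?_ (hle hx) (mon_mem rfl)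
  rintro _ ⟨i, rfl⟩ b rfl hle
  have := hle i
  simp at this

def MP (w : ι → A) : Prop := ∀ e, mon w e ∉ mI w (bx e)

lemma coeff_mem_of_bx {w : ι → A} (hmp : MP w) {x : A} {e : ι → ℕ}
    (h : x * mon w e ∈ mI w (bx e)) : x ∈ maximalIdeal A := by
  by_contra hx
  have hu : IsUnit x := by simpa using hx
  exact hmp e ((Ideal.unit_mul_mem_iff_mem _ hu).1 h)

lemma mI_step {w : ι → A} (hw : Ideal.span (Set.range w) = maximalIdeal A) (hmp : MP w)
    {E : Set (ι → ℕ)} {k : ℕ} {r : A} (hr : r ∈ maximalIdeal A ^ k)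
    (h : ∀ e, e ∉ E → dg e = k → r ∈ mI w (bx e)) :
    r ∈ mI w {e | e ∈ E ∧ dg e = k} ⊔ maximalIdeal A ^ (k + 1) := by
  rw [pow_eq_mI hw] at hr
  obtain ⟨F, c, hF, rfl⟩ := mI_exp hr
  refine Ideal.sum_mem _ fun a ha => ?_
  by_cases haE : a ∈ E
  · exact Ideal.mem_sup_left (Ideal.mul_mem_left _ _ (mon_mem ⟨haE, hF a ha⟩))
  · refine Ideal.mem_sup_right ?_
    have h1 := h a haE (hF a ha)
    rw [← Finset.add_sum_erase _ _ ha] at h1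
    have h2 : ∑ x ∈ F.erase a, c x * mon w x ∈ mI w (bx a) := by
      classical
      refine Ideal.sum_mem _ fun b hb => Ideal.mul_mem_left _ _ (mon_mem ?_)
      rw [Finset.mem_erase] at hb
      intro hle
      refine hb.1 (eq_of_dg hle ?_)
      rw [hF a ha, hF b hb.2]
    have h3 := coeff_mem_of_bx hmp ((Ideal.add_mem_iff_left _ h2).1 h1)
    rw [pow_succ']
    exact Ideal.mul_mem_mul h3 (mon_mem_pow hw (hF a ha).ge)

structure MonSys (w : ι → A) : Prop where
  hw : Ideal.span (Set.range w) = maximalIdeal A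
  mp : MP w
  cl : ∀ (E : Set (ι → ℕ)) (h : A), (∀ k, h ∈ mI w E ⊔ maximalIdeal A ^ k) → h ∈ mI w E

/-- the exponent set of `h` -/
def ES (w : ι → A) (h : A) : Set (ι → ℕ) := {e | h ∉ mI w (bx e)}

lemma mI_le_bx {w : ι → A} {E : Set (ι → ℕ)} (hE : IsUpperSet E) {e} (he : e ∉ E) :
    mI w E ≤ mI w (bx e) := mI_mono fun _ ha hle => he (hE hle ha)

lemma ES_upper (w : ι → A) (h : A) : IsUpperSet (ES w h) := by
  intro a b hab ha hb
  exact ha (mI_mono (E := bx b) (F := bx a) (fun e he hle => he (hle.trans hab)) hb)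

variable {w : ι → A}

lemma MonSys.mem_of_ES (hs : MonSys w) {E : Set (ι → ℕ)} (hE : IsUpperSet E) {h : A}
    (hh : ES w h ⊆ E) : h ∈ mI w E := by
  refine hs.cl E h fun k => ?_
  induction k with
  | zero => simp
  | succ k ih =>
    obtain ⟨g, hg, r, hr, rfl⟩ := Submodule.mem_sup.1 ih
    have := mI_step hs.hw hs.mp hr (E := E) (fun e he _ => by
      have h1 : g + r ∈ mI w (bx e) := by
        by_contra hc; exact he (hh hc)
      exact (Ideal.add_mem_iff_right _ (mI_le_bx hE he hg)).1 h1)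
    refine Ideal.add_mem _ (Ideal.mem_sup_left hg) ?_
    have hle : mI w {e | e ∈ E ∧ dg e = k} ≤ mI w E := mI_mono fun e he => he.1
    exact (sup_le_sup_right hle (maximalIdeal A ^ (k + 1)) :) this

lemma ES_sub_of_mem {E : Set (ι → ℕ)} (hE : IsUpperSet E) {h : A}
    (hh : h ∈ mI w E) : ES w h ⊆ E := by
  intro e he
  by_contra hc
  exact he (mI_le_bx hE hc hh)

lemma MonSys.mem_iff (hs : MonSys w) {E : Set (ι → ℕ)} (hE : IsUpperSet E) {h : A} :
    h ∈ mI w E ↔ ES w h ⊆ E := ⟨ES_sub_of_mem hE, hs.mem_of_ES hE⟩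

/-- Dickson -/
lemma exists_gens (E : Set (ι → ℕ)) :
    ∃ F : Finset (ι → ℕ), (∀ a ∈ F, a ∈ E) ∧ (∀ e ∈ E, ∃ a ∈ F, a ≤ e) ∧
      ∀ a ∈ F, ∀ b ∈ F, a ≤ b → a = b := by
  classical
  have hanti : IsAntichain (· ≤ ·) {e | Minimal (· ∈ E) e} := setOfPred_minimal_antichain _
  have hfin : {e | Minimal (· ∈ E) e}.Finite := by
    have hp : Set.PartiallyWellOrderedOn {e | Minimal (· ∈ E) e} (· ≤ ·) :=
      Set.IsPWO.mono (Set.isPWO_of_wellQuasiOrderedLE Set.univ) (Set.subset_univ _)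
    exact hanti.finite_of_partiallyWellOrderedOn hp
  refine ⟨hfin.toFinset, ?_, ?_, ?_⟩
  · intro a ha; exact (hfin.mem_toFinset.1 ha).1
  · intro e he
    obtain ⟨a, hae, ha⟩ := exists_minimal_le_of_wellFoundedLT (· ∈ E) e he
    exact ⟨a, hfin.mem_toFinset.2 ha, hae⟩
  · intro a ha b hb hab
    exact hanti.eq (hfin.mem_toFinset.1 ha) (hfin.mem_toFinset.1 hb) hab

lemma MonSys.unit_exp (hs : MonSys w) (h : A) :
    ∃ (F : Finset (ι → ℕ)) (c : (ι → ℕ) → A), (∀ e ∈ F, e ∈ ES w h ∧ IsUnit (c e)) ∧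
      (∀ e ∈ ES w h, ∃ a ∈ F, a ≤ e) ∧ h = ∑ e ∈ F, c e * mon w e := by
  classical
  obtain ⟨F, hF, hdom, hanti⟩ := exists_gens (ES w h)
  have h1 : h ∈ mI w (F : Set (ι → ℕ)) :=
    mI_dom (fun e he => by simpa using hdom e he) (hs.mem_of_ES (ES_upper w h) subset_rfl)
  have h2 : ∃ c : (ι → ℕ) → A, h = ∑ e ∈ F, c e * mon w e := by
    obtain ⟨G, c, hG, he⟩ := mI_exp h1
    refine ⟨fun e => if e ∈ G then c e else 0, ?_⟩
    rw [he, ← Finset.sum_subset (s₁ := G) (s₂ := F)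
      (f := fun e => (if e ∈ G then c e else 0) * mon w e) (fun e he => by simpa using hG e he)]
    · exact Finset.sum_congr rfl fun e he => by simp [he]
    · intro e _ he; simp [he]
  obtain ⟨c, hc⟩ := h2
  refine ⟨F, c, fun e he => ⟨hF e he, ?_⟩, hdom, hc⟩
  by_contra hnu
  have hm : c e ∈ maximalIdeal A := hnu
  refine hF e he ?_
  rw [hc, ← Finset.add_sum_erase _ _ he]
  refine Ideal.add_mem _ (mul_mon_mem_bx hs.hw hm e) ?_
  refine Ideal.sum_mem _ fun b hb => Ideal.mul_mem_left _ _ (mon_mem ?_)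
  rw [Finset.mem_erase] at hb
  exact fun hle => hb.1 (hanti b hb.2 e he hle)

/-- unit expansions lie in `E` -/
lemma ue_sub (hmp : MP w) {E : Set (ι → ℕ)} (hE : IsUpperSet E) {F : Finset (ι → ℕ)}
    {c : (ι → ℕ) → A} (hc : ∀ e ∈ F, IsUnit (c e)) (h : ∑ e ∈ F, c e * mon w e ∈ mI w E) :
    ∀ e ∈ F, e ∈ E := by
  classical
  by_contra hcon
  push Not at hcon
  obtain ⟨e, he, heE⟩ := hcon
  obtain ⟨a, -, ha⟩ := exists_minimal_le_of_wellFoundedLT (fun e => e ∈ F ∧ e ∉ E) e ⟨he, heE⟩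
  obtain ⟨⟨haF, haE⟩, hmin⟩ := ha
  have h1 := mI_le_bx hE haE h
  rw [← Finset.add_sum_erase _ _ haF] at h1
  have h2 : ∑ x ∈ F.erase a, c x * mon w x ∈ mI w (bx a) := by
    refine Ideal.sum_mem _ fun b hb => Ideal.mul_mem_left _ _ (mon_mem ?_)
    rw [Finset.mem_erase] at hb
    intro hle
    by_cases hbE : b ∈ E
    · exact haE (hE hle hbE)
    · exact hb.1 (le_antisymm hle (hmin ⟨hb.2, hbE⟩ hle))
  have h3 := (Ideal.add_mem_iff_left _ h2).1 h1
  exact hmp a ((Ideal.unit_mul_mem_iff_mem _ (hc a haF)).1 h3)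

lemma MonSys.ES_mul_mon (hs : MonSys w) {x : A} {e : ι → ℕ} (he : e ∈ ES w x) (a : ι → ℕ) :
    e + a ∈ ES w (x * mon w a) := by
  classical
  intro hmem
  obtain ⟨F, c, hF, hdom, rfl⟩ := hs.unit_exp x
  obtain ⟨f, hf, hfe⟩ := hdom e he
  rw [Finset.sum_mul] at hmem
  have h2 : ∑ i ∈ F, c i * mon w i * mon w a
      = ∑ j ∈ F.image (· + a), c (j - a) * mon w j := by
    rw [Finset.sum_image (by intro p _ q _ h; simpa using h)]
    refine Finset.sum_congr rfl fun i _ => ?_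
    simp [mon_add, mul_assoc]
  rw [h2] at hmem
  have := ue_sub hs.mp (E := bx (e + a)) (by
    intro p q hpq hp hq; exact hp (hpq.trans hq)) (by
    intro j hj
    obtain ⟨i, hi, rfl⟩ := Finset.mem_image.1 hj
    simpa using (hF i hi).2) hmem (f + a) (Finset.mem_image_of_mem _ hf)
  exact this (add_le_add_left hfe a)

lemma mon_ES (hmp : MP w) (e : ι → ℕ) : e ∈ ES w (mon w e) := hmp e

end MonIdeals

set_option linter.unusedSectionVars false
section RegDom

lemma wb_cancel (n k : ℕ) (d : WithBot ℕ∞) (h : (n : WithBot ℕ∞) + k ≤ d + k) :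
    (n : WithBot ℕ∞) ≤ d := by
  induction d with
  | bot => simp at h
  | coe d =>
    induction d with
    | top => exact le_top
    | coe d => norm_cast at h ⊢; omega

lemma field_of_bot {A : Type u} [CommRing A] [IsLocalRing A] (h : maximalIdeal A = ⊥) :
    IsField A := IsLocalRing.isField_iff_maximalIdeal_eq.2 h

lemma dom_of_dim (n : ℕ) : ∀ (A : Type u) [CommRing A] [IsLocalRing A] [IsNoetherianRing A]
    (s : Finset A), Ideal.span (s : Set A) = maximalIdeal A → s.card ≤ n →
    (n : WithBot ℕ∞) ≤ ringKrullDim A → IsDomain A := by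
  classical
  induction n with
  | zero =>
    intro A _ _ _ s hs hc _
    have : s = ∅ := by simpa using hc
    subst this
    have hf : IsField A := field_of_bot (by rw [← hs]; simp)
    let _ := hf.toField
    infer_instance
  | succ n ih =>
    intro A _ _ _ s hs hc hd
    have hnf : ¬ IsField A := by
      intro hf
      rw [ringKrullDim_eq_zero_of_isField hf] at hd
      norm_cast at hd
    have hfin := minimalPrimes.finite_of_isNoetherianRing A
    obtain ⟨x, hxM, hx2, hxp⟩ : ∃ x ∈ maximalIdeal A, x ∉ maximalIdeal A ^ 2 ∧
        ∀ p ∈ minimalPrimes A, x ∉ p := by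
      by_contra hcon
      push Not at hcon
      have := (Ideal.subset_union_prime (s := insert (maximalIdeal A ^ 2) hfin.toFinset)
        (f := fun I : Ideal A => I) (maximalIdeal A ^ 2) (maximalIdeal A ^ 2) (by
          intro i hi h1 _
          rw [Finset.mem_insert] at hi
          rcases hi with hi | hi
          · exact absurd hi h1
          · exact Ideal.IsMinimalPrime.isPrime (hfin.mem_toFinset.1 hi)) (I := maximalIdeal A)).1 (by
          intro x hx
          simp only [Set.mem_iUnion]
          by_cases h2 : x ∈ maximalIdeal A ^ 2
          · exact ⟨_, by simp, h2⟩
          · obtain ⟨p, hp, hxp⟩ := hcon x hx h2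
            exact ⟨p, by simp [hp], hxp⟩)
      obtain ⟨p, hp, hle⟩ := this
      rw [Finset.mem_insert] at hp
      rcases hp with rfl | hp
      · have hb : maximalIdeal A = ⊥ := by
          refine Submodule.eq_bot_of_le_smul_of_le_jacobson_bot (maximalIdeal A) _
            (IsNoetherian.noetherian _) ?_ (IsLocalRing.maximalIdeal_le_jacobson _)
          rw [smul_eq_mul, ← pow_two]; exact hle
        exact hnf (field_of_bot hb)
      · have hp' := hfin.mem_toFinset.1 hp
        have hpp := Ideal.IsMinimalPrime.isPrime hp'
        have : p = maximalIdeal A := le_antisymm (IsLocalRing.le_maximalIdeal hpp.ne_top) hle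
        subst this
        have h0 : (maximalIdeal A).height = 0 := by
          exact Ideal.height_eq_zero_iff.2 hp'
        rw [← IsLocalRing.maximalIdeal_height_eq_ringKrullDim, h0] at hd
        norm_cast at hd
    -- exchange
    obtain ⟨t, hts, hspan⟩ : ∃ t ∈ s,
        Ideal.span (insert x (s.erase t : Set A)) = maximalIdeal A := by
      have hx' := hxM
      rw [← hs, Submodule.mem_span_finset'] at hx'
      obtain ⟨a, ha⟩ := hx'
      have : ∃ t : s, a t ∉ maximalIdeal A := by
        by_contra hcon
        push Not at hcon
        apply hx2
        rw [← ha, pow_two]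
        refine Ideal.sum_mem _ fun t _ => Ideal.mul_mem_mul (hcon t) ?_
        rw [← hs]; exact Ideal.subset_span t.2
      obtain ⟨t, ht⟩ := this
      have hu : IsUnit (a t) := by simpa using ht
      refine ⟨t, t.2, le_antisymm ?_ ?_⟩
      · rw [Ideal.span_le]
        rintro y (rfl | hy)
        · exact hxM
        · rw [← hs]; exact Ideal.subset_span (Finset.mem_of_mem_erase hy)
      · conv_lhs => rw [← hs]
        rw [Ideal.span_le]
        intro y hy
        have hmem : ∀ y ∈ s, y ≠ t → y ∈ Ideal.span (insert x (s.erase (t : A) : Set A)) := by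
          intro y hy hne
          exact Ideal.subset_span (Or.inr (by simp [hne, hy]))
        by_cases hyt : y = t
        · subst hyt
          refine (Ideal.unit_mul_mem_iff_mem _ hu).1 ?_
          have hx1 : x ∈ Ideal.span (insert x (s.erase (t : A) : Set A)) :=
            Ideal.subset_span (Or.inl rfl)
          have hx2 : a t * (t : A) + ∑ r ∈ Finset.univ.erase t, a r * (r : A) = x := by
            rw [← ha]; exact Finset.add_sum_erase _ (fun r => a r * (r : A)) (Finset.mem_univ t)
          have hx3 : a t * (t : A) = x - ∑ r ∈ Finset.univ.erase t, a r * (r : A) := by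
            rw [← hx2]; ring
          rw [hx3]
          refine Ideal.sub_mem _ hx1 ?_
          refine Ideal.sum_mem _ fun r hr => Ideal.mul_mem_left _ _ (hmem r r.2 ?_)
          intro h
          exact (Finset.mem_erase.1 hr).1 (Subtype.ext h)
        · exact hmem y hy hyt
    have hnt : Nontrivial (A ⧸ Ideal.span {x}) := by
      rw [Ideal.Quotient.nontrivial_iff]
      intro h
      have : Ideal.span {x} ≤ maximalIdeal A := by simpa [Ideal.span_le] using hxM
      rw [h, top_le_iff] at this
      exact Ideal.IsPrime.ne_top' this
    have : IsLocalRing (A ⧸ Ideal.span {x}) :=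
      IsLocalRing.of_surjective' (Ideal.Quotient.mk _) Ideal.Quotient.mk_surjective
    have hdom : IsDomain (A ⧸ Ideal.span {x}) := by
      refine ih _ ((s.erase t).image (Ideal.Quotient.mk _)) ?_ ?_ ?_
      · have h1 : (maximalIdeal A).map (Ideal.Quotient.mk (Ideal.span {x}))
            = maximalIdeal (A ⧸ Ideal.span {x}) := by
          have hsurj := Ideal.Quotient.mk_surjective (I := Ideal.span {x})
          refine le_antisymm ?_ ?_
          · rw [Ideal.map_le_iff_le_comap]
            exact (IsLocalRing.eq_maximalIdeal (Ideal.comap_isMaximal_of_surjective _ hsurj)).ge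
          · rw [← Ideal.map_comap_of_surjective _ hsurj (maximalIdeal (A ⧸ Ideal.span {x}))]
            refine Ideal.map_mono ?_
            exact (IsLocalRing.eq_maximalIdeal (Ideal.comap_isMaximal_of_surjective _ hsurj)).le
        rw [← h1, ← hspan, Ideal.map_span, Set.image_insert_eq, Finset.coe_image]
        have : Ideal.Quotient.mk (Ideal.span {x}) x = 0 := by
          rw [Ideal.Quotient.eq_zero_iff_mem]; exact Ideal.mem_span_singleton_self x
        rw [this, Ideal.span_insert_zero]
      · refine Finset.card_image_le.trans ?_
        rw [Finset.card_erase_of_mem hts]; omega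
      · have h1 := ringKrullDim_le_ringKrullDim_quotient_add_card ({x} : Finset A) (by
          simp only [Finset.coe_singleton, Set.singleton_subset_iff]
          rw [IsLocalRing.ringJacobson_eq_maximalIdeal]
          exact hxM)
        have h2 := hd.trans h1
        simp only [Finset.coe_singleton, Finset.card_singleton, Nat.cast_add, Nat.cast_one] at h2
        rw [Finset.coe_singleton] at h2
        exact wb_cancel n 1 _ (by simpa using h2)
    have hxprime := (Ideal.Quotient.isDomain_iff_prime _).1 hdom
    obtain ⟨P, hP, hPx⟩ := Ideal.exists_minimalPrimes_le (I := ⊥) (J := Ideal.span {x}) bot_le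
    have hPp : P.IsPrime := Ideal.IsMinimalPrime.isPrime hP
    have hP0 : P = ⊥ := by
      refine Submodule.eq_bot_of_le_smul_of_le_jacobson_bot (maximalIdeal A) _
            (IsNoetherian.noetherian _) ?_ (IsLocalRing.maximalIdeal_le_jacobson _)
      intro p hp
      obtain ⟨q, rfl⟩ := Ideal.mem_span_singleton'.1 (hPx hp)
      rw [smul_eq_mul, mul_comm q]
      refine Ideal.mul_mem_mul hxM ?_
      exact (hPp.mem_or_mem hp).resolve_right (hxp P hP)
    subst hP0
    exact IsDomain.of_bot_isPrime A

end RegDom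

set_option linter.unusedSectionVars false
section RegMP

variable {A : Type u} [CommRing A] [IsLocalRing A] {ι : Type} [Fintype ι] {w : ι → A}

lemma map_max_quot (I : Ideal A) [IsLocalRing (A ⧸ I)] :
    (maximalIdeal A).map (Ideal.Quotient.mk I) = maximalIdeal (A ⧸ I) := by
  have hsurj := Ideal.Quotient.mk_surjective (I := I)
  refine le_antisymm ?_ ?_
  · rw [Ideal.map_le_iff_le_comap]
    exact (IsLocalRing.eq_maximalIdeal (Ideal.comap_isMaximal_of_surjective _ hsurj)).ge
  · rw [← Ideal.map_comap_of_surjective _ hsurj (maximalIdeal (A ⧸ I))]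
    refine Ideal.map_mono ?_
    exact (IsLocalRing.eq_maximalIdeal (Ideal.comap_isMaximal_of_surjective _ hsurj)).le

lemma prime_span [IsNoetherianRing A] (hw : Ideal.span (Set.range w) = maximalIdeal A)
    (hd : (Fintype.card ι : WithBot ℕ∞) ≤ ringKrullDim A) (I : Finset ι) :
    (Ideal.span (w '' I)).IsPrime := by
  classical
  set J := Ideal.span (w '' I) with hJ
  have hJM : J ≤ maximalIdeal A := by
    rw [← hw]; exact Ideal.span_mono (Set.image_subset_range _ _)
  have hnt : Nontrivial (A ⧸ J) := by
    rw [Ideal.Quotient.nontrivial_iff]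
    intro h
    rw [h, top_le_iff] at hJM
    exact Ideal.IsPrime.ne_top' hJM
  have : IsLocalRing (A ⧸ J) :=
    IsLocalRing.of_surjective' (Ideal.Quotient.mk _) Ideal.Quotient.mk_surjective
  rw [← Ideal.Quotient.isDomain_iff_prime]
  refine dom_of_dim (Fintype.card ι - I.card) (A ⧸ J)
    ((Finset.univ \ I).image fun i => Ideal.Quotient.mk J (w i)) ?_ ?_ ?_
  · rw [← map_max_quot, ← hw, Ideal.map_span]
    refine le_antisymm (Ideal.span_mono ?_) ?_
    · intro x hx
      simp only [Finset.coe_image, Set.mem_image] at hx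
      obtain ⟨i, _, rfl⟩ := hx
      exact ⟨_, ⟨i, rfl⟩, rfl⟩
    · rw [Ideal.span_le]
      rintro _ ⟨_, ⟨i, rfl⟩, rfl⟩
      by_cases hi : i ∈ I
      · have : Ideal.Quotient.mk J (w i) = 0 := by
          rw [Ideal.Quotient.eq_zero_iff_mem]; exact Ideal.subset_span ⟨i, hi, rfl⟩
        rw [this]; exact Ideal.zero_mem _
      · exact Ideal.subset_span (by simpa using ⟨i, hi, rfl⟩)
  · refine Finset.card_image_le.trans ?_
    rw [Finset.card_sdiff_of_subset (Finset.subset_univ _), Finset.card_univ]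
  · have h1 := ringKrullDim_le_ringKrullDim_quotient_add_card (I.image w) (by
      rw [IsLocalRing.ringJacobson_eq_maximalIdeal]
      intro x hx
      simp only [Finset.coe_image] at hx
      exact hJM (Ideal.subset_span hx))
    rw [Finset.coe_image] at h1
    refine wb_cancel _ I.card _ ?_
    have h2 : ((Fintype.card ι - I.card : ℕ) : WithBot ℕ∞) + I.card = Fintype.card ι := by
      have := Finset.card_le_univ I
      norm_cast
      omega
    rw [h2]
    refine (hd.trans h1).trans ?_
    have : ((I.image w).card : WithBot ℕ∞) ≤ I.card := by
      norm_cast; exact Finset.card_image_le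
    gcongr

lemma not_mem_span [IsNoetherianRing A] (hw : Ideal.span (Set.range w) = maximalIdeal A)
    (hd : (Fintype.card ι : WithBot ℕ∞) ≤ ringKrullDim A) (I : Finset ι) {i : ι} (hi : i ∉ I) :
    w i ∉ Ideal.span (w '' I) := by
  classical
  intro hmem
  set J := Finset.univ.erase i with hJ
  have hsp : Ideal.span (w '' J) = maximalIdeal A := by
    rw [← hw]
    refine le_antisymm (Ideal.span_mono (Set.image_subset_range _ _)) ?_
    rw [Ideal.span_le]
    rintro _ ⟨j, rfl⟩
    by_cases hj : j = i
    · subst hj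
      refine Ideal.span_mono (Set.image_mono ?_) hmem
      intro k hk
      have : k ≠ j := fun h => hi (h ▸ hk)
      simp [hJ, this]
    · exact Ideal.subset_span ⟨j, by simp [hJ, hj], rfl⟩
  have h1 := ringKrullDim_le_ringKrullDim_quotient_add_card (J.image w) (by
      rw [IsLocalRing.ringJacobson_eq_maximalIdeal, ← hsp]
      intro x hx
      simp only [Finset.coe_image] at hx
      exact Ideal.subset_span hx)
  rw [Finset.coe_image, hsp] at h1
  have h0 : ringKrullDim (A ⧸ maximalIdeal A) = 0 := by
    refine ringKrullDim_eq_zero_of_isField ?_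
    exact (Ideal.Quotient.maximal_ideal_iff_isField_quotient _).1 inferInstance
  rw [h0, zero_add] at h1
  have h2 := hd.trans h1
  have h3 : (J.image w).card ≤ J.card := Finset.card_image_le
  rw [hJ, Finset.card_erase_of_mem (Finset.mem_univ i), Finset.card_univ] at h3
  have h4 : Fintype.card ι ≤ (J.image w).card := by exact_mod_cast h2
  have h5 : 0 < Fintype.card ι := Fintype.card_pos_iff.2 ⟨i⟩
  rw [hJ] at h4
  omega

def Jn (w : ι → A) (I : Finset ι) (n : ι → ℕ) : Ideal A := Ideal.span ((fun j => w j ^ n j) '' I)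

lemma Jn_congr {I : Finset ι} {n n' : ι → ℕ} (h : ∀ i ∈ I, n i = n' i) : Jn w I n = Jn w I n' := by
  unfold Jn
  congr 1
  exact Set.image_congr fun i hi => by simp only [h i hi]

lemma Jn_split [DecidableEq ι] {I : Finset ι} {j : ι} (hj : j ∈ I) (n : ι → ℕ) :
    Jn w I n = Ideal.span {w j ^ n j} ⊔ Jn w (I.erase j) n := by
  unfold Jn
  conv_lhs => rw [← Finset.insert_erase hj]
  rw [Finset.coe_insert, Set.image_insert_eq, Ideal.span_insert]

lemma Jn_nzd [IsNoetherianRing A] (hw : Ideal.span (Set.range w) = maximalIdeal A)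
    (hd : (Fintype.card ι : WithBot ℕ∞) ≤ ringKrullDim A) (k : ℕ) :
    ∀ (I : Finset ι) (n : ι → ℕ), (∀ i ∈ I, 1 ≤ n i) → ∑ i ∈ I, n i ≤ k → ∀ i ∉ I, ∀ x,
      w i * x ∈ Jn w I n → x ∈ Jn w I n := by
  classical
  induction k with
  | zero =>
    intro I n h1 hs i hi x hx
    have : I = ∅ := by
      by_contra hne
      obtain ⟨j, hj⟩ := Finset.nonempty_iff_ne_empty.2 hne
      have := Finset.single_le_sum (f := n) (fun i _ => Nat.zero_le _) hj
      have := h1 j hj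
      omega
    subst this
    have hp := prime_span hw hd ∅
    have hn := not_mem_span hw hd ∅ hi
    unfold Jn at hx ⊢
    simp only [Finset.coe_empty, Set.image_empty] at hp hn hx ⊢
    exact (hp.mem_or_mem hx).resolve_left hn
  | succ k ih =>
    intro I n h1 hs i hi x hx
    by_cases hall : ∀ j ∈ I, n j = 1
    · have hp := prime_span hw hd I
      have hn := not_mem_span hw hd I hi
      have he : Jn w I n = Ideal.span (w '' I) := by
        unfold Jn; congr 1; exact Set.image_congr fun j hj => by simp [hall j hj]
      rw [he] at hx ⊢
      exact (hp.mem_or_mem hx).resolve_left hn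
    · push Not at hall
      obtain ⟨j, hj, hnj⟩ := hall
      have hnj2 : 2 ≤ n j := by have := h1 j hj; omega
      have hij : i ≠ j := fun h => hi (h ▸ hj)
      have hsum := Finset.add_sum_erase I n hj
      have hupd : ∀ t, Jn w I (Function.update n j t)
          = Ideal.span {w j ^ t} ⊔ Jn w (I.erase j) n := by
        intro t
        rw [Jn_split hj, Function.update_self]
        congr 1
        refine Jn_congr fun i hi => ?_
        rw [Function.update_of_ne (Finset.ne_of_mem_erase hi)]
      have hus : ∀ t, ∑ i ∈ I, Function.update n j t i = t + ∑ i ∈ I.erase j, n i := by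
        intro t
        rw [← Finset.add_sum_erase I _ hj, Function.update_self]
        congr 1
        exact Finset.sum_congr rfl fun i hi => by
          rw [Function.update_of_ne (Finset.ne_of_mem_erase hi)]
      have hup : ∀ t, 1 ≤ t → ∀ i ∈ I, 1 ≤ Function.update n j t i := by
        intro t ht i hi
        by_cases h : i = j
        · subst h; simpa using ht
        · rw [Function.update_of_ne h]; exact h1 i hi
      rw [Jn_split hj] at hx ⊢
      have hx1 : x ∈ Jn w I (Function.update n j 1) := by
        refine ih I _ (hup 1 le_rfl) (by rw [hus]; omega) i hi x ?_
        rw [hupd]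
        refine (sup_le_sup_right ?_ (Jn w (I.erase j) n) :) hx
        rw [Ideal.span_singleton_le_span_singleton]
        exact pow_dvd_pow _ (by omega)
      rw [hupd, pow_one] at hx1
      obtain ⟨_, ha, r, hr, rfl⟩ := Submodule.mem_sup.1 hx1
      obtain ⟨y, rfl⟩ := Ideal.mem_span_singleton'.1 ha
      obtain ⟨_, hb, r', hr', he⟩ := Submodule.mem_sup.1 hx
      obtain ⟨t, rfl⟩ := Ideal.mem_span_singleton'.1 hb
      have h2 : w j * (w i * y - t * w j ^ (n j - 1)) ∈ Jn w (I.erase j) n := by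
        have e1 : w j ^ n j = w j * w j ^ (n j - 1) := by
          rw [← pow_succ']; congr 1; omega
        have e2 : w j * (w i * y - t * w j ^ (n j - 1)) = r' - w i * r := by
          rw [e1] at he; linear_combination (-1 : A) * he
        rw [e2]
        exact Ideal.sub_mem _ hr' (Ideal.mul_mem_left _ _ hr)
      have h3 := ih (I.erase j) n (fun i hi => h1 i (Finset.mem_of_mem_erase hi)) (by omega) j
        (Finset.notMem_erase j I) _ h2
      have h4 : y ∈ Jn w I (Function.update n j (n j - 1)) := by
        refine ih I _ (hup _ (by omega)) (by rw [hus]; omega) i hi y ?_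
        rw [hupd]
        refine Submodule.mem_sup.2 ⟨t * w j ^ (n j - 1),
          Ideal.mul_mem_left _ _ (Ideal.mem_span_singleton_self _), _, h3, by ring⟩
      rw [hupd] at h4
      obtain ⟨_, ha2, r2, hr2, rfl⟩ := Submodule.mem_sup.1 h4
      obtain ⟨y2, rfl⟩ := Ideal.mem_span_singleton'.1 ha2
      have e1 : w j ^ n j = w j ^ (n j - 1) * w j := by
          rw [← pow_succ]; congr 1; omega
      refine Submodule.mem_sup.2 ⟨y2 * w j ^ n j,
          Ideal.mul_mem_left _ _ (Ideal.mem_span_singleton_self _), r2 * w j + r,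
          Ideal.add_mem _ (Ideal.mul_mem_right _ _ hr2) hr, by rw [e1]; ring⟩

lemma mp_of_dim [IsNoetherianRing A] (hw : Ideal.span (Set.range w) = maximalIdeal A)
    (hd : (Fintype.card ι : WithBot ℕ∞) ≤ ringKrullDim A) : MP w := by
  classical
  intro e he
  have hle : mI w (bx e) ≤ Jn w Finset.univ (fun i => e i + 1) := by
    refine mI_le fun a ha => ?_
    have : ∃ i, e i + 1 ≤ a i := by
      by_contra hc
      push Not at hc
      exact ha fun i => Nat.lt_succ_iff.1 (hc i)
    obtain ⟨i, hi⟩ := this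
    unfold mon
    rw [← Finset.mul_prod_erase _ _ (Finset.mem_univ i)]
    refine Ideal.mul_mem_right _ _ (Ideal.mem_of_dvd _ (pow_dvd_pow _ hi) ?_)
    exact Ideal.subset_span ⟨i, by simp, rfl⟩
  have key : ∀ K : Finset ι, ∏ i ∈ K, w i ^ e i ∉
      Jn w Finset.univ (fun i => if i ∈ K then e i + 1 else 1) := by
    intro K
    induction K using Finset.induction_on with
    | empty =>
      intro h
      simp only [Finset.prod_empty, Finset.notMem_empty, if_false] at h
      have : Jn w Finset.univ (fun _ => 1) ≤ maximalIdeal A := by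
        rw [← hw]; unfold Jn; refine Ideal.span_mono ?_
        rintro _ ⟨i, _, rfl⟩
        exact ⟨i, by simp⟩
      exact (maximalIdeal.isMaximal A).ne_top ((Ideal.eq_top_iff_one _).2 (this h))
    | insert i K hi ih =>
      intro h
      apply ih
      rw [Finset.prod_insert hi, Jn_split (Finset.mem_univ i)] at h
      rw [Jn_split (Finset.mem_univ i)]
      simp only [Finset.mem_insert, true_or, if_true, hi, if_false, pow_one] at h ⊢
      have hc : Jn w (Finset.univ.erase i) (fun j => if j = i ∨ j ∈ K then e j + 1 else 1)
          = Jn w (Finset.univ.erase i) (fun j => if j ∈ K then e j + 1 else 1) := by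
        refine Jn_congr fun j hj => ?_
        simp [Finset.ne_of_mem_erase hj]
      rw [hc] at h
      obtain ⟨_, ha, r, hr, he⟩ := Submodule.mem_sup.1 h
      obtain ⟨t, rfl⟩ := Ideal.mem_span_singleton'.1 ha
      have h2 : ∀ N x, w i ^ N * x ∈
          Jn w (Finset.univ.erase i) (fun j => if j ∈ K then e j + 1 else 1) →
          x ∈ Jn w (Finset.univ.erase i) (fun j => if j ∈ K then e j + 1 else 1) := by
        intro N
        induction N with
        | zero => intro x hx; simpa using hx
        | succ N ihN =>
          intro x hx
          refine ihN x (Jn_nzd hw hd _ _ _ ?_ le_rfl i (Finset.notMem_erase i _) _ ?_)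
          · intro j _; split_ifs <;> omega
          · rwa [← mul_assoc, ← pow_succ']
      have h3 := h2 (e i) (∏ i ∈ K, w i ^ e i - t * w i) (by
        have : w i ^ e i * (∏ i ∈ K, w i ^ e i - t * w i) = r := by
          linear_combination -he
        rwa [this])
      exact Submodule.mem_sup.2 ⟨t * w i,
        Ideal.mul_mem_left _ _ (Ideal.mem_span_singleton_self _), _, h3, by ring⟩
  refine key Finset.univ ?_
  simpa [mon] using hle he

lemma cl_noeth [IsNoetherianRing A] (I : Ideal A) (h : A)
    (hh : ∀ k, h ∈ I ⊔ maximalIdeal A ^ k) : h ∈ I := by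
  rw [← Ideal.Quotient.eq_zero_iff_mem]
  have := Ideal.iInf_pow_smul_eq_bot_of_isLocalRing (M := A ⧸ I) (maximalIdeal A)
    Ideal.IsPrime.ne_top'
  have hm : Ideal.Quotient.mk I h ∈ (⊥ : Submodule A (A ⧸ I)) := by
    rw [← this, Submodule.mem_iInf]
    intro k
    obtain ⟨a, ha, b, hb, rfl⟩ := Submodule.mem_sup.1 (hh k)
    rw [map_add, Ideal.Quotient.eq_zero_iff_mem.2 ha, zero_add]
    have : Ideal.Quotient.mk I b = b • (1 : A ⧸ I) := by
      rw [Algebra.smul_def, mul_one]; rfl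
    rw [this]
    exact Submodule.smul_mem_smul hb trivial
  simpa using hm

lemma monSys_of_dim [IsNoetherianRing A] (hw : Ideal.span (Set.range w) = maximalIdeal A)
    (hd : (Fintype.card ι : WithBot ℕ∞) ≤ ringKrullDim A) : MonSys w :=
  ⟨hw, mp_of_dim hw hd, fun _ h hh => cl_noeth _ h hh⟩

lemma lim_exists [IsAdicComplete (maximalIdeal A) A] (f : ℕ → A)
    (hf : ∀ n, f (n + 1) - f n ∈ maximalIdeal A ^ n) :
    ∃ L, ∀ n, L - f n ∈ maximalIdeal A ^ n := by
  have h1 : ∀ {m n}, m ≤ n → f n - f m ∈ maximalIdeal A ^ m := by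
    intro m n hmn
    induction n, hmn using Nat.le_induction with
    | base => simp
    | succ n hmn ih =>
      have := Ideal.add_mem _ (Ideal.pow_le_pow_right hmn (hf n)) ih
      simpa using this
  obtain ⟨L, hL⟩ := IsPrecomplete.prec (I := maximalIdeal A) (M := A) inferInstance (f := f) (by
    intro m n hmn
    rw [SModEq.sub_mem, smul_eq_mul, Ideal.mul_top, ← neg_mem_iff, neg_sub]
    exact h1 hmn)
  refine ⟨L, fun n => ?_⟩
  have := hL n
  rwa [SModEq.sub_mem, smul_eq_mul, Ideal.mul_top, ← neg_mem_iff, neg_sub] at this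

lemma haus_zero [IsAdicComplete (maximalIdeal A) A] (x : A)
    (hx : ∀ n, x ∈ maximalIdeal A ^ n) : x = 0 := by
  refine IsHausdorff.haus (I := maximalIdeal A) (M := A) inferInstance x fun n => ?_
  rw [SModEq.zero, smul_eq_mul, Ideal.mul_top]; exact hx n

lemma cl_complete [IsAdicComplete (maximalIdeal A) A]
    (hw : Ideal.span (Set.range w) = maximalIdeal A) (hmp : MP w) (E : Set (ι → ℕ)) (h : A)
    (hh : ∀ k, h ∈ mI w E ⊔ maximalIdeal A ^ k) : h ∈ mI w E := by
  classical
  obtain ⟨F, hF, hdom, -⟩ := exists_gens E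
  set E' : Set (ι → ℕ) := {e | ∃ a ∈ F, a ≤ e} with hE'
  have hup : IsUpperSet E' := by
    rintro a b hab ⟨c, hc, hca⟩; exact ⟨c, hc, hca.trans hab⟩
  have hEE : mI w E ≤ mI w E' := mI_mono fun e he => hdom e he
  have hE'E : mI w E' ≤ mI w E := mI_dom fun e ⟨a, ha, hae⟩ => ⟨a, hF a ha, hae⟩
  set D := ∑ a ∈ F, dg a with hD
  have hFD : ∀ a ∈ F, dg a ≤ D := fun a ha =>
    Finset.single_le_sum (f := dg) (fun _ _ => Nat.zero_le _) ha
  have hstep : ∀ k (r : A), r ∈ maximalIdeal A ^ k → r ∈ mI w E' ⊔ maximalIdeal A ^ (k + 1) →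
      ∃ y : (ι → ℕ) → A, (∀ a, y a ∈ maximalIdeal A ^ (k - D)) ∧
        r - ∑ a ∈ F, y a * mon w a ∈ maximalIdeal A ^ (k + 1) := by
    intro k r hr hr2
    have h1 := mI_step hw hmp hr (E := E') (fun e he hde => by
      refine (sup_le (mI_le_bx hup he) (pow_le_bx hw ?_) :
        mI w E' ⊔ maximalIdeal A ^ (k + 1) ≤ _) hr2
      omega)
    obtain ⟨g, hg, r', hr', rfl⟩ := Submodule.mem_sup.1 h1
    have h2 : mI w {e | e ∈ E' ∧ dg e = k} ≤
        maximalIdeal A ^ (k - D) • Ideal.span (mon w '' (F : Set (ι → ℕ))) := by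
      refine mI_le ?_
      rintro e ⟨⟨a, ha, hae⟩, hde⟩
      have he : e = (e - a) + a := (tsub_add_cancel_of_le hae).symm
      rw [he, mon_add]
      refine Submodule.smul_mem_smul (mon_mem_pow hw ?_) (Ideal.subset_span ⟨a, ha, rfl⟩)
      have := congrArg dg he
      rw [dg_add] at this
      have := hFD a ha
      omega
    obtain ⟨c, hc, hcs⟩ := (Submodule.mem_ideal_smul_span_iff_exists_sum' _ _ _ _).1 (h2 hg)
    refine ⟨fun a => if h : a ∈ (F : Set (ι → ℕ)) then c ⟨a, h⟩ else 0, ?_, ?_⟩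
    · intro a
      dsimp only
      split_ifs with h
      · exact hc _
      · exact Ideal.zero_mem _
    · have : ∑ a ∈ F, (if h : a ∈ (F : Set (ι → ℕ)) then c ⟨a, h⟩ else 0) * mon w a = g := by
        rw [← hcs, Finsupp.sum_fintype _ _ (by simp), ← Finset.sum_coe_sort F]
        refine Finset.sum_congr rfl fun a _ => ?_
        simp
      rw [this]
      simpa using hr'
  choose! y hy1 hy2 using hstep
  let c : ℕ → (ι → ℕ) → A := fun n => Nat.rec (fun _ => 0)
    (fun k ck => fun a => ck a + y k (h - ∑ a ∈ F, ck a * mon w a) a) n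
  have hcs : ∀ k a, c (k + 1) a = c k a + y k (h - ∑ a ∈ F, c k a * mon w a) a := fun k a => rfl
  have hin : ∀ k, ∑ a ∈ F, c k a * mon w a ∈ mI w E' := fun k =>
    Ideal.sum_mem _ fun a ha => Ideal.mul_mem_left _ _ (mon_mem ⟨a, ha, le_rfl⟩)
  have hsup : ∀ k j, h - ∑ a ∈ F, c k a * mon w a ∈ mI w E' ⊔ maximalIdeal A ^ j := fun k j =>
    Ideal.sub_mem _ ((sup_le_sup_right hEE (maximalIdeal A ^ j) :) (hh j))
      (Ideal.mem_sup_left (hin k))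
  have hr : ∀ k, h - ∑ a ∈ F, c k a * mon w a ∈ maximalIdeal A ^ k := by
    intro k
    induction k with
    | zero => simp
    | succ k ih =>
      have := hy2 k _ ih (hsup k _)
      have e : h - ∑ a ∈ F, c (k + 1) a * mon w a = h - ∑ a ∈ F, c k a * mon w a -
          ∑ a ∈ F, y k (h - ∑ a ∈ F, c k a * mon w a) a * mon w a := by
        simp only [hcs, add_mul, Finset.sum_add_distrib]; ring
      rw [e]; exact this
  have hlim : ∀ a, ∃ L, ∀ n, L - c (n + D) a ∈ maximalIdeal A ^ n := by
    intro a
    refine lim_exists (fun n => c (n + D) a) fun n => ?_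
    have e : n + 1 + D = (n + D) + 1 := by omega
    rw [e, hcs, add_sub_cancel_left]
    have := hy1 (n + D) _ (hr _) (hsup _ _) a
    simpa using this
  choose L hL using hlim
  have hfin : h = ∑ a ∈ F, L a * mon w a := by
    rw [← sub_eq_zero]
    refine haus_zero _ fun n => ?_
    have e : h - ∑ a ∈ F, L a * mon w a = (h - ∑ a ∈ F, c (n + D) a * mon w a) -
        ∑ a ∈ F, (L a - c (n + D) a) * mon w a := by
      simp only [sub_mul, Finset.sum_sub_distrib]; ring
    rw [e]
    refine Ideal.sub_mem _ (Ideal.pow_le_pow_right (by omega) (hr (n + D))) ?_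
    exact Ideal.sum_mem _ fun a _ => Ideal.mul_mem_right _ _ (hL a n)
  rw [hfin]
  exact Ideal.sum_mem _ fun a ha => Ideal.mul_mem_left _ _ (mon_mem (hF a ha))

lemma monSys_of_complete [IsAdicComplete (maximalIdeal A) A]
    (hw : Ideal.span (Set.range w) = maximalIdeal A) (hmp : MP w) : MonSys w :=
  ⟨hw, hmp, fun E h hh => cl_complete hw hmp E h hh⟩

end RegMP

set_option linter.unusedSectionVars false

section Weights

variable {ι : Type*} [Fintype ι]

def wt (L : ι → ℝ) (e : ι → ℕ) : ℝ := ∑ i, L i * (e i : ℝ)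

def GE (L : ι → ℝ) (l : ℝ) : Set (ι → ℕ) := {e | l ≤ wt L e}
def GT (L : ι → ℝ) (l : ℝ) : Set (ι → ℕ) := {e | l < wt L e}

lemma wt_add (L : ι → ℝ) (a b : ι → ℕ) : wt L (a + b) = wt L a + wt L b := by
  simp [wt, mul_add, Finset.sum_add_distrib]

lemma wt_nsmul (L : ι → ℝ) (n : ℕ) (a : ι → ℕ) : wt L (n • a) = n * wt L a := by
  simp only [wt, Finset.mul_sum]
  refine Finset.sum_congr rfl fun i _ => ?_
  simp; ring

lemma wt_zero (L : ι → ℝ) : wt L 0 = 0 := by simp [wt]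

lemma wt_mono {L : ι → ℝ} (hL : ∀ i, 0 ≤ L i) {a b : ι → ℕ} (h : a ≤ b) : wt L a ≤ wt L b :=
  Finset.sum_le_sum fun i _ => mul_le_mul_of_nonneg_left (by exact_mod_cast h i) (hL i)

lemma wt_mono_left {L L' : ι → ℝ} (h : ∀ i, L i ≤ L' i) (a : ι → ℕ) : wt L a ≤ wt L' a :=
  Finset.sum_le_sum fun i _ => mul_le_mul_of_nonneg_right (h i) (Nat.cast_nonneg _)

lemma wt_nonneg {L : ι → ℝ} (hL : ∀ i, 0 ≤ L i) (a : ι → ℕ) : 0 ≤ wt L a :=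
  Finset.sum_nonneg fun i _ => mul_nonneg (hL i) (Nat.cast_nonneg _)

lemma GE_upper {L : ι → ℝ} (hL : ∀ i, 0 ≤ L i) (l : ℝ) : IsUpperSet (GE L l) :=
  fun _ _ hab ha => le_trans ha (wt_mono hL hab)

lemma GT_upper {L : ι → ℝ} (hL : ∀ i, 0 ≤ L i) (l : ℝ) : IsUpperSet (GT L l) :=
  fun _ _ hab ha => lt_of_lt_of_le ha (wt_mono hL hab)

section
variable {A : Type*} [CommRing A] {w : ι → A} {L : ι → ℝ}

lemma GT_le_GE (l : ℝ) : mI w (GT L l) ≤ mI w (GE L l) :=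
  mI_mono fun _ h => by simp only [GE, GT, Set.mem_ofPred_eq] at *; exact h.le

lemma GE_anti {l l' : ℝ} (h : l ≤ l') : mI w (GE L l') ≤ mI w (GE L l) :=
  mI_mono fun _ h' => le_trans h h'

lemma GT_anti {l l' : ℝ} (h : l ≤ l') : mI w (GT L l') ≤ mI w (GT L l) :=
  mI_mono fun _ h' => lt_of_le_of_lt h h'

lemma GE_le_GT {l l' : ℝ} (h : l < l') : mI w (GE L l') ≤ mI w (GT L l) :=
  mI_mono fun _ h' => lt_of_lt_of_le h h'

lemma GE_zero (hL : ∀ i, 0 ≤ L i) {l : ℝ} (hl : l ≤ 0) (x : A) : x ∈ mI w (GE L l) := by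
  have : GE L l = Set.univ := Set.eq_univ_of_forall fun a => le_trans hl (wt_nonneg hL a)
  rw [this, mI_univ]; trivial

lemma GE_mul {a b : ℝ} {x y : A} (hx : x ∈ mI w (GE L a)) (hy : y ∈ mI w (GE L b)) :
    x * y ∈ mI w (GE L (a + b)) :=
  mI_mul (fun p hp q hq => by
    simp only [GE, Set.mem_ofPred_eq] at *; rw [wt_add]; linarith) hx hy

lemma GT_mul {a b : ℝ} {x y : A} (hx : x ∈ mI w (GT L a)) (hy : y ∈ mI w (GE L b)) :
    x * y ∈ mI w (GT L (a + b)) :=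
  mI_mul (fun p hp q hq => by
    simp only [GE, GT, Set.mem_ofPred_eq] at *; rw [wt_add]; linarith) hx hy

lemma GE_pow {a : ℝ} {x : A} (hx : x ∈ mI w (GE L a)) (n : ℕ) :
    x ^ n ∈ mI w (GE L (n * a)) := by
  induction n with
  | zero =>
    rw [pow_zero, ← mon_zero w]
    exact mon_mem (by simp [GE, wt_zero])
  | succ n ih =>
    rw [pow_succ]
    have := GE_mul ih hx
    convert this using 3
    push_cast; ring

lemma mul_congr {a b : ℝ} {x x' y y' : A} (hx : x' ∈ mI w (GE L a)) (hy : y ∈ mI w (GE L b))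
    (hxx : x - x' ∈ mI w (GT L a)) (hyy : y - y' ∈ mI w (GT L b)) :
    x * y - x' * y' ∈ mI w (GT L (a + b)) := by
  have h1 := GT_mul hxx hy
  have h2 := GT_mul hyy hx
  rw [add_comm b a] at h2
  have : x * y - x' * y' = (x - x') * y + (y - y') * x' := by ring
  rw [this]
  exact Ideal.add_mem _ h1 h2

lemma pow_congr {a : ℝ} {x x' : A} (hx : x' ∈ mI w (GE L a)) (hxx : x - x' ∈ mI w (GT L a))
    (n : ℕ) : x ^ n - x' ^ n ∈ mI w (GT L (n * a)) := by
  have hx1 : x ∈ mI w (GE L a) := by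
    have := Ideal.add_mem _ (GT_le_GE _ hxx) hx
    simpa using this
  induction n with
  | zero => simp
  | succ n ih =>
    rw [pow_succ, pow_succ]
    have := mul_congr (GE_pow hx n) hx1 ih hxx
    convert this using 3
    push_cast; ring

end

lemma generic (L : ι → ℝ) (I : Finset ι) (hL : ∀ i, 0 ≤ L i) (hI : ∀ i, i ∉ I → L i = 0)
    (x : ι → ℝ) (l : ℝ) (hx : ∑ i, L i * x i < l) :
    ∃ L' : ι → ℝ, (∀ i, L i ≤ L' i) ∧ (∀ i ∈ I, 0 < L' i) ∧ (∀ i, i ∉ I → L' i = 0) ∧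
      (∀ e e' : ι → ℕ, wt L' e = wt L' e' → ∀ i ∈ I, e i = e' i) ∧ ∑ i, L' i * x i < l := by
  classical
  let n : ι → ℕ := fun i => (Fintype.equivFin ι i : ℕ)
  have hn : ∀ i j, n i = n j → i = j := fun i j h => by
    have : Fintype.equivFin ι i = Fintype.equivFin ι j := Fin.ext h
    simpa using this
  let M : ℝ → ι → ℝ := fun ε i => if i ∈ I then L i + ε ^ (n i + 1) else 0
  -- polynomial
  let Pp : (ι → ℕ) → (ι → ℕ) → Polynomial ℝ := fun e e' =>
    ∑ i ∈ I, (Polynomial.C (L i) + Polynomial.X ^ (n i + 1)) *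
      Polynomial.C ((e i : ℝ) - e' i)
  have hPe : ∀ ε e e', (Pp e e').eval ε = wt (M ε) e - wt (M ε) e' := by
    intro ε e e'
    simp only [Pp, wt, M, Polynomial.eval_finsetSum, ← Finset.sum_sub_distrib]
    rw [← Finset.sum_subset (Finset.subset_univ I)]
    · refine Finset.sum_congr rfl fun i hi => ?_
      simp [hi]; ring
    · intro i _ hi; simp [hi]
  have hPne : ∀ e e', (∃ i ∈ I, e i ≠ e' i) → Pp e e' ≠ 0 := by
    rintro e e' ⟨i, hi, hne⟩ h0
    have h1 : (Pp e e').coeff (n i + 1) = 0 := by rw [h0]; simp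
    simp only [Pp, Polynomial.finsetSum_coeff, Polynomial.coeff_mul_C, Polynomial.coeff_add,
      Polynomial.coeff_C_succ, Polynomial.coeff_X_pow, zero_add] at h1
    rw [Finset.sum_eq_single i] at h1
    · simp only [if_true, one_mul] at h1
      exact hne (by exact_mod_cast sub_eq_zero.1 h1)
    · intro j _ hj
      rw [if_neg]; · simp
      intro h; exact hj (hn _ _ (by omega))
    · intro h; exact absurd hi h
  let B : Set ℝ := ⋃ p ∈ {p : (ι → ℕ) × (ι → ℕ) | ∃ i ∈ I, p.1 i ≠ p.2 i},
    {ε | (Pp p.1 p.2).IsRoot ε}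
  have hB : B.Countable := by
    refine Set.Countable.biUnion (Set.to_countable _) fun p hp => ?_
    exact (Polynomial.finite_setOfPred_isRoot (hPne _ _ hp)).countable
  have hcont : Continuous fun ε => ∑ i, M ε i * x i := by
    refine continuous_finsetSum _ fun i _ => ?_
    simp only [M]
    split_ifs <;> fun_prop
  have h0 : ∑ i, M 0 i * x i < l := by
    convert hx using 2 with i
    simp only [M]
    split_ifs with hi
    · simp
    · simp [hI i hi]
  have hop : IsOpen {ε | ∑ i, M ε i * x i < l} := isOpen_lt hcont continuous_const
  obtain ⟨δ, hδ, hball⟩ := Metric.isOpen_iff.1 hop 0 h0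
  have hunc : ¬ (Set.Ioo (0:ℝ) δ).Countable := by
    rw [← Cardinal.le_aleph0_iff_set_countable, Cardinal.mk_Ioo_real hδ, not_le]
    exact Cardinal.aleph0_lt_continuum
  have : ∃ ε ∈ Set.Ioo (0:ℝ) δ, ε ∉ B := by
    by_contra hc
    push Not at hc
    exact hunc (hB.mono hc)
  obtain ⟨ε, ⟨he0, heδ⟩, heB⟩ := this
  refine ⟨M ε, ?_, ?_, ?_, ?_, ?_⟩
  · intro i
    simp only [M]
    split_ifs with hi
    · have := pow_pos he0 (n i + 1); linarith
    · exact (hI i hi).le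
  · intro i hi
    simp only [M, hi, if_true]
    have := pow_pos he0 (n i + 1); have := hL i; linarith
  · intro i hi; simp [M, hi]
  · intro e e' h i hi
    by_contra hne
    refine heB (Set.mem_biUnion (x := (e, e')) ⟨i, hi, hne⟩ ?_)
    change (Pp e e').eval ε = 0
    rw [hPe, h, sub_self]
  · refine hball ?_
    simp [abs_of_pos he0, heδ]

lemma hb_cone (K : Set (ι → ℝ)) (I : Finset ι) (hK : IsClosed K) (hc : Convex ℝ K)
    (hadd : ∀ k ∈ K, ∀ v : ι → ℝ, (∀ i ∈ I, 0 ≤ v i) → k + v ∈ K) (x : ι → ℝ) (hx : x ∉ K) :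
    ∃ (L : ι → ℝ) (l : ℝ), (∀ i, 0 ≤ L i) ∧ (∀ i, i ∉ I → L i = 0) ∧ ∑ i, L i * x i < l ∧
      ∀ p ∈ K, l ≤ ∑ i, L i * p i := by
  classical
  rcases K.eq_empty_or_nonempty with rfl | ⟨k, hk⟩
  · exact ⟨0, 1, by simp, by simp, by simp, by simp⟩
  obtain ⟨φ, l, h1, h2⟩ := geometric_hahn_banach_point_closed hc hK hx
  have hφ : ∀ p, φ p = ∑ i, φ (Pi.single i 1) * p i := by
    intro p
    have := φ.toLinearMap.pi_apply_eq_sum_univ p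
    simp only [ContinuousLinearMap.coe_coe, smul_eq_mul] at this
    rw [this]
    refine Finset.sum_congr rfl fun i _ => ?_
    rw [mul_comm]; congr 2
    ext j
    simp [Pi.single_apply, eq_comm]
  have hpos : ∀ v : ι → ℝ, (∀ i ∈ I, 0 ≤ v i) → 0 ≤ φ v := by
    intro v hv
    by_contra hneg
    push Not at hneg
    have h3 := h2 _ (hadd k hk (((φ k - l) / (- φ v)) • v) (fun i hi => by
      have := h2 k hk
      exact mul_nonneg (div_nonneg (by linarith) (by linarith)) (hv i hi)))
    rw [map_add, map_smul, smul_eq_mul, div_mul_eq_mul_div, div_neg, mul_div_assoc,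
      div_self hneg.ne, mul_one] at h3
    linarith
  refine ⟨fun i => φ (Pi.single i 1), l, ?_, ?_, ?_, ?_⟩
  · intro i
    refine hpos _ fun j _ => ?_
    rw [Pi.single_apply]; split_ifs <;> norm_num
  · intro i hi
    apply le_antisymm
    · have := hpos (- Pi.single i 1) (fun j hj => by
        have : j ≠ i := fun h => hi (h ▸ hj)
        simp [this])
      rw [map_neg] at this
      simpa using this
    · refine hpos _ fun j _ => ?_
      rw [Pi.single_apply]; split_ifs <;> norm_num
  · rw [← hφ]; exact h1
  · intro p hp; rw [← hφ]; exact (h2 p hp).le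

/-- finite version -/
lemma hb_finite (F : Set (ι → ℝ)) (hF : F.Finite) (I : Finset ι) (x : ι → ℝ)
    (hx : ∀ p ∈ convexHull ℝ F, ∃ i ∈ I, x i < p i) :
    ∃ (L : ι → ℝ) (l : ℝ), (∀ i, 0 ≤ L i) ∧ (∀ i, i ∉ I → L i = 0) ∧ ∑ i, L i * x i < l ∧
      ∀ p ∈ F, l ≤ ∑ i, L i * p i := by
  have hcc : IsClosed {v : ι → ℝ | ∀ i ∈ I, 0 ≤ v i} := by
    simp only [Set.ofPred_forall]
    exact isClosed_biInter fun i _ => isClosed_le continuous_const (continuous_apply i)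
  have hcv : Convex ℝ {v : ι → ℝ | ∀ i ∈ I, 0 ≤ v i} := by
    intro v hv w hw a b ha hb _ i hi
    have := hv i hi
    have := hw i hi
    simp only [Pi.add_apply, Pi.smul_apply, smul_eq_mul]
    positivity
  open Pointwise in
  obtain ⟨L, l, h1, h2, h3, h4⟩ := hb_cone (convexHull ℝ F + {v : ι → ℝ | ∀ i ∈ I, 0 ≤ v i}) I
    (hcc.add_left_of_isCompact (hF.isCompact_convexHull (𝕜 := ℝ))) ((convex_convexHull ℝ F).add hcv) (by
      rintro _ ⟨p, hp, v, hv, rfl⟩ v' hv'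
      exact ⟨p, hp, v + v', fun i hi => add_nonneg (hv i hi) (hv' i hi), by simp [add_assoc]⟩) x (by
      rintro ⟨p, hp, v, hv, rfl⟩
      obtain ⟨i, hi, h⟩ := hx p hp
      have := hv i hi
      simp at h; linarith)
  refine ⟨L, l, h1, h2, h3, fun p hp => h4 p ?_⟩
  exact ⟨p, subset_convexHull ℝ F hp, 0, by simp, by simp⟩

end Weights

set_option linter.unusedSectionVars false

section PolyG

variable {A : Type u} [CommRing A] {ι : Type} [Fintype ι]

def Gp (w : ι → A) (f : Polynomial A) (m : ℕ) (φ : A) (L : ι → ℝ) (l : ℝ) : Prop :=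
  ∀ b < m, (Polynomial.taylor φ f).coeff b ∈ mI w (GE L (((m : ℝ) - b) * l))

def Le (w : ι → A) (f : Polynomial A) (m : ℕ) (φ' φ : A) : Prop :=
  ∀ (L : ι → ℝ) (l : ℝ), (∀ i, 0 ≤ L i) → Gp w f m φ L l → Gp w f m φ' L l

def JJ (w : ι → A) (f : Polynomial A) (m : ℕ) (φ : A) : Set (ι → ℕ) :=
  {a | ∀ (L : ι → ℝ) (l : ℝ), (∀ i, 0 ≤ L i) → Gp w f m φ L l → l ≤ wt L a}

lemma taylor_sum (g : Polynomial A) (m : ℕ) (hd : g.natDegree ≤ m) (h : A) (b : ℕ) :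
    (Polynomial.taylor h g).coeff b
      = ∑ j ∈ Finset.range (m + 1), (j.choose b : A) * g.coeff j * h ^ (j - b) := by
  rw [Polynomial.taylor_coeff, Polynomial.hasseDeriv_apply, Polynomial.sum_over_range' _ _ (m+1)]
  · simp [Polynomial.eval_finsetSum]
  · omega
  · simp

variable {w : ι → A} {f : Polynomial A} {m : ℕ}

lemma taylor_monic_coeff (hf : f.Monic) (hd : f.natDegree = m) (φ : A) :
    (Polynomial.taylor φ f).coeff m = 1 := by
  rw [← hd, Polynomial.coeff_taylor_natDegree, hf.leadingCoeff]

lemma taylor_shift (hf : f.Monic) (hd : f.natDegree = m) (φ h : A) (b : ℕ) :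
    (Polynomial.taylor (φ + h) f).coeff b
      = ∑ j ∈ Finset.range m, (j.choose b : A) * (Polynomial.taylor φ f).coeff j * h ^ (j - b)
        + (m.choose b : A) * h ^ (m - b) := by
  rw [add_comm φ h, ← Polynomial.taylor_taylor, taylor_sum _ m (by simp [hd]),
    Finset.sum_range_succ, taylor_monic_coeff hf hd, mul_one]

lemma Gp_shift (hf : f.Monic) (hd : f.natDegree = m) {φ h : A} {L : ι → ℝ} {l : ℝ}
    (hG : Gp w f m φ L l) (hh : h ∈ mI w (GE L l)) : Gp w f m (φ + h) L l := by
  intro b hb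
  rw [taylor_shift hf hd]
  refine Ideal.add_mem _ (Ideal.sum_mem _ fun j hj => ?_) ?_
  · rw [Finset.mem_range] at hj
    rcases lt_or_ge j b with h1 | h1
    · rw [Nat.choose_eq_zero_of_lt h1]; simp
    · rw [mul_assoc]
      refine Ideal.mul_mem_left _ _ ?_
      have := GE_mul (hG j hj) (GE_pow hh (j - b))
      convert this using 3
      rw [Nat.cast_sub h1]; ring
  · refine Ideal.mul_mem_left _ _ ?_
    have := GE_pow hh (m - b)
    rwa [Nat.cast_sub hb.le] at this

lemma JJ_upper (φ : A) : IsUpperSet (JJ w f m φ) :=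
  fun _ _ hab ha L l hL hG => (ha L l hL hG).trans (wt_mono hL hab)

lemma Le_of_JJ (hf : f.Monic) (hd : f.natDegree = m) {φ φ' : A}
    (h : φ' - φ ∈ mI w (JJ w f m φ)) : Le w f m φ' φ := by
  intro L l hL hG
  have := Gp_shift hf hd hG (mI_mono (F := GE L l) (fun a ha => by
    have ha' : a ∈ JJ w f m φ := ha
    exact ha' L l hL hG) h)
  simpa using this

lemma JJ_mono {φ φ' : A} (h : Le w f m φ' φ) : JJ w f m φ' ⊆ JJ w f m φ :=
  fun _ ha L l hL hG => ha L l hL (h L l hL hG)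

lemma Le.trans {a b c : A} (h : Le w f m a b) (h' : Le w f m b c) : Le w f m a c :=
  fun L l hL hG => h L l hL (h' L l hL hG)

lemma Gp_mono {φ : A} {L L' : ι → ℝ} {l : ℝ} (h : ∀ i, L i ≤ L' i) (hG : Gp w f m φ L l) :
    Gp w f m φ L' l := fun b hb =>
  mI_mono (fun a ha => le_trans ha (wt_mono_left h a)) (hG b hb)

variable [IsLocalRing A]

lemma MonSys.not_mem_of_not (hs : MonSys w) {E : Set (ι → ℕ)} (hE : IsUpperSet E) {c : A}
    (hc : IsUnit c) {e : ι → ℕ} (he : e ∉ E) : c * mon w e ∉ mI w E := by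
  intro h
  exact hs.mp e (mI_le_bx hE he ((Ideal.unit_mul_mem_iff_mem _ hc).1 h))

/-- initial monomial with respect to generic `L` -/
lemma MonSys.initial (hs : MonSys w) {h : A} {L : ι → ℝ} {l : ℝ} {p : ι → ℕ}
    (hp : p ∈ ES w h) (hpl : wt L p < l) (hL0 : ∀ i, 0 ≤ L i)
    (hgen : ∀ e e' : ι → ℕ, wt L e = wt L e' → e = e') :
    ∃ e c, IsUnit c ∧ wt L e < l ∧ h - c * mon w e ∈ mI w (GT L (wt L e)) := by
  classical
  obtain ⟨F, c, hF, hdom, hh⟩ := hs.unit_exp h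
  obtain ⟨q, hq, hqp⟩ := hdom p hp
  obtain ⟨e, he, hmin⟩ := F.exists_min_image (wt L) ⟨q, hq⟩
  refine ⟨e, c e, (hF e he).2, ?_, ?_⟩
  · exact lt_of_le_of_lt ((hmin q hq).trans (wt_mono hL0 hqp)) hpl
  · rw [hh, ← Finset.add_sum_erase _ _ he, add_sub_cancel_left]
    refine Ideal.sum_mem _ fun b hb => Ideal.mul_mem_left _ _ (mon_mem ?_)
    rw [Finset.mem_erase] at hb
    exact lt_of_le_of_ne (hmin b hb.2) (fun h => hb.1 (hgen _ _ h).symm)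

lemma Gp_unique (hs : MonSys w) (hm : 0 < m) (hf : f.Monic) (hd : f.natDegree = m)
    {φ φ' : A} {L : ι → ℝ} {l : ℝ} (hL : ∀ i, 0 ≤ L i)
    (hG : Gp w f m φ L l) (hG' : Gp w f m φ' L l) : φ' - φ ∈ mI w (GE L l) := by
  refine hs.mem_of_ES (GE_upper hL l) fun p hp => ?_
  by_contra hpl
  simp only [GE, Set.mem_ofPred_eq, not_le] at hpl
  obtain ⟨L', h1, h2, -, h4, h5⟩ := generic L Finset.univ hL (by simp) (fun i => (p i : ℝ)) l hpl
  have hL' : ∀ i, 0 ≤ L' i := fun i => (h2 i (Finset.mem_univ i)).le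
  obtain ⟨e, c, hc, he, hh⟩ := hs.initial (L := L') hp h5 hL'
    (fun e e' h => funext fun i => h4 e e' h i (Finset.mem_univ i))
  have g1 := Gp_mono h1 hG
  have g2 := Gp_mono h1 hG' 0 hm
  have hce : c * mon w e ∈ mI w (GE L' (wt L' e)) :=
    Ideal.mul_mem_left _ _ (mon_mem (le_refl (wt L' e)))
  have hge : φ' - φ ∈ mI w (GE L' (wt L' e)) := by
    have := Ideal.add_mem _ (GT_le_GE _ hh) hce
    simpa using this
  have e1 := taylor_shift hf hd φ (φ' - φ) 0
  rw [add_sub_cancel] at e1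
  simp only [Nat.choose_zero_right, Nat.cast_one, one_mul, tsub_zero] at e1
  rw [e1] at g2
  have hmpos : (0:ℝ) < m := by exact_mod_cast hm
  have g3 := GE_le_GT (l := m * wt L' e) (by
    simp only [Nat.cast_zero, sub_zero]
    exact mul_lt_mul_of_pos_left he hmpos) g2
  have g4 : ∑ j ∈ Finset.range m, (Polynomial.taylor φ f).coeff j * (φ' - φ) ^ j
      ∈ mI w (GT L' (m * wt L' e)) := by
    refine Ideal.sum_mem _ fun j hj => ?_
    rw [Finset.mem_range] at hj
    refine GE_le_GT ?_ (GE_mul (g1 j hj) (GE_pow hge j))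
    have : (j:ℝ) < m := by exact_mod_cast hj
    nlinarith
  have g5 := (Ideal.add_mem_iff_right _ g4).1 g3
  have g6 := Ideal.sub_mem _ g5 (pow_congr hce hh m)
  rw [sub_sub_cancel, mul_pow, ← mon_nsmul] at g6
  refine hs.not_mem_of_not (GT_upper hL' _) (hc.pow m) ?_ g6
  simp only [GT, Set.mem_ofPred_eq, wt_nsmul, lt_irrefl, not_false_eq_true]

lemma Le_JJ (hs : MonSys w) (hm : 0 < m) (hf : f.Monic) (hd : f.natDegree = m) {φ φ' : A}
    (h : Le w f m φ' φ) : φ' - φ ∈ mI w (JJ w f m φ) := by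
  refine hs.mem_of_ES (JJ_upper φ) fun p hp L l hL hG => ?_
  exact ES_sub_of_mem (GE_upper hL l) (Gp_unique hs hm hf hd hL hG (h L l hL hG)) hp

lemma taylor_coeff_mem (hf : f.Monic) (hd : f.natDegree = m)
    (hc : ∀ i < m, f.coeff i ∈ maximalIdeal A) {φ : A} (hφ : φ ∈ maximalIdeal A) (b : ℕ)
    (hb : b < m) : (Polynomial.taylor φ f).coeff b ∈ maximalIdeal A := by
  have := taylor_shift hf hd 0 φ b
  rw [zero_add] at this
  rw [this, Polynomial.taylor_zero]
  refine Ideal.add_mem _ (Ideal.sum_mem _ fun j hj => ?_) ?_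
  · exact Ideal.mul_mem_right _ _ (Ideal.mul_mem_left _ _ (hc j (Finset.mem_range.1 hj)))
  · exact Ideal.mul_mem_left _ _ (Ideal.pow_mem_of_mem _ hφ _ (by omega))

lemma wt_one (a : ι → ℕ) : wt (fun _ => 1) a = dg a := by simp [wt, dg]

lemma JJ_dg (hw : Ideal.span (Set.range w) = maximalIdeal A) (hm : 0 < m) (hf : f.Monic)
    (hd : f.natDegree = m) (hc : ∀ i < m, f.coeff i ∈ maximalIdeal A) {φ : A}
    (hφ : φ ∈ maximalIdeal A) {a : ι → ℕ} (ha : a ∈ JJ w f m φ) : 1 ≤ dg a := by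
  have hmpos : (0:ℝ) < m := by exact_mod_cast hm
  have := ha (fun _ => 1) (1 / m) (by simp) (fun b hb => by
    have h1 := taylor_coeff_mem hf hd hc hφ b hb
    rw [← pow_one (maximalIdeal A), pow_eq_mI hw] at h1
    refine mI_mono (fun e he => ?_) h1
    simp only [GE, Set.mem_ofPred_eq, wt_one] at he ⊢
    rw [he, Nat.cast_one, mul_one_div, div_le_one hmpos]
    have : (0:ℝ) ≤ b := Nat.cast_nonneg _
    linarith)
  rw [wt_one] at this
  have h2 : (0:ℝ) < dg a := lt_of_lt_of_le (by positivity) this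
  exact_mod_cast h2

lemma JJ_le_max (hw : Ideal.span (Set.range w) = maximalIdeal A) (hm : 0 < m) (hf : f.Monic)
    (hd : f.natDegree = m) (hc : ∀ i < m, f.coeff i ∈ maximalIdeal A) {φ : A}
    (hφ : φ ∈ maximalIdeal A) : mI w (JJ w f m φ) ≤ maximalIdeal A := by
  refine mI_le fun e he => ?_
  have := mon_mem_pow hw (JJ_dg hw hm hf hd hc hφ he)
  rwa [pow_one] at this

lemma finite_dg (k : ℕ) : {a : ι → ℕ | dg a < k}.Finite := by
  refine (Set.Finite.pi' (fun _ : ι => Set.finite_Iic k)).subset fun a ha i => ?_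
  have h1 : a i ≤ dg a := Finset.single_le_sum (f := a) (fun _ _ => Nat.zero_le _)
    (Finset.mem_univ i)
  simp only [Set.mem_ofPred_eq] at ha
  simp only [Set.mem_Iic]
  omega

theorem exists_minimal [IsAdicComplete (maximalIdeal A) A] (hs : MonSys w) (hm : 0 < m)
    (hf : f.Monic) (hd : f.natDegree = m) (hc : ∀ i < m, f.coeff i ∈ maximalIdeal A) :
    ∃ φ ∈ maximalIdeal A, ∀ φ' ∈ maximalIdeal A, Le w f m φ' φ → Le w f m φ φ' := by
  have key := exists_maximal_of_chains_bounded
    (r := fun a b : maximalIdeal A => Le w f m b.1 a.1) ?_ (fun h h' => h'.trans h)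
  · obtain ⟨φ, hφ⟩ := key
    exact ⟨φ.1, φ.2, fun φ' h' hle => hφ ⟨φ', h'⟩ hle⟩
  intro c hchain
  rcases c.eq_empty_or_nonempty with rfl | hne
  · exact ⟨0, by simp⟩
  have htot : ∀ a ∈ c, ∀ b ∈ c, Le w f m b.1 a.1 ∨ Le w f m a.1 b.1 := by
    intro a ha b hb
    by_cases hab : a = b
    · subst hab; exact Or.inl fun _ _ _ h => h
    · exact hchain ha hb hab
  let Q : ℕ → A → Prop := fun k y => ∀ φ ∈ c, y - φ.1 ∈ mI w (JJ w f m φ.1) ⊔ maximalIdeal A ^ k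
  have hfinal : ∀ y, (∀ k, Q k y) → ∃ ub : maximalIdeal A, ∀ a ∈ c, Le w f m ub.1 a.1 := by
    intro y hy
    have h1 : ∀ φ ∈ c, y - φ.1 ∈ mI w (JJ w f m φ.1) := fun φ hφ =>
      hs.cl _ _ fun k => hy k φ hφ
    obtain ⟨φ, hφ⟩ := hne
    have hyM : y ∈ maximalIdeal A := by
      have := Ideal.add_mem _ (JJ_le_max hs.hw hm hf hd hc φ.2 (h1 φ hφ)) φ.2
      simpa using this
    exact ⟨⟨y, hyM⟩, fun a ha => Le_of_JJ hf hd (h1 a ha)⟩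
  have hstep : ∀ k y, Q k y → ∃ y', Q (k + 1) y' ∧ y' - y ∈ maximalIdeal A ^ k := by
    intro k y hy
    obtain ⟨φ, hφ, hmin⟩ : ∃ φ ∈ c, ∀ φ' ∈ c,
        (JJ w f m φ.1 ∩ {a | dg a < k + 1}).ncard ≤ (JJ w f m φ'.1 ∩ {a | dg a < k + 1}).ncard := by
      obtain ⟨φ, hφ, h⟩ := exists_minimalFor_of_wellFoundedLT (· ∈ c)
        (fun φ => (JJ w f m φ.1 ∩ {a | dg a < k + 1}).ncard) hne
      refine ⟨φ, hφ, fun φ' h' => ?_⟩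
      rcases le_total (JJ w f m φ.1 ∩ {a | dg a < k + 1}).ncard
        (JJ w f m φ'.1 ∩ {a | dg a < k + 1}).ncard with h2 | h2
      · exact h2
      · exact h h' h2
    have hsub : ∀ φ' ∈ c, JJ w f m φ.1 ∩ {a | dg a < k + 1} ⊆ JJ w f m φ'.1 := by
      intro φ' h'
      rcases htot φ hφ φ' h' with h2 | h2
      · have h3 : JJ w f m φ'.1 ∩ {a | dg a < k + 1} ⊆ JJ w f m φ.1 ∩ {a | dg a < k + 1} :=
          Set.inter_subset_inter_left _ (JJ_mono h2)
        rw [← Set.eq_of_subset_of_ncard_le h3 (hmin φ' h')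
          ((finite_dg (k + 1)).subset Set.inter_subset_right)]
        exact Set.inter_subset_left
      · exact Set.inter_subset_left.trans (JJ_mono h2)
    have hle : ∀ φ' ∈ c, mI w (JJ w f m φ.1)
        ≤ mI w (JJ w f m φ'.1) ⊔ maximalIdeal A ^ (k + 1) := by
      intro φ' h'
      refine mI_le fun e he => ?_
      by_cases hk : dg e < k + 1
      · exact Ideal.mem_sup_left (mon_mem (hsub φ' h' ⟨he, hk⟩))
      · exact Ideal.mem_sup_right (mon_mem_pow hs.hw (by omega))
    obtain ⟨a, ha, r, hr, har⟩ := Submodule.mem_sup.1 (hy φ hφ)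
    refine ⟨φ.1 + a, fun φ' h' => ?_, ?_⟩
    · have h1 : φ.1 - φ'.1 ∈ mI w (JJ w f m φ'.1) ⊔ maximalIdeal A ^ (k + 1) := by
        rcases htot φ hφ φ' h' with h2 | h2
        · have := hle φ' h' (Le_JJ hs hm hf hd h2)
          rw [← neg_sub]
          exact neg_mem this
        · exact Ideal.mem_sup_left (Le_JJ hs hm hf hd h2)
      have : φ.1 + a - φ'.1 = a + (φ.1 - φ'.1) := by ring
      rw [this]
      exact Ideal.add_mem _ (hle φ' h' ha) h1
    · have : φ.1 + a - y = - r := by rw [← sub_eq_iff_eq_add'.2 har.symm]; ring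
      rw [this]; exact neg_mem hr
  choose! st hst using hstep
  obtain ⟨φ0, hφ0⟩ := hne
  let y : ℕ → A := fun n => Nat.rec φ0.1 (fun k yk => st k yk) n
  have hQ : ∀ n, Q n (y n) := by
    intro n
    induction n with
    | zero => intro φ _; simp
    | succ n ih => exact (hst n _ ih).1
  obtain ⟨z, hz⟩ := lim_exists y fun n => (hst n _ (hQ n)).2
  refine hfinal z fun k φ hφ => ?_
  have : z - φ.1 = (z - y k) + (y k - φ.1) := by ring
  rw [this]
  exact Ideal.add_mem _ (Ideal.mem_sup_right (hz k)) (hQ k φ hφ)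

end PolyG

set_option linter.unusedSectionVars false

section Pts

variable {A : Type u} [CommRing A] [IsLocalRing A] {ι : Type} [Fintype ι]

def PT (w : ι → A) (f : Polynomial A) (m : ℕ) (φ : A) : Set (ι → ℝ) :=
  {x | ∃ b < m, ∃ a ∈ ES w ((Polynomial.taylor φ f).coeff b),
    x = fun i => (a i : ℝ) / ((m : ℝ) - b)}

variable {w : ι → A} {f : Polynomial A} {m : ℕ}

lemma pair_div (L : ι → ℝ) (a : ι → ℕ) (r : ℝ) :
    ∑ i, L i * ((a i : ℝ) / r) = wt L a / r := by
  simp only [wt, Finset.sum_div, mul_div_assoc]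

lemma PT_nonneg {φ : A} {x : ι → ℝ} (hx : x ∈ PT w f m φ) (i : ι) : 0 ≤ x i := by
  obtain ⟨b, hb, a, ha, rfl⟩ := hx
  have : (b:ℝ) < m := by exact_mod_cast hb
  exact div_nonneg (Nat.cast_nonneg _) (by linarith)

lemma Gp_iff_PT (hs : MonSys w) {φ : A} {L : ι → ℝ} (hL : ∀ i, 0 ≤ L i) {l : ℝ} :
    Gp w f m φ L l ↔ ∀ x ∈ PT w f m φ, l ≤ ∑ i, L i * x i := by
  constructor
  · rintro hG x ⟨b, hb, a, ha, rfl⟩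
    have hb' : (0:ℝ) < (m:ℝ) - b := by
      have : (b:ℝ) < m := by exact_mod_cast hb
      linarith
    rw [pair_div, le_div_iff₀ hb', mul_comm]
    exact ES_sub_of_mem (GE_upper hL _) (hG b hb) ha
  · intro h b hb
    have hb' : (0:ℝ) < (m:ℝ) - b := by
      have : (b:ℝ) < m := by exact_mod_cast hb
      linarith
    refine hs.mem_of_ES (GE_upper hL _) fun a ha => ?_
    have := h _ ⟨b, hb, a, ha, rfl⟩
    rwa [pair_div, le_div_iff₀ hb', mul_comm] at this

lemma PT_finite (w : ι → A) (f : Polynomial A) (m : ℕ) (φ : A) :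
    ∃ F : Set (ι → ℝ), F.Finite ∧ F ⊆ PT w f m φ ∧ ∀ x ∈ PT w f m φ, ∃ y ∈ F, ∀ i, y i ≤ x i := by
  choose G hG hdom _ using fun b => exists_gens (ES w ((Polynomial.taylor φ f).coeff b))
  refine ⟨⋃ b ∈ Set.Iio m, (fun (a : ι → ℕ) i => (a i : ℝ) / ((m : ℝ) - b)) '' (G b), ?_, ?_, ?_⟩
  · exact (Set.finite_Iio m).biUnion fun b _ => (G b).finite_toSet.image _
  · intro x hx
    simp only [Set.mem_iUnion] at hx
    obtain ⟨b, hb, a, ha, rfl⟩ := hx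
    exact ⟨b, hb, a, hG b a ha, rfl⟩
  · rintro x ⟨b, hb, a, ha, rfl⟩
    obtain ⟨a', ha', hle⟩ := hdom b a ha
    refine ⟨_, Set.mem_biUnion (x := b) hb ⟨a', ha', rfl⟩, fun i => ?_⟩
    have : (b:ℝ) < m := by exact_mod_cast hb
    have h2 : (a' i : ℝ) ≤ a i := by exact_mod_cast hle i
    exact div_le_div_of_nonneg_right h2 (by linarith)

lemma pair_mono {L : ι → ℝ} (hL : ∀ i, 0 ≤ L i) {x y : ι → ℝ} (h : ∀ i, x i ≤ y i) :
    ∑ i, L i * x i ≤ ∑ i, L i * y i :=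
  Finset.sum_le_sum fun i _ => mul_le_mul_of_nonneg_left (h i) (hL i)

lemma pair_mono_left {L L' : ι → ℝ} (hL : ∀ i, L i ≤ L' i) {x : ι → ℝ} (h : ∀ i, 0 ≤ x i) :
    ∑ i, L i * x i ≤ ∑ i, L' i * x i :=
  Finset.sum_le_sum fun i _ => mul_le_mul_of_nonneg_right (hL i) (h i)

end Pts

section Descent

lemma choose_pp {p : ℕ} (hp : p.Prime) (v n k : ℕ) :
    (p ^ v * n).choose (p ^ v * k) ≡ n.choose k [MOD p] := by
  haveI : Fact p.Prime := ⟨hp⟩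
  induction v with
  | zero => simp; rfl
  | succ v ih =>
    have := Choose.choose_modEq_choose_mod_mul_choose_div_nat (p := p) (n := p ^ (v + 1) * n)
      (k := p ^ (v + 1) * k)
    have e1 : ∀ n, p ^ (v + 1) * n = p * (p ^ v * n) := fun n => by ring
    rw [e1, e1, Nat.mul_mod_right, Nat.mul_mod_right, Nat.mul_div_cancel_left _ hp.pos,
      Nat.mul_div_cancel_left _ hp.pos, Nat.choose_self, one_mul] at this
    rw [e1, e1]
    exact this.trans ih

lemma exists_q {S : Type u} [CommRing S] (P : Ideal S) [P.IsPrime] {m : ℕ} (hm : 0 < m) :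
    ∃ q, 0 < q ∧ q ≤ m ∧ (q = 1 ∨ ∃ p e : ℕ, p.Prime ∧ (p : S) ∈ P ∧ q = p ^ e) ∧
      (m.choose q : S) ∉ P := by
  by_cases hmP : (m : S) ∈ P
  · obtain ⟨p, hp⟩ := CharP.exists (S ⧸ P)
    have hcast : ∀ n : ℕ, (n : S) ∈ P ↔ p ∣ n := by
      intro n
      rw [← CharP.cast_eq_zero_iff (S ⧸ P) p n, ← Ideal.Quotient.eq_zero_iff_mem]
      simp
    have hpm := (hcast m).1 hmP
    have hp0 : p ≠ 0 := by rintro rfl; rw [zero_dvd_iff] at hpm; omega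
    have hpp : p.Prime := (CharP.char_is_prime_or_zero (S ⧸ P) p).resolve_right hp0
    obtain ⟨n, hn⟩ : p ^ (m.factorization p) ∣ m := Nat.ordProj_dvd m p
    have hnd : ¬ p ∣ n := by
      have := Nat.not_dvd_ordCompl hpp hm.ne'
      have hpos : 0 < p ^ (m.factorization p) := pow_pos hpp.pos _
      rwa [Nat.div_eq_of_eq_mul_right hpos hn] at this
    refine ⟨p ^ (m.factorization p), pow_pos hpp.pos _, Nat.le_of_dvd hm ⟨n, hn⟩,
      Or.inr ⟨p, _, hpp, (hcast p).2 dvd_rfl, rfl⟩, ?_⟩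
    rw [hcast]
    have := choose_pp hpp (m.factorization p) n 1
    rw [← hn, mul_one, Nat.choose_one_right] at this
    rwa [(this.dvd_iff dvd_rfl)]
  · exact ⟨1, one_pos, hm, Or.inl rfl, by simpa using hmP⟩

variable {S T : Type u} [CommRing S] [IsLocalRing S] [CommRing T] [IsLocalRing T]
  (ψ : S →+* T) {ι : Type} [Fintype ι] (w : ι → S)

structure DescSetup : Prop where
  msS : MonSys w
  msT : MonSys (fun i => ψ (w i))
  contr : ∀ I : Ideal S, (I.map ψ).comap ψ = I
  prime : ∀ I : Finset ι, (Ideal.span (w '' I)).IsPrime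
  root : ∀ (P : Ideal S), P.IsPrime → ∀ (c s : S) (q : ℕ) (x : T), c ∉ P →
    (q = 1 ∨ ∃ p e : ℕ, p.Prime ∧ (p : S) ∈ P ∧ q = p ^ e) →
    ψ c * x ^ q - ψ s ∈ P.map ψ → ∃ t, x - ψ t ∈ P.map ψ

variable {ψ w} {f : Polynomial S} {m : ℕ}

lemma DescSetup.contr_mI (h : DescSetup ψ w) {E : Set (ι → ℕ)} {s : S}
    (hs : ψ s ∈ mI (fun i => ψ (w i)) E) : s ∈ mI w E := by
  rw [← h.contr (mI w E), Ideal.mem_comap, map_mI]; exact hs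

lemma DescSetup.glue (h : DescSetup ψ w) {E F : Set (ι → ℕ)} (hE : IsUpperSet E)
    (hF : IsUpperSet F) {x : T} {s₁ s₂ : S} (h1 : ψ s₁ - x ∈ mI (fun i => ψ (w i)) E)
    (h2 : ψ s₂ - x ∈ mI (fun i => ψ (w i)) F) :
    ∃ s, ψ s - x ∈ mI (fun i => ψ (w i)) (E ∩ F) := by
  have h3 : s₁ - s₂ ∈ mI w (E ∪ F) := by
    apply h.contr_mI
    rw [mI_union, map_sub]
    have : ψ s₁ - ψ s₂ = (ψ s₁ - x) - (ψ s₂ - x) := by ring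
    rw [this]
    exact Ideal.sub_mem _ (Ideal.mem_sup_left h1) (Ideal.mem_sup_right h2)
  rw [mI_union] at h3
  obtain ⟨a, ha, b, hb, hab⟩ := Submodule.mem_sup.1 h3
  have ha' : ψ a ∈ mI (fun i => ψ (w i)) E := by rw [← map_mI]; exact Ideal.mem_map_of_mem _ ha
  have hb' : ψ b ∈ mI (fun i => ψ (w i)) F := by rw [← map_mI]; exact Ideal.mem_map_of_mem _ hb
  refine ⟨s₁ - a, h.msT.mem_of_ES (hE.inter hF) fun e he => ⟨?_, ?_⟩⟩
  · refine ES_sub_of_mem hE ?_ he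
    have : ψ (s₁ - a) - x = (ψ s₁ - x) - ψ a := by rw [map_sub]; ring
    rw [this]; exact Ideal.sub_mem _ h1 ha'
  · refine ES_sub_of_mem hF ?_ he
    have e2 : s₁ - a = s₂ + b := by linear_combination -hab
    have : ψ (s₁ - a) - x = (ψ s₂ - x) + ψ b := by rw [e2, map_add]; ring
    rw [this]; exact Ideal.add_mem _ h2 hb'

/-- restriction of exponent to `I` -/
lemma restr_exists (L : ι → ℝ) (I : Finset ι) (hI0 : ∀ i, i ∉ I → L i = 0)
    (hgen : ∀ e e' : ι → ℕ, wt L e = wt L e' → ∀ i ∈ I, e i = e' i) (v : ℝ)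
    (hv : ∃ e, wt L e = v) :
    ∃ a, wt L a = v ∧ (∀ i, i ∉ I → a i = 0) ∧ ∀ n : ℕ, ∀ e, wt L e = n * v → n • a ≤ e := by
  classical
  obtain ⟨e, rfl⟩ := hv
  have hwa : wt L (fun i => if i ∈ I then e i else 0) = wt L e := by
    refine Finset.sum_congr rfl fun i _ => ?_
    by_cases hi : i ∈ I
    · simp [hi]
    · simp [hi, hI0 i hi]
  refine ⟨fun i => if i ∈ I then e i else 0, hwa, fun i hi => by simp [hi], ?_⟩
  intro n e' he' i
  by_cases hi : i ∈ I
  · rw [← hwa, ← wt_nsmul] at he'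
    exact (hgen _ _ he' i hi).ge
  · simp [hi]

lemma lead_split {A : Type u} [CommRing A] {w : ι → A} {L : ι → ℝ} {v : ℝ} {a : ι → ℕ}
    (ha : ∀ e, wt L e = v → a ≤ e) {h : A} (hh : h ∈ mI w (GE L v)) :
    ∃ x, h - x * mon w a ∈ mI w (GT L v) := by
  have : mI w (GE L v) ≤ Ideal.span {mon w a} ⊔ mI w (GT L v) := by
    refine mI_le fun e he => ?_
    rcases eq_or_lt_of_le (show v ≤ wt L e from he) with h1 | h1
    · refine Ideal.mem_sup_left ?_
      rw [← tsub_add_cancel_of_le (ha e h1.symm), mon_add]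
      exact Ideal.mul_mem_left _ _ (Ideal.subset_span rfl)
    · exact Ideal.mem_sup_right (mon_mem h1)
  obtain ⟨y, hy, r, hr, rfl⟩ := Submodule.mem_sup.1 (this hh)
  obtain ⟨x, rfl⟩ := Ideal.mem_span_singleton'.1 hy
  exact ⟨x, by simpa using hr⟩

lemma colon_span {A : Type u} [CommRing A] [IsLocalRing A] {w : ι → A} (hs : MonSys w)
    {L : ι → ℝ} (hL : ∀ i, 0 ≤ L i) (I : Finset ι) (hI0 : ∀ i, i ∉ I → L i = 0) {x : A}
    {a : ι → ℕ} (h : x * mon w a ∈ mI w (GT L (wt L a))) : x ∈ Ideal.span (w '' I) := by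
  classical
  have h1 : x ∈ mI w (GT L 0) := by
    refine hs.mem_of_ES (GT_upper hL 0) fun e he => ?_
    have := ES_sub_of_mem (GT_upper hL _) h (hs.ES_mul_mon he a)
    simp only [GT, Set.mem_ofPred_eq, wt_add] at this ⊢
    linarith
  refine mI_le (fun e he => ?_) h1
  have : ∃ i ∈ I, e i ≠ 0 := by
    by_contra hc
    push Not at hc
    have : wt L e = 0 := Finset.sum_eq_zero fun i _ => by
      by_cases hi : i ∈ I
      · simp [hc i hi]
      · simp [hI0 i hi]
    exact absurd he (by simp [GT, this])
  obtain ⟨i, hi, hne⟩ := this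
  unfold mon
  refine Ideal.mem_of_dvd _ ((dvd_pow_self (w i) hne).trans
    (Finset.dvd_prod_of_mem (fun i => w i ^ e i) (Finset.mem_univ i))) ?_
  exact Ideal.subset_span ⟨i, hi, rfl⟩

lemma DescSetup.step (h : DescSetup ψ w) (hm : 0 < m) (hf : f.Monic) (hd : f.natDegree = m)
    {L : ι → ℝ} {I : Finset ι} (hLpos : ∀ i ∈ I, 0 < L i) (hI0 : ∀ i, i ∉ I → L i = 0)
    (hgen : ∀ e e' : ι → ℕ, wt L e = wt L e' → ∀ i ∈ I, e i = e' i) {φh : T} {l v : ℝ}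
    (hG : Gp (fun i => ψ (w i)) (f.map ψ) m φh L l) (hv : v < l) {φ : S}
    (hφ : ψ φ - φh ∈ mI (fun i => ψ (w i)) (GE L v)) :
    ∃ φ' : S, ψ φ' - φh ∈ mI (fun i => ψ (w i)) (GT L v) := by
  classical
  have hL : ∀ i, 0 ≤ L i := fun i => by
    by_cases hi : i ∈ I
    · exact (hLpos i hi).le
    · exact (hI0 i hi).ge
  by_cases hex : ∃ e, wt L e = v
  swap
  · refine ⟨φ, mI_mono (fun e he => ?_) hφ⟩
    exact lt_of_le_of_ne he fun h => hex ⟨e, h.symm⟩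
  obtain ⟨a, hav, ha0, hale⟩ := restr_exists L I hI0 hgen v hex
  obtain ⟨x, hx⟩ := lead_split (fun e he => by simpa using hale 1 e (by simpa using he)) hφ
  haveI := h.prime I
  obtain ⟨q, hq0, hqm, hqp, hqc⟩ := exists_q (Ideal.span (w '' I)) hm
  set s := (Polynomial.taylor φ f).coeff (m - q) with hs
  have hψs : ψ s = (Polynomial.taylor (φh + (ψ φ - φh)) (f.map ψ)).coeff (m - q) := by
    rw [add_sub_cancel, ← Polynomial.map_taylor, Polynomial.coeff_map]
  rw [taylor_shift (hf.map ψ) (by rw [hf.natDegree_map, hd]), Nat.choose_symm hqm,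
    Nat.sub_sub_self hqm] at hψs
  have h1 : ψ s - (m.choose q : T) * (ψ φ - φh) ^ q ∈ mI (fun i => ψ (w i)) (GT L (q * v)) := by
    rw [hψs, add_sub_cancel_right]
    refine Ideal.sum_mem _ fun j hj => ?_
    rw [Finset.mem_range] at hj
    rcases lt_or_ge j (m - q) with h1 | h1
    · rw [Nat.choose_eq_zero_of_lt h1]; simp
    · rw [mul_assoc]
      refine Ideal.mul_mem_left _ _ (GE_le_GT ?_ (GE_mul (hG j hj) (GE_pow hφ (j - (m - q)))))
      rw [Nat.cast_sub h1, Nat.cast_sub hqm]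
      have : (j:ℝ) < m := by exact_mod_cast hj
      nlinarith
  have hxa : x * mon (fun i => ψ (w i)) a ∈ mI (fun i => ψ (w i)) (GE L v) :=
    Ideal.mul_mem_left _ _ (mon_mem hav.ge)
  have h2 := pow_congr hxa hx q
  rw [mul_pow, ← mon_nsmul] at h2
  have h3 : ψ s - (m.choose q : T) * x ^ q * mon (fun i => ψ (w i)) (q • a)
      ∈ mI (fun i => ψ (w i)) (GT L (q * v)) := by
    have := Ideal.add_mem _ h1 (Ideal.mul_mem_left _ (m.choose q : T) h2)
    convert this using 1
    ring
  have hqa : wt L (q • a) = q * v := by rw [wt_nsmul, hav]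
  have h4 : s ∈ mI w (GE L (q * v)) := by
    apply h.contr_mI
    have := Ideal.add_mem _ (GT_le_GE _ h3) (Ideal.mul_mem_left _ ((m.choose q : T) * x ^ q)
      (mon_mem (w := fun i => ψ (w i)) (show q • a ∈ GE L (q * v) from hqa.ge)))
    simpa using this
  obtain ⟨s', hs'⟩ := lead_split (hale q) h4
  have h5 : ψ s - ψ s' * mon (fun i => ψ (w i)) (q • a) ∈ mI (fun i => ψ (w i)) (GT L (q * v)) := by
    rw [← map_mI]
    have := Ideal.mem_map_of_mem ψ hs'
    rwa [map_sub, map_mul, map_mon] at this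
  have h6 : (ψ (m.choose q : S) * x ^ q - ψ s') * mon (fun i => ψ (w i)) (q • a)
      ∈ mI (fun i => ψ (w i)) (GT L (wt L (q • a))) := by
    rw [hqa]
    have := Ideal.sub_mem _ h5 h3
    convert this using 1
    rw [map_natCast]; ring
  have h7 := colon_span h.msT hL I hI0 h6
  have hmap : (Ideal.span (w '' I)).map ψ = Ideal.span ((fun i => ψ (w i)) '' I) := by
    rw [Ideal.map_span, Set.image_image]
  rw [← hmap] at h7
  obtain ⟨t, ht⟩ := h.root _ (h.prime I) _ _ q x hqc hqp h7
  refine ⟨φ - t * mon w a, ?_⟩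
  have h8 : (x - ψ t) * mon (fun i => ψ (w i)) a ∈ mI (fun i => ψ (w i)) (GT L v) := by
    have hle : Ideal.span ((fun i => ψ (w i)) '' I) ≤ mI (fun i => ψ (w i)) (GT L 0) := by
      rw [Ideal.span_le]
      rintro _ ⟨i, hi, rfl⟩
      have he := mon_single (fun i => ψ (w i)) i
      change ψ (w i) ∈ _
      rw [← he]
      refine mon_mem ?_
      change 0 < wt L _
      simp only [wt]
      rw [Finset.sum_eq_single i]
      · simpa using hLpos i hi
      · intro j _ hj; simp [hj]
      · simp
    rw [hmap] at ht
    have := GT_mul (hle ht) (mon_mem (w := fun i => ψ (w i)) (show a ∈ GE L v from hav.ge))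
    rwa [zero_add] at this
  have := Ideal.add_mem _ h8 hx
  convert this using 1
  rw [map_sub, map_mul, map_mon]
  ring

lemma finite_vals {L : ι → ℝ} {I : Finset ι} (hLpos : ∀ i ∈ I, 0 < L i)
    (hI0 : ∀ i, i ∉ I → L i = 0) (l : ℝ) : {v | v < l ∧ ∃ e, wt L e = v}.Finite := by
  classical
  have hL : ∀ i, 0 ≤ L i := fun i => by
    by_cases hi : i ∈ I
    · exact (hLpos i hi).le
    · exact (hI0 i hi).ge
  refine ((Set.Finite.pi' (fun i : ι => Set.finite_Iic ⌈l / L i⌉₊)).image (wt L)).subset ?_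
  rintro v ⟨hv, e, rfl⟩
  refine ⟨fun i => if i ∈ I then e i else 0, fun i => ?_, ?_⟩
  · by_cases hi : i ∈ I
    · simp only [hi, if_true, Set.mem_Iic]
      have h1 : L i * e i ≤ wt L e := Finset.single_le_sum (f := fun i => L i * (e i : ℝ))
        (fun j _ => mul_nonneg (hL j) (Nat.cast_nonneg _)) (Finset.mem_univ i)
      have h2 : (e i : ℝ) ≤ l / L i := by
        rw [le_div_iff₀ (hLpos i hi), mul_comm]; linarith
      exact_mod_cast h2.trans (Nat.le_ceil _)
    · simp [hi]
  · refine Finset.sum_congr rfl fun i _ => ?_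
    by_cases hi : i ∈ I
    · simp [hi]
    · simp [hi, hI0 i hi]

lemma DescSetup.desc_gen (h : DescSetup ψ w) (hm : 0 < m) (hf : f.Monic) (hd : f.natDegree = m)
    {L : ι → ℝ} {I : Finset ι} (hLpos : ∀ i ∈ I, 0 < L i) (hI0 : ∀ i, i ∉ I → L i = 0)
    (hgen : ∀ e e' : ι → ℕ, wt L e = wt L e' → ∀ i ∈ I, e i = e' i) {φh : T} {l : ℝ}
    (hG : Gp (fun i => ψ (w i)) (f.map ψ) m φh L l) :
    ∃ φ : S, ψ φ - φh ∈ mI (fun i => ψ (w i)) (GE L l) := by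
  classical
  have key : ∀ U : Finset ℝ, (∀ e : ι → ℕ, (∃ u ∈ U, u ≤ wt L e) → l ≤ wt L e ∨ wt L e ∈ U) →
      (∃ φ : S, ψ φ - φh ∈ mI (fun i => ψ (w i)) {e | l ≤ wt L e ∨ wt L e ∈ U}) →
      ∃ φ : S, ψ φ - φh ∈ mI (fun i => ψ (w i)) (GE L l) := by
    intro U
    induction U using Finset.induction_on_min with
    | empty =>
      rintro - ⟨φ, hφ⟩
      exact ⟨φ, by simpa [GE] using hφ⟩
    | insert a s has ih =>
      rintro hfin ⟨φ, hφ⟩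
      have hfin' : ∀ e : ι → ℕ, (∃ u ∈ s, u ≤ wt L e) → l ≤ wt L e ∨ wt L e ∈ s := by
        rintro e ⟨u, hu, hue⟩
        rcases hfin e ⟨u, Finset.mem_insert_of_mem hu, hue⟩ with h1 | h1
        · exact Or.inl h1
        · rcases Finset.mem_insert.1 h1 with h2 | h2
          · have := has u hu; linarith
          · exact Or.inr h2
      refine ih hfin' ?_
      rcases lt_or_ge a l with hal | hal
      · have h1 : ψ φ - φh ∈ mI (fun i => ψ (w i)) (GE L a) := by
          refine mI_mono (fun e he => ?_) hφ
          change a ≤ wt L e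
          rcases he with he | he
          · linarith
          · rcases Finset.mem_insert.1 he with h2 | h2
            · exact h2.ge
            · exact (has _ h2).le
        obtain ⟨φ', h'⟩ := h.step hm hf hd hLpos hI0 hgen hG hal h1
        refine ⟨φ', mI_mono (fun e he => ?_) h'⟩
        have he' : a < wt L e := he
        rcases hfin e ⟨a, Finset.mem_insert_self _ _, he'.le⟩ with h1 | h1
        · exact Or.inl h1
        · rcases Finset.mem_insert.1 h1 with h2 | h2
          · linarith
          · exact Or.inr h2
      · refine ⟨φ, mI_mono (fun e he => ?_) hφ⟩
        rcases he with he | he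
        · exact Or.inl he
        · rcases Finset.mem_insert.1 he with h2 | h2
          · exact Or.inl (h2 ▸ hal)
          · exact Or.inr h2
  have hall : ∀ e : ι → ℕ, l ≤ wt L e ∨ wt L e ∈ (finite_vals hLpos hI0 l).toFinset := by
    intro e
    rcases le_or_gt l (wt L e) with h1 | h1
    · exact Or.inl h1
    · exact Or.inr ((finite_vals hLpos hI0 l).mem_toFinset.2 ⟨h1, e, rfl⟩)
  refine key _ (fun e _ => hall e) ⟨0, ?_⟩
  have : {e : ι → ℕ | l ≤ wt L e ∨ wt L e ∈ (finite_vals hLpos hI0 l).toFinset} = Set.univ :=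
    Set.eq_univ_of_forall hall
  rw [this, mI_univ]; trivial

lemma DescSetup.desc_sigma (h : DescSetup ψ w) (hm : 0 < m) (hf : f.Monic) (hd : f.natDegree = m)
    (φh : T) (E : Finset (ι → ℕ))
    (hE : ∀ e ∈ JJ (fun i => ψ (w i)) (f.map ψ) m φh, ∃ a ∈ E, a ≤ e) (σ : E → ι) :
    ∃ φ : S, ψ φ - φh ∈ mI (fun i => ψ (w i)) {b | ∃ j : E, j.1 (σ j) ≤ b (σ j)} := by
  classical
  by_cases h0 : ∃ j : E, j.1 (σ j) = 0
  · obtain ⟨j, hj⟩ := h0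
    have : {b : ι → ℕ | ∃ j : E, j.1 (σ j) ≤ b (σ j)} = Set.univ :=
      Set.eq_univ_of_forall fun b => ⟨j, by omega⟩
    rw [this, mI_univ]; exact ⟨0, trivial⟩
  push Not at h0
  set I : Finset ι := Finset.univ.image σ with hI
  have hcex : ∀ i, ∃ c : ℕ, i ∈ I → (∃ j : E, σ j = i ∧ j.1 i = c + 1) ∧
      ∀ j : E, σ j = i → c + 1 ≤ j.1 i := by
    intro i
    by_cases hi : i ∈ I
    · obtain ⟨j0, -, hj0⟩ := Finset.mem_image.1 hi
      obtain ⟨j, hj, hmin⟩ := (Finset.univ.filter fun j => σ j = i).exists_min_image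
        (fun j => j.1 i) ⟨j0, by simp [hj0]⟩
      rw [Finset.mem_filter] at hj
      have hne := h0 j
      rw [hj.2] at hne
      refine ⟨j.1 i - 1, fun _ => ⟨⟨j, hj.2, by omega⟩, fun j' hj' => ?_⟩⟩
      have := hmin j' (by simp [hj'])
      omega
    · exact ⟨0, fun h => absurd h hi⟩
  choose c hc using hcex
  obtain ⟨F, hFfin, hFsub, hFdom⟩ := PT_finite (fun i => ψ (w i)) (f.map ψ) m φh
  have hGF : ∀ (L : ι → ℝ) (l : ℝ), (∀ i, 0 ≤ L i) → (Gp (fun i => ψ (w i)) (f.map ψ) m φh L l ↔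
      ∀ x ∈ F, l ≤ ∑ i, L i * x i) := by
    intro L l hL
    rw [Gp_iff_PT h.msT hL]
    refine ⟨fun hh x hx => hh x (hFsub hx), fun hh x hx => ?_⟩
    obtain ⟨y, hy, hyx⟩ := hFdom x hx
    exact (hh y hy).trans (pair_mono hL hyx)
  obtain ⟨L, l, hL, hL0, hLc, hLF⟩ := hb_finite F hFfin I (fun i => (c i : ℝ)) (by
    intro p hp
    by_contra hcon
    push Not at hcon
    set N : ι → ℕ := fun i => if i ∈ I then c i else ⌈p i⌉₊ with hN
    have hpN : ∀ i, p i ≤ N i := by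
      intro i
      by_cases hi : i ∈ I
      · simpa [hN, hi] using hcon i hi
      · simpa [hN, hi] using Nat.le_ceil (p i)
    have hNJ : N ∈ JJ (fun i => ψ (w i)) (f.map ψ) m φh := by
      intro L l hL hG
      rw [hGF L l hL] at hG
      have hconv : Convex ℝ {x : ι → ℝ | l ≤ ∑ i, L i * x i} := by
        have : IsLinearMap ℝ (fun x : ι → ℝ => ∑ i, L i * x i) := by
          constructor
          · intro x y; simp [mul_add, Finset.sum_add_distrib]
          · intro r x; simp only [Pi.smul_apply, smul_eq_mul, Finset.mul_sum]
            exact Finset.sum_congr rfl fun i _ => by ring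
        exact convex_halfSpace_ge this l
      have := convexHull_min (fun x hx => hG x hx) hconv hp
      exact le_trans this (pair_mono hL hpN)
    obtain ⟨j, hj, hjN⟩ := hE N hNJ
    have hjI : σ ⟨j, hj⟩ ∈ I := Finset.mem_image_of_mem _ (Finset.mem_univ _)
    have h1 := hjN (σ ⟨j, hj⟩)
    have h2 := (hc _ hjI).2 ⟨j, hj⟩ rfl
    simp only [hN, hjI, if_true] at h1
    simp only at h2
    omega)
  obtain ⟨L', hLL', hpos, hz, hgen, hlt⟩ := generic L I hL hL0 _ l hLc
  have hL' : ∀ i, 0 ≤ L' i := fun i => (hL i).trans (hLL' i)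
  obtain ⟨φ, hφ⟩ := h.desc_gen hm hf hd hpos hz hgen (φh := φh) (l := l) (by
    rw [hGF L' l hL']
    intro x hx
    exact (hLF x hx).trans (pair_mono_left hLL' (PT_nonneg (hFsub hx))))
  refine ⟨φ, mI_mono (fun e he => ?_) hφ⟩
  by_contra hcon
  simp only [Set.mem_ofPred_eq, not_exists, not_le] at hcon
  have h1 : wt L' e ≤ ∑ i, L' i * (c i : ℝ) := by
    refine Finset.sum_le_sum fun i _ => ?_
    by_cases hi : i ∈ I
    · obtain ⟨j, hj, hj2⟩ := (hc i hi).1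
      have := hcon j
      rw [hj] at this
      have h3 : e i ≤ c i := by omega
      exact mul_le_mul_of_nonneg_left (by exact_mod_cast h3) (hL' i)
    · simp [hz i hi]
  have h2 : l ≤ wt L' e := he
  linarith

theorem DescSetup.descent (h : DescSetup ψ w) (hm : 0 < m) (hf : f.Monic) (hd : f.natDegree = m)
    (φh : T) : ∃ φ : S, ψ φ - φh ∈
      mI (fun i => ψ (w i)) (JJ (fun i => ψ (w i)) (f.map ψ) m φh) := by
  classical
  obtain ⟨E, hE1, hE2, -⟩ := exists_gens (JJ (fun i => ψ (w i)) (f.map ψ) m φh)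
  have hup : ∀ σ : E → ι, IsUpperSet {b : ι → ℕ | ∃ j : E, j.1 (σ j) ≤ b (σ j)} := by
    rintro σ a b hab ⟨j, hj⟩
    exact ⟨j, hj.trans (hab _)⟩
  have key : ∀ s : Finset (E → ι), ∃ φ : S, ψ φ - φh ∈ mI (fun i => ψ (w i))
      (⋂ σ ∈ s, {b : ι → ℕ | ∃ j : E, j.1 (σ j) ≤ b (σ j)}) := by
    intro s
    induction s using Finset.induction_on with
    | empty => exact ⟨0, by simp [mI_univ]⟩
    | insert σ s _ ih =>
      obtain ⟨φ, hφ⟩ := ih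
      obtain ⟨φ', h'⟩ := h.desc_sigma hm hf hd φh E hE2 σ
      rw [Finset.set_biInter_insert]
      exact h.glue (hup σ) (isUpperSet_iInter₂ fun σ _ => hup σ) h' hφ
  obtain ⟨φ, hφ⟩ := key Finset.univ
  refine ⟨φ, mI_mono (fun b hb => ?_) hφ⟩
  simp only [Finset.mem_univ, Set.iInter_true, Set.mem_iInter] at hb
  by_contra hbJ
  have : ∀ j : E, ∃ i, b i < j.1 i := by
    intro j
    by_contra hc
    push Not at hc
    exact hbJ (JJ_upper _ hc (hE1 j.1 j.2))
  choose σ hσ using this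
  obtain ⟨j, hj⟩ := hb σ
  have := hσ j
  omega

end Descent

set_option linter.unusedSectionVars false

section RootLemma

lemma IsRegularLocalRing.dom {A : Type u} [CommRing A] [IsLocalRing A]
    (h : IsRegularLocalRing A) : IsDomain A := by
  classical
  obtain ⟨h1, n, s, hs, hd⟩ := h
  refine dom_of_dim n A (Finset.univ.image s) (by simpa using hs) ?_ hd.ge
  exact (Finset.card_image_le).trans (by simp)

lemma IsRegularRing.red {A : Type u} [CommRing A] (h : IsRegularRing A) : IsReduced A := by
  refine isReduced_ofLocalizationMaximal A fun J hJ => ?_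
  haveI := (h.2 J).dom
  infer_instance

lemma root_field {K : Type u} [Field K] {B : Type u} [CommRing B] [Algebra K B]
    (hgr : IsGeometricallyRegularAlgebra K B) (X : B) (r0 : K) (q : ℕ)
    (hq : q = 1 ∨ ∃ p e : ℕ, p.Prime ∧ (p : K) = 0 ∧ q = p ^ e)
    (hX : X ^ q = algebraMap K B r0) : ∃ ρ, X = algebraMap K B ρ := by
  rcases hq with rfl | ⟨p, e, hp, hpK, rfl⟩
  · exact ⟨r0, by simpa using hX⟩
  set P : Polynomial K := Polynomial.X ^ (p ^ e) - Polynomial.C r0 with hP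
  have hq0 : p ^ e ≠ 0 := pow_ne_zero _ hp.ne_zero
  let K' := P.SplittingField
  have hsp := Polynomial.SplittingField.splits P
  obtain ⟨r, hr⟩ : ∃ r : K', r ^ (p ^ e) = algebraMap K K' r0 := by
    have hdeg : (P.map (algebraMap K K')).degree ≠ 0 := by
      rw [Polynomial.degree_map, hP, Polynomial.degree_X_pow_sub_C (Nat.pos_of_ne_zero hq0)]
      exact_mod_cast hq0
    obtain ⟨r, hr⟩ := hsp.exists_eval_eq_zero hdeg
    refine ⟨r, ?_⟩
    rw [Polynomial.eval_map_algebraMap] at hr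
    have h2 : ∀ Q : Polynomial K, Q = Polynomial.X ^ (p ^ e) - Polynomial.C r0 →
        Polynomial.aeval r Q = r ^ (p ^ e) - algebraMap K K' r0 := by
      rintro Q rfl
      rw [map_sub, map_pow, Polynomial.aeval_X, Polynomial.aeval_C]
    rw [h2 P hP] at hr
    exact sub_eq_zero.1 hr
  haveI : Module.Finite K K' := inferInstance
  haveI hred := (hgr K').red
  have heq : (1 : K') ⊗ₜ[K] X = r ⊗ₜ[K] (1 : B) := by
    rcases subsingleton_or_nontrivial (K' ⊗[K] B) with hsub | hnt
    · exact Subsingleton.elim _ _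
    haveI : Fact p.Prime := ⟨hp⟩
    haveI : CharP K p := by
      rw [CharP.charP_iff_prime_eq_zero hp]; exact hpK
    haveI : CharP (K' ⊗[K] B) p :=
      charP_of_injective_algebraMap (algebraMap K (K' ⊗[K] B)).injective p
    have h0 : ((1 : K') ⊗ₜ[K] X - r ⊗ₜ[K] (1 : B)) ^ (p ^ e) = 0 := by
      rw [sub_pow_char_pow, Algebra.TensorProduct.tmul_pow, Algebra.TensorProduct.tmul_pow,
        hX, hr, one_pow, one_pow, Algebra.algebraMap_eq_smul_one, Algebra.algebraMap_eq_smul_one,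
        TensorProduct.tmul_smul, TensorProduct.smul_tmul', sub_self]
    exact sub_eq_zero.1 (pow_eq_zero_iff hq0 |>.1 h0)
  obtain ⟨g, hg⟩ := LinearMap.exists_leftInverse_of_injective (Algebra.linearMap K K')
    (LinearMap.ker_eq_bot.2 (algebraMap K K').injective)
  have hg1 : g 1 = 1 := by
    have := LinearMap.congr_fun hg 1
    simpa using this
  refine ⟨g r, ?_⟩
  have := congrArg (fun z => TensorProduct.lid K B (LinearMap.rTensor B g z)) heq
  simp only [LinearMap.rTensor_tmul, TensorProduct.lid_tmul, hg1, one_smul] at this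
  rw [this, Algebra.algebraMap_eq_smul_one]

lemma tensor_ker {S T : Type u} [CommRing S] [CommRing T] [Algebra S T] [Module.Flat S T]
    (P : Ideal S) [P.IsPrime] (y : T)
    (hy : (1 : ResidueField (Localization.AtPrime P)) ⊗ₜ[S] y = 0) :
    y ∈ P.map (algebraMap S T) := by
  let j : (S ⧸ P) →ₗ[S] ResidueField (Localization.AtPrime P) :=
    (IsScalarTower.toAlgHom S (S ⧸ P) (P.ResidueField)).toLinearMap
  have hj : Function.Injective j := IsFractionRing.injective (S ⧸ P) P.ResidueField
  have h1 := Module.Flat.rTensor_preserves_injective_linearMap (M := T) j hj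
  have h2 : (Ideal.Quotient.mk P 1) ⊗ₜ[S] y = 0 := by
    apply h1
    rw [LinearMap.rTensor_tmul, map_zero, ← hy]
    congr 1
    simp [j]
  have h3 := congrArg (TensorProduct.quotTensorEquivQuotSMul T P) h2
  rw [TensorProduct.quotTensorEquivQuotSMul_mk_tmul, map_zero, one_smul,
    Submodule.Quotient.mk_eq_zero, Ideal.smul_top_eq_map] at h3
  exact h3

lemma root_ff {S T : Type u} [CommRing S] [CommRing T] [Algebra S T] [Module.FaithfullyFlat S T]
    (P : Ideal S) [P.IsPrime]
    (hgr : IsGeometricallyRegularAlgebra (ResidueField (Localization.AtPrime P))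
      (ResidueField (Localization.AtPrime P) ⊗[S] T)) (c s : S) (q : ℕ) (x : T) (hc : c ∉ P)
    (hq : q = 1 ∨ ∃ p e : ℕ, p.Prime ∧ (p : S) ∈ P ∧ q = p ^ e)
    (h : algebraMap S T c * x ^ q - algebraMap S T s ∈ P.map (algebraMap S T)) :
    ∃ t, x - algebraMap S T t ∈ P.map (algebraMap S T) := by
  let K := ResidueField (Localization.AtPrime P)
  have hker : ∀ a : S, algebraMap S K a = 0 ↔ a ∈ P := fun a =>
    Ideal.algebraMap_residueField_eq_zero
  have hmapP : ∀ y ∈ P.map (algebraMap S T), (1 : K) ⊗ₜ[S] y = 0 := by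
    intro y hy
    have hle : P.map (algebraMap S T) ≤
        RingHom.ker (Algebra.TensorProduct.includeRight (R := S) (A := K) (B := T)) := by
      rw [Ideal.map_le_iff_le_comap]
      intro a ha
      rw [Ideal.mem_comap, RingHom.mem_ker, Algebra.TensorProduct.includeRight_apply,
        Algebra.algebraMap_eq_smul_one, TensorProduct.tmul_smul, TensorProduct.smul_tmul',
        ← Algebra.algebraMap_eq_smul_one, (hker a).2 ha, TensorProduct.zero_tmul]
    exact hle hy
  have hsm : ∀ (a : S) (k : K) (y : T), k ⊗ₜ[S] (algebraMap S T a * y)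
      = (algebraMap S K a * k) ⊗ₜ[S] y := by
    intro a k y
    rw [← Algebra.smul_def, TensorProduct.tmul_smul, TensorProduct.smul_tmul', Algebra.smul_def]
  have hcne : algebraMap S K c ≠ 0 := fun h => hc ((hker c).1 h)
  have hX : ((1 : K) ⊗ₜ[S] x) ^ q
      = algebraMap K (K ⊗[S] T) (algebraMap S K s / algebraMap S K c) := by
    have h1 := hmapP _ h
    rw [TensorProduct.tmul_sub, sub_eq_zero, hsm, mul_one] at h1
    have h2 := hsm s 1 1
    rw [mul_one, mul_one] at h2
    rw [h2] at h1
    rw [Algebra.TensorProduct.tmul_pow, one_pow]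
    have h3 := congrArg (fun z => (algebraMap S K c)⁻¹ • z) h1
    simp only [TensorProduct.smul_tmul', smul_eq_mul] at h3
    rw [inv_mul_cancel₀ hcne] at h3
    rw [h3, div_eq_inv_mul]
    rfl
  obtain ⟨ρ, hρ⟩ := root_field hgr _ _ q (by
    rcases hq with h | ⟨p, e, hp, hpP, rfl⟩
    · exact Or.inl h
    · refine Or.inr ⟨p, e, hp, ?_, rfl⟩
      have := (hker p).2 hpP
      simpa using this) hX
  obtain ⟨a', b', hb', hab⟩ := IsFractionRing.div_surjective (A := S ⧸ P) (K := P.ResidueField) ρ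
  obtain ⟨a, rfl⟩ := Ideal.Quotient.mk_surjective a'
  obtain ⟨b, rfl⟩ := Ideal.Quotient.mk_surjective b'
  have hea : ∀ a : S, algebraMap (S ⧸ P) P.ResidueField (Ideal.Quotient.mk P a)
      = algebraMap S K a := fun a => rfl
  have hbP : b ∉ P := by
    have := nonZeroDivisors.ne_zero hb'
    rwa [Ne, Ideal.Quotient.eq_zero_iff_mem] at this
  have hbne : algebraMap S K b ≠ 0 := fun h => hbP ((hker b).1 h)
  rw [hea, hea] at hab
  have h1 : algebraMap S T b * x - algebraMap S T a ∈ P.map (algebraMap S T) := by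
    refine tensor_ker P _ ?_
    have h2 := hsm a 1 1
    rw [mul_one, mul_one] at h2
    have h3 : (1 : K) ⊗ₜ[S] x = ρ ⊗ₜ[S] (1 : T) := hρ
    rw [TensorProduct.tmul_sub, hsm, mul_one]
    have h4 := congrArg (fun z => (algebraMap S K b) • z) h3
    simp only [TensorProduct.smul_tmul', smul_eq_mul, mul_one] at h4
    rw [h4, h2, ← hab, mul_div_cancel₀ _ hbne, sub_self]
  have h2 : a ∈ Ideal.span {b} ⊔ P := by
    rw [← Ideal.comap_map_eq_self_of_faithfullyFlat (B := T) (Ideal.span {b} ⊔ P), Ideal.mem_comap,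
      Ideal.map_sup]
    have e1 : algebraMap S T a = x * algebraMap S T b - (algebraMap S T b * x - algebraMap S T a) := by
      ring
    rw [e1]
    refine Ideal.sub_mem _ (Ideal.mem_sup_left ?_) (Ideal.mem_sup_right h1)
    exact Ideal.mul_mem_left _ _ (Ideal.mem_map_of_mem _ (Ideal.mem_span_singleton_self b))
  obtain ⟨y, hy, π, hπ, hyπ⟩ := Submodule.mem_sup.1 h2
  obtain ⟨t, rfl⟩ := Ideal.mem_span_singleton'.1 hy
  refine ⟨t, tensor_ker P _ ?_⟩
  have h3 : algebraMap S T b * (x - algebraMap S T t) ∈ P.map (algebraMap S T) := by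
    have := Ideal.add_mem _ h1 (Ideal.mem_map_of_mem (algebraMap S T) hπ)
    rw [← hyπ] at this
    convert this using 1
    simp only [map_add, map_mul]; ring
  have h4 := hmapP _ h3
  rw [hsm, mul_one] at h4
  have h5 := congrArg (fun z => (algebraMap S K b)⁻¹ • z) h4
  simp only [TensorProduct.smul_tmul', smul_eq_mul, smul_zero] at h5
  rwa [inv_mul_cancel₀ hbne] at h5

end RootLemma

set_option linter.unusedSectionVars false

section ComplS

lemma compl_max (A : Type u) [CommRing A] [IsLocalRing A] [IsNoetherianRing A] :
    maximalIdeal (Completion A) = (maximalIdeal A).map (cmpl (R := A)) :=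
  AdicCompletion.maximalIdeal_eq_map

lemma compl_ff (A : Type u) [CommRing A] [IsLocalRing A] [IsNoetherianRing A] :
    Module.FaithfullyFlat A (Completion A) := by
  haveI : Module.Flat A (Completion A) := AdicCompletion.flat_of_isNoetherian (maximalIdeal A)
  exact Module.FaithfullyFlat.of_flat_of_isLocalHom

lemma compl_contr (A : Type u) [CommRing A] [IsLocalRing A] [IsNoetherianRing A] (I : Ideal A) :
    (I.map (cmpl (R := A))).comap cmpl = I := by
  haveI := compl_ff A
  exact Ideal.comap_map_eq_self_of_faithfullyFlat (B := Completion A) I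

lemma MP_map {S T : Type u} [CommRing S] [CommRing T] (ψ : S →+* T)
    (contr : ∀ I : Ideal S, (I.map ψ).comap ψ = I) {ι : Type} [Fintype ι] {w : ι → S}
    [IsLocalRing S] [IsLocalRing T]
    (h : MP w) : MP (fun i => ψ (w i)) := by
  intro e he
  apply h e
  rw [← contr (mI w (bx e)), Ideal.mem_comap, map_mI, map_mon]
  exact he

lemma span_map {S T : Type u} [CommRing S] [CommRing T] (ψ : S →+* T) {ι : Type} (w : ι → S) :
    (Ideal.span (Set.range w)).map ψ = Ideal.span (Set.range fun i => ψ (w i)) := by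
  rw [Ideal.map_span, ← Set.range_comp]; rfl

lemma MP_compl {A : Type u} [CommRing A] [IsLocalRing A] [IsNoetherianRing A]
    {ι : Type} [Fintype ι] {w : ι → A} (h : MP w) : MP (fun i => cmpl (w i)) :=
  MP_map cmpl (compl_contr A) h

lemma MonSys_compl {A : Type u} [CommRing A] [IsLocalRing A] [IsNoetherianRing A]
    {ι : Type} [Fintype ι] {w : ι → A} (h : MonSys w) : MonSys (fun i => cmpl (w i)) := by
  refine monSys_of_complete ?_ (MP_compl h.mp)
  rw [compl_max, ← span_map]
  exact congrArg (Ideal.map (cmpl (R := A))) h.hw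

lemma loc_bij (S : Type u) [CommRing S] [IsLocalRing S] :
    Function.Bijective (algebraMap S (Localization.AtPrime (maximalIdeal S))) := by
  have H : ∀ x ∈ (maximalIdeal S).primeCompl, IsUnit x := fun x hx => by
    simpa [Ideal.primeCompl] using hx
  have := (IsLocalization.atUnits S (maximalIdeal S).primeCompl
    (S := Localization.AtPrime (maximalIdeal S)) H).bijective
  convert this using 1
  ext x; simp

lemma setup_exists {S : Type u} [CommRing S] [IsLocalRing S] (hG : IsGRing S)
    {d : ℕ} (u : Fin d → S) (hu : IsSysOfParams S u) :
    ∃ (T : Type u) (_ : CommRing T) (_ : IsLocalRing T) (_ : IsAdicComplete (maximalIdeal T) T)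
      (ψ : S →+* T), DescSetup ψ u ∧ maximalIdeal T = (maximalIdeal S).map ψ := by
  haveI := hG.1
  set S' := Localization.AtPrime (maximalIdeal S)
  haveI : IsNoetherianRing S' := IsLocalization.isNoetherianRing (maximalIdeal S).primeCompl _ hG.1
  haveI hff := compl_ff S'
  let e : S ≃+* S' := RingEquiv.ofBijective _ (loc_bij S)
  let e' : S →+* S' := algebraMap S S'
  let ψ : S →+* Completion S' := cmpl.comp e'
  have hmax : maximalIdeal (Completion S') = (maximalIdeal S).map ψ := by
    rw [compl_max, ← Ideal.map_map, Localization.AtPrime.map_eq_maximalIdeal]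
  have hcontr : ∀ I : Ideal S, (I.map ψ).comap ψ = I := by
    intro I
    rw [← Ideal.map_map, ← Ideal.comap_comap, compl_contr]
    exact Ideal.comap_map_of_bijective e' (loc_bij S)
  have hd : (Fintype.card (Fin d) : WithBot ℕ∞) ≤ ringKrullDim S := by
    rw [hu.2]; simp
  refine ⟨Completion S', inferInstance, inferInstance, inferInstance, ψ, ⟨?_, ?_, hcontr, ?_, ?_⟩, hmax⟩
  · exact monSys_of_dim hu.1 hd
  · refine monSys_of_complete ?_ (MP_map ψ hcontr (mp_of_dim hu.1 hd))
    rw [hmax, ← span_map]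
    exact congrArg (Ideal.map ψ) hu.1
  · exact prime_span hu.1 hd
  · intro P hP c s q x hc hq h
    haveI hP' : (P.map e').IsPrime := Ideal.map_isPrime_of_equiv e
    have hmem : ∀ a, e' a ∈ P.map e' → a ∈ P := by
      intro a ha
      have := Ideal.comap_map_of_bijective e' (loc_bij S) (I := P)
      rw [← this]; exact ha
    have hmm : P.map ψ = (P.map e').map (algebraMap S' (Completion S')) := by
      rw [Ideal.map_map]; rfl
    rw [hmm] at h ⊢
    obtain ⟨t, ht⟩ := root_ff (T := Completion S') (P.map e') (hG.2 (maximalIdeal S) (P.map e')) (e' c) (e' s) q x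
      (fun h => hc (hmem _ h)) (by
        rcases hq with h | ⟨p, n, hp, hpP, rfl⟩
        · exact Or.inl h
        · refine Or.inr ⟨p, n, hp, ?_, rfl⟩
          have := Ideal.mem_map_of_mem e' hpP
          simpa using this) h
    obtain ⟨t', rfl⟩ := (loc_bij S).2 t
    exact ⟨t', ht⟩

lemma Gp_transfer {S T : Type u} [CommRing S] [IsLocalRing S] [CommRing T] [IsLocalRing T]
    {ψ : S →+* T} {ι : Type} [Fintype ι] {w : ι → S} (h : DescSetup ψ w) (f : Polynomial S) (m : ℕ)
    (φ : S) (L : ι → ℝ) (l : ℝ) :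
    Gp (fun i => ψ (w i)) (f.map ψ) m (ψ φ) L l ↔ Gp w f m φ L l := by
  unfold Gp
  refine forall_congr' fun b => forall_congr' fun _ => ?_
  have : (Polynomial.taylor (ψ φ) (f.map ψ)).coeff b = ψ ((Polynomial.taylor φ f).coeff b) := by
    rw [← Polynomial.map_taylor, Polynomial.coeff_map]
  rw [this]
  refine ⟨h.contr_mI, fun hh => ?_⟩
  rw [← map_mI]
  exact Ideal.mem_map_of_mem _ hh

lemma exists_min_S {S : Type u} [CommRing S] [IsLocalRing S] (hG : IsGRing S)
    {d : ℕ} (u : Fin d → S) (hu : IsSysOfParams S u) {f : Polynomial S} {m : ℕ} (hm : 0 < m)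
    (hf : f.Monic) (hd : f.natDegree = m) (hc : ∀ i < m, f.coeff i ∈ maximalIdeal S) :
    ∃ φ ∈ maximalIdeal S, ∀ φ' ∈ maximalIdeal S, Le u f m φ' φ → Le u f m φ φ' := by
  obtain ⟨T, _, _, _, ψ, h, hmax⟩ := setup_exists hG u hu
  have hfT : (f.map ψ).Monic := hf.map ψ
  have hdT : (f.map ψ).natDegree = m := by rw [hf.natDegree_map, hd]
  have hmem : ∀ a, ψ a ∈ maximalIdeal T ↔ a ∈ maximalIdeal S := by
    intro a
    rw [hmax, ← Ideal.mem_comap, h.contr]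
  have hcT : ∀ i < m, (f.map ψ).coeff i ∈ maximalIdeal T := by
    intro i hi
    rw [Polynomial.coeff_map, hmem]; exact hc i hi
  obtain ⟨φh, hφh, hmin⟩ := exists_minimal h.msT hm hfT hdT hcT
  obtain ⟨φ, hφ⟩ := h.descent hm hf hd φh
  have hle := Le_of_JJ hfT hdT hφ
  have hφT : ψ φ ∈ maximalIdeal T := by
    have := Ideal.add_mem _ (JJ_le_max h.msT.hw hm hfT hdT hcT hφh hφ) hφh
    simpa using this
  refine ⟨φ, (hmem φ).1 hφT, fun φ' hφ' hle' L l hL hg => ?_⟩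
  have h1 : Le (fun i => ψ (u i)) (f.map ψ) m (ψ φ') (ψ φ) := by
    intro L l hL hg
    rw [Gp_transfer h] at hg ⊢
    exact hle' L l hL hg
  have h2 := hmin _ ((hmem φ').2 hφ') (h1.trans hle)
  rw [← Gp_transfer h] at hg ⊢
  exact (hle.trans h2) L l hL hg

end ComplS

set_option linter.unusedSectionVars false

section Opt

variable {ι : Type} [Fintype ι]

def zw {B : Type u} (z : B) (v : ι → B) : Option ι → B := fun o => o.elim z v

def oe (a : ι → ℕ) (b : ℕ) : Option ι → ℕ := fun o => o.elim b a

def ow (L : ι → ℝ) (l : ℝ) : Option ι → ℝ := fun o => o.elim l L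

def oq : ((ι → ℕ) × ℕ) ≃ (Option ι → ℕ) where
  toFun ab := oe ab.1 ab.2
  invFun e := (fun i => e (some i), e none)
  left_inv ab := rfl
  right_inv e := by
    funext o; cases o <;> rfl

lemma oe_eta (e : Option ι → ℕ) : oe (fun i => e (some i)) (e none) = e := oq.right_inv e

lemma oe_inj {a a' : ι → ℕ} {b b' : ℕ} (h : oe a b = oe a' b') : a = a' ∧ b = b' := by
  have := oq.injective (a₁ := (a, b)) (a₂ := (a', b')) h
  simpa using this

lemma mon_zw {B : Type u} [CommRing B] (z : B) (v : ι → B) (e : Option ι → ℕ) :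
    mon (zw z v) e = z ^ (e none) * mon v (fun i => e (some i)) := by
  simp [mon, zw, Fintype.prod_option]

lemma mon_zw_oe {B : Type u} [CommRing B] (z : B) (v : ι → B) (a : ι → ℕ) (b : ℕ) :
    mon (zw z v) (oe a b) = z ^ b * mon v a := mon_zw z v _

lemma wt_ow (L : ι → ℝ) (l : ℝ) (e : Option ι → ℕ) :
    wt (ow L l) e = l * (e none : ℝ) + wt L (fun i => e (some i)) := by
  simp [wt, ow, Fintype.sum_option]

lemma wt_ow_oe (L : ι → ℝ) (l : ℝ) (a : ι → ℕ) (b : ℕ) :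
    wt (ow L l) (oe a b) = l * (b : ℝ) + wt L a := wt_ow L l _

lemma ow_nonneg {L : ι → ℝ} (hL : ∀ i, 0 ≤ L i) {l : ℝ} (hl : 0 ≤ l) : ∀ o, 0 ≤ ow L l o := by
  intro o; cases o
  · exact hl
  · exact hL _

lemma oe_mono {a a' : ι → ℕ} {b b' : ℕ} (h : a ≤ a') (h' : b ≤ b') : oe a b ≤ oe a' b' := by
  intro o; cases o
  · exact h'
  · exact h _

variable {S B : Type u} [CommRing S] [IsLocalRing S] [CommRing B] [IsLocalRing B]
  {θ : S →+* B} {w : ι → S} {z : B}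

lemma slice_upper {E : Set (Option ι → ℕ)} (hE : IsUpperSet E) (b : ℕ) :
    IsUpperSet {a : ι → ℕ | oe a b ∈ E} := fun _ _ h ha => hE (oe_mono h le_rfl) ha

/-- coefficientwise detection of membership in monomial ideals -/
lemma lemmaQ (hS : MonSys w) (hB : MP (zw z fun i => θ (w i))) {E : Set (Option ι → ℕ)}
    (hE : IsUpperSet E) (n : ℕ) (h : ℕ → S)
    (hmem : ∑ b ∈ Finset.range n, θ (h b) * z ^ b ∈ mI (zw z fun i => θ (w i)) E) (b : ℕ)
    (hb : b < n) : h b ∈ mI w {a | oe a b ∈ E} := by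
  classical
  choose F c hF _ hh using fun b => hS.unit_exp (h b)
  let G : Finset (Option ι → ℕ) := ((Finset.range n).sigma F).image fun p => oe p.2 p.1
  let C : (Option ι → ℕ) → B := fun e => θ (c (e none) fun i => e (some i))
  have hsum : ∑ e ∈ G, C e * mon (zw z fun i => θ (w i)) e
      = ∑ b ∈ Finset.range n, θ (h b) * z ^ b := by
    rw [Finset.sum_image, Finset.sum_sigma]
    · refine Finset.sum_congr rfl fun b _ => ?_
      conv_rhs => rw [hh b, map_sum, Finset.sum_mul]
      refine Finset.sum_congr rfl fun a _ => ?_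
      rw [mon_zw_oe, map_mul, map_mon]
      change θ (c b a) * _ = _
      ring
    · rintro ⟨b, a⟩ _ ⟨b', a'⟩ _ hab
      obtain ⟨rfl, rfl⟩ := oe_inj hab
      rfl
  have key := ue_sub hB hE (F := G) (c := C) (by
    intro e he
    obtain ⟨⟨b, a⟩, hp, rfl⟩ := Finset.mem_image.1 he
    rw [Finset.mem_sigma] at hp
    exact ((hF b a hp.2).2).map θ) (by rw [hsum]; exact hmem)
  rw [hh b]
  refine Ideal.sum_mem _ fun a ha => Ideal.mul_mem_left _ _ (mon_mem ?_)
  exact key _ (Finset.mem_image.2 ⟨⟨b, a⟩, Finset.mem_sigma.2 ⟨Finset.mem_range.2 hb, ha⟩, rfl⟩)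

lemma lemmaQ_conv {E : Set (Option ι → ℕ)} {h : S} {b : ℕ}
    (hh : h ∈ mI w {a | oe a b ∈ E}) : θ h * z ^ b ∈ mI (zw z fun i => θ (w i)) E := by
  have h1 : θ h ∈ mI (fun i => θ (w i)) {a | oe a b ∈ E} := by
    rw [← map_mI]; exact Ideal.mem_map_of_mem _ hh
  obtain ⟨F, c, hF, hx⟩ := mI_exp h1
  rw [hx, Finset.sum_mul]
  refine Ideal.sum_mem _ fun a ha => ?_
  have h2 := mon_mem (w := zw z fun i => θ (w i)) (hF a ha)
  rw [mon_zw_oe] at h2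
  have : c a * mon (fun i => θ (w i)) a * z ^ b = c a * (z ^ b * mon (fun i => θ (w i)) a) := by ring
  rw [this]
  exact Ideal.mul_mem_left _ _ h2

lemma slice_GE {L : ι → ℝ} {l r : ℝ} {b : ℕ} :
    {a : ι → ℕ | oe a b ∈ GE (ow L l) r} = GE L (r - l * b) := by
  ext a
  simp only [GE, Set.mem_ofPred_eq, wt_ow_oe]
  constructor <;> intro h <;> linarith

lemma slice_GT {L : ι → ℝ} {l r : ℝ} {b : ℕ} :
    {a : ι → ℕ | oe a b ∈ GT (ow L l) r} = GT L (r - l * b) := by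
  ext a
  simp only [GT, Set.mem_ofPred_eq, wt_ow_oe]
  constructor <;> intro h <;> linarith

/-- the polynomial `f` evaluated via its Taylor expansion -/
def TF (θ : S →+* B) (f : Polynomial S) (m : ℕ) (φ : S) (z : B) : B :=
  ∑ b ∈ Finset.range (m + 1), θ ((Polynomial.taylor φ f).coeff b) * z ^ b

lemma Gp_of_TF (hS : MonSys w) (hB : MP (zw z fun i => θ (w i))) {f : Polynomial S} {m : ℕ} {φ : S}
    {L : ι → ℝ} {l : ℝ} (hL : ∀ i, 0 ≤ L i) (hl : 0 ≤ l)
    (h : TF θ f m φ z ∈ mI (zw z fun i => θ (w i)) (GE (ow L l) (m * l))) : Gp w f m φ L l := by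
  intro b hb
  have := lemmaQ hS hB (GE_upper (ow_nonneg hL hl) _) (m + 1) _ h b (by omega)
  rw [slice_GE] at this
  convert this using 3; ring

lemma TF_of_Gp {f : Polynomial S} {m : ℕ} {φ : S} {L : ι → ℝ} {l : ℝ} (hL : ∀ i, 0 ≤ L i)
    (h : Gp w f m φ L l) : TF θ f m φ z ∈ mI (zw z fun i => θ (w i)) (GE (ow L l) (m * l)) := by
  refine Ideal.sum_mem _ fun b hb => ?_
  refine lemmaQ_conv ?_
  rw [slice_GE]
  rcases lt_or_eq_of_le (Nat.lt_succ_iff.1 (Finset.mem_range.1 hb)) with hb' | rfl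
  · have := h b hb'
    convert this using 3; ring
  · exact GE_zero hL (by ring_nf; exact le_rfl) _

end Opt

section Poly

variable {d : ℕ}

lemma smallest_F (X : Set (Fin d → ℝ)) (hX : X ⊆ orthant d) : IsFSubset (smallestFSubset X) := by
  have ho : IsFSubset (orthant d) := by
    refine ⟨le_rfl, ?_, ?_, fun v hv w hw i => add_nonneg (hv i) (hw i)⟩
    · have : orthant d = ⋂ i, {x : Fin d → ℝ | 0 ≤ x i} := by ext; simp [orthant]
      rw [this]
      exact isClosed_iInter fun i => isClosed_le continuous_const (continuous_apply i)
    · intro x hx y hy a b ha hb _ i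
      exact add_nonneg (mul_nonneg ha (hx i)) (mul_nonneg hb (hy i))
  refine ⟨fun x hx => hx _ ⟨ho, hX⟩, isClosed_sInter fun Δ h => h.1.2.1,
    convex_sInter fun Δ h => h.1.2.2.1, fun v hv w hw Δ h => h.1.2.2.2 v (hv Δ h) w hw⟩

lemma half_F (L : Fin d → ℝ) (hL : ∀ i, 0 ≤ L i) (l : ℝ) :
    IsFSubset {x : Fin d → ℝ | x ∈ orthant d ∧ l ≤ ∑ i, L i * x i} := by
  refine ⟨fun x hx => hx.1, ?_, ?_, ?_⟩
  · have : {x : Fin d → ℝ | x ∈ orthant d ∧ l ≤ ∑ i, L i * x i} =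
        (⋂ i, {x : Fin d → ℝ | 0 ≤ x i}) ∩ {x | l ≤ ∑ i, L i * x i} := by ext; simp [orthant]
    rw [this]
    refine (isClosed_iInter fun i => isClosed_le continuous_const (continuous_apply i)).inter ?_
    exact isClosed_le continuous_const
      (continuous_finsetSum _ fun i _ => continuous_const.mul (continuous_apply i))
  · rintro x ⟨hx, hx'⟩ y ⟨hy, hy'⟩ a b ha hb hab
    refine ⟨fun i => add_nonneg (mul_nonneg ha (hx i)) (mul_nonneg hb (hy i)), ?_⟩
    have : ∑ i, L i * (a • x + b • y) i = a * ∑ i, L i * x i + b * ∑ i, L i * y i := by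
      rw [Finset.mul_sum, Finset.mul_sum, ← Finset.sum_add_distrib]
      exact Finset.sum_congr rfl fun i _ => by simp; ring
    rw [this]
    have e1 := mul_le_mul_of_nonneg_left hx' ha
    have e2 := mul_le_mul_of_nonneg_left hy' hb
    have e3 : a * l + b * l = l := by rw [← add_mul, hab, one_mul]
    linarith
  · rintro v ⟨hv, hv'⟩ w hw
    refine ⟨fun i => add_nonneg (hv i) (hw i), hv'.trans ?_⟩
    exact pair_mono hL fun i => le_add_of_nonneg_right (hw i)

lemma smallest_half {X : Set (Fin d → ℝ)} (hX : X ⊆ orthant d) {L : Fin d → ℝ} (hL : ∀ i, 0 ≤ L i)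
    {l : ℝ} (h : ∀ x ∈ X, l ≤ ∑ i, L i * x i) {x : Fin d → ℝ} (hx : x ∈ smallestFSubset X) :
    l ≤ ∑ i, L i * x i :=
  (hx _ ⟨half_F L hL l, fun y hy => ⟨hX hy, h y hy⟩⟩).2

lemma smallest_sep {X : Set (Fin d → ℝ)} (hX : X ⊆ orthant d) {x : Fin d → ℝ} (hx0 : x ∈ orthant d)
    (hx : x ∉ smallestFSubset X) : ∃ (L : Fin d → ℝ) (l : ℝ), (∀ i, 0 ≤ L i) ∧ 0 < l ∧
      ∑ i, L i * x i < l ∧ ∀ p ∈ X, l ≤ ∑ i, L i * p i := by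
  have hF := smallest_F X hX
  obtain ⟨L, l, h1, -, h2, h3⟩ := hb_cone _ Finset.univ hF.2.1 hF.2.2.1
    (fun k hk v hv => hF.2.2.2 k hk v fun i => hv i (Finset.mem_univ i)) x hx
  refine ⟨L, l, h1, ?_, h2, fun p hp => h3 p fun Δ hΔ => hΔ.2 hp⟩
  exact lt_of_le_of_lt (Finset.sum_nonneg fun i _ => mul_nonneg (h1 i) (hx0 i)) h2

lemma exp_orth {R : Type u} [CommRing R] (f y : R) (u : Fin d → R) (m : ℕ) :
    (⋃ c ∈ {c | IsUnitExpansion f y u c}, expPoints m c.support) ⊆ orthant d := by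
  intro x hx
  simp only [Set.mem_iUnion] at hx
  obtain ⟨c, _, ab, _, hb, rfl⟩ := hx
  intro i
  have : (ab.2:ℝ) < m := by exact_mod_cast hb
  exact div_nonneg (Nat.cast_nonneg _) (by linarith)

lemma monomial_eq {R : Type u} [CommRing R] (y : R) (u : Fin d → R) (ab : (Fin d → ℕ) × ℕ) :
    monomial y u ab = mon (zw y u) (oq ab) := by
  rw [mon_zw]; rfl

lemma pair_proj (L : Fin d → ℝ) (m : ℕ) (ab : (Fin d → ℕ) × ℕ) :
    ∑ i, L i * projPoint m ab i = wt L ab.1 / ((m : ℝ) - ab.2) := pair_div L ab.1 _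

variable {B : Type u} [CommRing B] [IsLocalRing B]

/-- separating a point from `DeltaOf` -/
lemma delta_sep {F y : B} {v : Fin d → B} (hs : MonSys (zw y v)) {m : ℕ} {x : Fin d → ℝ}
    (hx0 : x ∈ orthant d) (hx : x ∉ DeltaOf F y v m) :
    ∃ (L : Fin d → ℝ) (l : ℝ), (∀ i, 0 ≤ L i) ∧ 0 < l ∧ ∑ i, L i * x i < l ∧
      F ∈ mI (zw y v) (GE (ow L l) (m * l)) := by
  classical
  obtain ⟨L, l, hL, hl, hxl, hX⟩ := smallest_sep (exp_orth F y v m) hx0 hx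
  refine ⟨L, l, hL, hl, hxl, ?_⟩
  obtain ⟨G, c, hG, -, hh⟩ := hs.unit_exp F
  let c' : ((Fin d → ℕ) × ℕ) →₀ B :=
    Finsupp.onFinset (G.map oq.symm.toEmbedding) (fun ab => if oq ab ∈ G then c (oq ab) else 0) (by
      intro ab hab
      have : oq ab ∈ G := by by_contra h; simp [h] at hab
      exact Finset.mem_map.2 ⟨oq ab, this, by simp⟩)
  have hc' : ∀ ab, c' ab = if oq ab ∈ G then c (oq ab) else 0 := fun _ => rfl
  have hue : IsUnitExpansion F y v c' := by
    refine ⟨?_, ?_⟩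
    · intro ab hab
      rw [Finsupp.mem_support_iff, hc'] at hab
      have : oq ab ∈ G := by by_contra h; simp [h] at hab
      rw [hc', if_pos this]
      exact (hG _ this).2
    · rw [Finsupp.onFinset_sum _ (by simp), Finset.sum_map]
      conv_lhs => rw [hh]
      refine Finset.sum_congr rfl fun e he => ?_
      simp [he, monomial_eq]
  rw [hh]
  refine Ideal.sum_mem _ fun e he => Ideal.mul_mem_left _ _ (mon_mem ?_)
  change (m:ℝ) * l ≤ wt (ow L l) e
  rw [wt_ow]
  have h0 := wt_nonneg hL (fun i => e (some i))
  rcases lt_or_ge (e none) m with hb | hb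
  · have hb' : (0:ℝ) < (m:ℝ) - (e none) := by
      have : ((e none : ℕ):ℝ) < m := by exact_mod_cast hb
      linarith
    have := hX (projPoint m (oq.symm e)) (by
      simp only [Set.mem_iUnion]
      refine ⟨c', hue, oq.symm e, ?_, hb, rfl⟩
      rw [Finsupp.mem_support_iff, hc']
      simp only [Equiv.apply_symm_apply, he, if_true]
      exact (hG e he).2.ne_zero)
    rw [pair_proj] at this
    change l ≤ wt L (fun i => e (some i)) / ((m:ℝ) - (e none)) at this
    rw [le_div_iff₀ hb'] at this
    linarith
  · have : (m:ℝ) ≤ (e none) := by exact_mod_cast hb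
    nlinarith

/-- membership in a monomial ideal bounds `DeltaOf` -/
lemma exp_bound {F y : B} {v : Fin d → B} (hmp : MP (zw y v)) {m : ℕ} {L : Fin d → ℝ} {l : ℝ}
    (hL : ∀ i, 0 ≤ L i) (hl : 0 < l) (hF : F ∈ mI (zw y v) (GE (ow L l) (m * l)))
    {x : Fin d → ℝ} (hx : x ∈ ⋃ c ∈ {c | IsUnitExpansion F y v c}, expPoints m c.support) :
    l ≤ ∑ i, L i * x i := by
  classical
  simp only [Set.mem_iUnion] at hx
  obtain ⟨c, hc, ab, hab, hb, rfl⟩ := hx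
  have hue : IsUnitExpansion F y v c := hc
  have h1 : F = ∑ e ∈ c.support.map oq.toEmbedding, c (oq.symm e) * mon (zw y v) e := by
    rw [Finset.sum_map]
    refine hue.2.trans ?_
    refine Finset.sum_congr rfl fun e _ => ?_
    simp [monomial_eq]
  have h2 := ue_sub hmp (GE_upper (ow_nonneg hL hl.le) (m * l)) (F := c.support.map oq.toEmbedding)
    (c := fun e => c (oq.symm e)) (by
      intro e he
      obtain ⟨ab, hab, rfl⟩ := Finset.mem_map.1 he
      simpa using hue.1 ab hab) (by rw [← h1]; exact hF) (oq ab)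
      (Finset.mem_map.2 ⟨ab, hab, rfl⟩)
  have h3 : (m:ℝ) * l ≤ wt (ow L l) (oe ab.1 ab.2) := h2
  rw [wt_ow_oe] at h3
  have hb' : (0:ℝ) < (m:ℝ) - ab.2 := by
    have : (ab.2:ℝ) < m := by exact_mod_cast hb
    linarith
  rw [pair_proj, le_div_iff₀ hb']
  linarith

variable {S : Type u} [CommRing S] [IsLocalRing S] {θ : S →+* B} {w : Fin d → S} {z : B}
  {f : Polynomial S} {m : ℕ} {φ : S}

lemma PT_orth : PT w f m φ ⊆ orthant d := fun _ hx i => PT_nonneg hx i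

lemma delta_eq_H (hS : MonSys w) (hB : MonSys (zw z fun i => θ (w i))) :
    DeltaOf (TF θ f m φ z) z (fun i => θ (w i)) m = smallestFSubset (PT w f m φ) := by
  apply Set.Subset.antisymm
  · intro x hx Δ hΔ
    refine hx Δ ⟨hΔ.1, fun p hp => ?_⟩
    by_contra hpΔ
    have hp' : p ∉ smallestFSubset (PT w f m φ) → False := by
      intro hp''
      obtain ⟨L, l, hL, hl, hpl, hX⟩ := smallest_sep PT_orth (exp_orth _ _ _ _ hp) hp''
      have := exp_bound hB.mp hL hl (TF_of_Gp hL ((Gp_iff_PT hS hL).2 hX)) hp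
      linarith
    exact hp' fun h => hpΔ (h Δ hΔ)
  · intro x hx
    by_contra hx'
    obtain ⟨L, l, hL, hl, hxl, hF⟩ := delta_sep hB ((smallest_F _ PT_orth).1 hx) hx'
    have := smallest_half PT_orth hL ((Gp_iff_PT hS hL).1 (Gp_of_TF hS hB.mp hL hl.le hF)) hx
    linarith

end Poly

set_option linter.unusedSectionVars false

section Cmp

variable {ι : Type} [Fintype ι] {S B : Type u} [CommRing S] [IsLocalRing S] [CommRing B]
  [IsLocalRing B] {θ : S →+* B} {w : ι → S} {z y : B} {v : ι → B}
  {f : Polynomial S} {m : ℕ} {φ : S}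

lemma MonSys.initial' (hs : MonSys w) {h : S} {L : ι → ℝ} {l : ℝ} {p : ι → ℕ}
    (hp : p ∈ ES w h) (hpl : wt L p < l) (hL0 : ∀ i, 0 ≤ L i)
    (hgen : ∀ e e' : ι → ℕ, wt L e < l → wt L e = wt L e' → e = e') :
    ∃ e c, IsUnit c ∧ wt L e < l ∧ h - c * mon w e ∈ mI w (GT L (wt L e)) := by
  classical
  obtain ⟨F, c, hF, hdom, hh⟩ := hs.unit_exp h
  obtain ⟨q, hq, hqp⟩ := hdom p hp
  obtain ⟨e, he, hmin⟩ := F.exists_min_image (wt L) ⟨q, hq⟩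
  have hlt : wt L e < l := lt_of_le_of_lt ((hmin q hq).trans (wt_mono hL0 hqp)) hpl
  refine ⟨e, c e, (hF e he).2, hlt, ?_⟩
  rw [hh, ← Finset.add_sum_erase _ _ he, add_sub_cancel_left]
  refine Ideal.sum_mem _ fun b hb => Ideal.mul_mem_left _ _ (mon_mem ?_)
  rw [Finset.mem_erase] at hb
  exact lt_of_le_of_ne (hmin b hb.2) (fun h => hb.1 (hgen _ _ hlt h).symm)

lemma exists_K {F : B} {L : ι → ℝ} {l : ℝ} (h : F ∈ mI (zw y v) (GE (ow L l) (m * l))) :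
    ∃ ε K, F = ε * y ^ m + K ∧ K ∈ mI (zw y v) {e | e none < m ∧ e ∈ GE (ow L l) (m * l)} := by
  have h1 : F ∈ mI (zw y v) ({oe 0 m} ∪ {e | e none < m ∧ e ∈ GE (ow L l) (m * l)}) := by
    refine mI_dom (fun e he => ?_) h
    rcases lt_or_ge (e none) m with hb | hb
    · exact ⟨e, Or.inr ⟨hb, he⟩, le_rfl⟩
    · refine ⟨oe 0 m, Or.inl rfl, ?_⟩
      intro o; cases o
      · exact hb
      · exact Nat.zero_le _
  rw [mI_union] at h1
  obtain ⟨a, ha, K, hK, rfl⟩ := Submodule.mem_sup.1 h1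
  unfold mI at ha
  rw [Set.image_singleton, mon_zw_oe, mon_zero, mul_one, Ideal.mem_span_singleton'] at ha
  obtain ⟨ε, rfl⟩ := ha
  exact ⟨ε, K, rfl, hK⟩

lemma mon_v_mem (L : ι → ℝ) (l : ℝ) (a : ι → ℕ) :
    mon v a ∈ mI (zw z v) (GE (ow L l) (wt L a)) := by
  have : mon v a = mon (zw z v) (oe a 0) := by rw [mon_zw_oe]; simp
  rw [this]
  refine mon_mem ?_
  change wt L a ≤ wt (ow L l) (oe a 0)
  rw [wt_ow_oe]; simp

lemma K_mem {L : ι → ℝ} {l l' μ : ℝ} (hy : y ∈ mI (zw z v) (GE (ow L l) μ)) (hμ : μ < l') :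
    mI (zw y v) {e | e none < m ∧ e ∈ GE (ow L l') (m * l')} ≤
      mI (zw z v) (GT (ow L l) (m * μ)) := by
  refine mI_le ?_
  rintro e ⟨hb, he⟩
  have he' : (m:ℝ) * l' ≤ wt (ow L l') e := he
  rw [wt_ow] at he'
  rw [mon_zw]
  refine GE_le_GT ?_ (GE_mul (GE_pow hy (e none)) (mon_v_mem L l _))
  have hb' : (0:ℝ) < (m:ℝ) - (e none) := by
    have : ((e none : ℕ):ℝ) < m := by exact_mod_cast hb
    linarith
  nlinarith

lemma span_zw : Ideal.span (Set.range (zw z v)) = Ideal.span (insert z (Set.range v)) := by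
  congr 1
  ext x; constructor
  · rintro ⟨o, rfl⟩
    cases o
    · exact Or.inl rfl
    · exact Or.inr ⟨_, rfl⟩
  · rintro (rfl | ⟨i, rfl⟩)
    · exact ⟨none, rfl⟩
    · exact ⟨some i, rfl⟩

lemma Ju_le_bx (k : ℕ) : Ideal.span (Set.range v) ≤ mI (zw z v) (bx (oe 0 k)) := by
  classical
  rw [Ideal.span_le]
  rintro _ ⟨i, rfl⟩
  have : v i = mon (zw z v) (oe (Pi.single i 1) 0) := by
    rw [mon_zw_oe, mon_single]; simp
  rw [SetLike.mem_coe, this]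
  refine mon_mem fun h => ?_
  have := h (some i)
  simp [oe] at this

lemma pow_notin_Ju (hmp : MP (zw z v)) (k : ℕ) : z ^ k ∉ Ideal.span (Set.range v) := by
  intro h
  apply hmp (oe 0 k)
  rw [mon_zw_oe, mon_zero, mul_one]
  exact Ju_le_bx k h

lemma mon_mem_Ju {a : ι → ℕ} (ha : a ≠ 0) : mon v a ∈ Ideal.span (Set.range v) := by
  classical
  obtain ⟨i, hi⟩ := Function.ne_iff.1 ha
  have : v i ∣ mon v a := by
    refine (dvd_pow_self (v i) hi).trans ?_
    exact Finset.dvd_prod_of_mem (fun i => v i ^ a i) (Finset.mem_univ i)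
  exact Ideal.mem_of_dvd _ this (Ideal.subset_span ⟨i, rfl⟩)

lemma TF_sub_Ju (hw : Ideal.span (Set.range w) = maximalIdeal S) (hf : f.Monic)
    (hd : f.natDegree = m) (hc : ∀ i < m, f.coeff i ∈ maximalIdeal S) (hφ : φ ∈ maximalIdeal S) :
    TF θ f m φ z - z ^ m ∈ Ideal.span (Set.range fun i => θ (w i)) := by
  unfold TF
  rw [Finset.sum_range_succ, taylor_monic_coeff hf hd, map_one, one_mul, add_sub_cancel_right]
  refine Ideal.sum_mem _ fun b hb => Ideal.mul_mem_right _ _ ?_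
  rw [← span_map]
  refine Ideal.mem_map_of_mem _ ?_
  rw [hw]
  exact taylor_coeff_mem hf hd hc hφ b (Finset.mem_range.1 hb)

lemma eps_unit (hB : MonSys (zw z v)) (hy : y ∈ maximalIdeal B) {F ε K : B}
    (hF : F - z ^ m ∈ Ideal.span (Set.range v)) (hFe : F = ε * y ^ m + K)
    (hm : 0 < m) (hK : K ∈ Ideal.span (Set.range v)) : IsUnit ε := by
  by_contra hε
  rw [← hB.hw, span_zw, Ideal.mem_span_insert] at hy
  obtain ⟨α, j, hj, rfl⟩ := hy
  have h1 : (α * z + j) ^ m - (α * z) ^ m ∈ Ideal.span (Set.range v) := by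
    refine Ideal.mem_of_dvd _ (sub_dvd_pow_sub_pow _ _ m) ?_
    simpa using hj
  have h2 : (1 - ε * α ^ m) * z ^ m ∈ Ideal.span (Set.range v) := by
    have e : (1 - ε * α ^ m) * z ^ m = ε * ((α * z + j) ^ m - (α * z) ^ m) + K - (F - z ^ m) := by
      rw [hFe, mul_pow]; ring
    rw [e]
    exact Ideal.sub_mem _ (Ideal.add_mem _ (Ideal.mul_mem_left _ _ h1) hK) hF
  have hu : IsUnit (1 - ε * α ^ m) := by
    by_contra hn
    have h3 : ε * α ^ m ∈ maximalIdeal B :=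
      Ideal.mul_mem_right _ _ ((mem_maximalIdeal ε).2 hε)
    have h4 := Ideal.add_mem _ ((mem_maximalIdeal _).2 hn) h3
    rw [sub_add_cancel] at h4
    exact (Ideal.ne_top_iff_one _).1 (maximalIdeal.isMaximal B).ne_top h4
  exact pow_notin_Ju hB.mp m ((Ideal.unit_mul_mem_iff_mem _ hu).1 h2)

lemma ow_gen {L : ι → ℝ} (hL : ∀ i, 0 < L i) {l : ℝ} (hl : 0 < l) {e : Option ι → ℕ}
    (he : wt (ow L l) e < l) : e none = 0 := by
  rw [wt_ow] at he
  have := wt_nonneg (fun i => (hL i).le) (fun i => e (some i))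
  by_contra h
  have : (1:ℝ) ≤ (e none) := by exact_mod_cast Nat.one_le_iff_ne_zero.2 h
  nlinarith

lemma wt_pos {L : ι → ℝ} (hL : ∀ i, 0 < L i) {a : ι → ℕ} (ha : a ≠ 0) : 0 < wt L a := by
  obtain ⟨i, hi⟩ := Function.ne_iff.1 ha
  refine Finset.sum_pos' (fun i _ => mul_nonneg (hL i).le (Nat.cast_nonneg _)) ⟨i, Finset.mem_univ i, ?_⟩
  exact mul_pos (hL i) (by exact_mod_cast Nat.pos_of_ne_zero hi)

lemma GT_le_max (hw : Ideal.span (Set.range w) = maximalIdeal S) {L : ι → ℝ} {l : ℝ}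
    (hl : 0 ≤ l) : mI w (GT L l) ≤ maximalIdeal S := by
  refine mI_le fun e he => ?_
  rw [← hw]
  refine mon_mem_Ju ?_
  rintro rfl
  have he' : l < wt L 0 := he
  rw [wt_zero] at he'
  linarith

/-- Claim A -/
lemma claimA (hB : MonSys (zw z v)) (hm : 0 < m) (hy : y ∈ maximalIdeal B) {F ε K : B}
    (hε : IsUnit ε) (hFe : F = ε * y ^ m + K) {L : ι → ℝ} {l l' : ℝ} (hL : ∀ i, 0 < L i)
    (hl : 0 < l) (hll' : l < l') (hgen : ∀ e e' : ι → ℕ, wt L e = wt L e' → e = e')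
    (hF : F ∈ mI (zw z v) (GE (ow L l) (m * l)))
    (hK : K ∈ mI (zw y v) {e | e none < m ∧ e ∈ GE (ow L l') (m * l')}) :
    y ∈ mI (zw z v) (GE (ow L l) l) := by
  have hL0 : ∀ o, 0 ≤ ow L l o := ow_nonneg (fun i => (hL i).le) hl.le
  refine hB.mem_of_ES (GE_upper hL0 l) fun p hp => ?_
  by_contra hpl
  simp only [GE, Set.mem_ofPred_eq, not_le] at hpl
  obtain ⟨e, c, hc, he, hh⟩ := hB.initial' hp hpl hL0 (by
    intro e e' he hee
    have h1 := ow_gen hL hl he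
    have h2 := ow_gen hL hl (hee ▸ he)
    rw [wt_ow, wt_ow, h1, h2] at hee
    have h3 := hgen _ _ (by simpa using hee)
    rw [← oe_eta e, ← oe_eta e', h1, h2, h3])
  set μ := wt (ow L l) e with hμ
  have hmon : c * mon (zw z v) e ∈ mI (zw z v) (GE (ow L l) μ) :=
    Ideal.mul_mem_left _ _ (mon_mem (le_refl (wt (ow L l) e)))
  have hyμ : y ∈ mI (zw z v) (GE (ow L l) μ) := by
    have := Ideal.add_mem _ (GT_le_GE _ hh) hmon
    simpa using this
  have h1 := pow_congr hmon hh m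
  have h2 := K_mem (m := m) hyμ (he.trans hll') hK
  have hm' : (0:ℝ) < m := by exact_mod_cast hm
  have h3 : F ∈ mI (zw z v) (GT (ow L l) (m * μ)) := GE_le_GT (by nlinarith) hF
  have h4 : (ε * c ^ m) * mon (zw z v) (m • e) ∈ mI (zw z v) (GT (ow L l) (m * μ)) := by
    have e1 : (ε * c ^ m) * mon (zw z v) (m • e)
        = F - K - ε * (y ^ m - (c * mon (zw z v) e) ^ m) := by
      rw [hFe, mon_nsmul]; ring
    rw [e1]
    exact Ideal.sub_mem _ (Ideal.sub_mem _ h3 h2) (Ideal.mul_mem_left _ _ h1)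
  refine hB.not_mem_of_not (GT_upper hL0 _) (hε.mul (hc.pow m)) ?_ h4
  intro h5
  have h6 : (m:ℝ) * μ < wt (ow L l) (m • e) := h5
  rw [wt_nsmul] at h6
  exact lt_irrefl _ h6

/-- the shape of the initial form of `y` -/
lemma y_shape (hB : MonSys (zw z fun i => θ (w i))) (hres : ∀ b : B, ∃ s, b - θ s ∈ maximalIdeal B)
    {L : ι → ℝ} {l : ℝ} (hL : ∀ i, 0 < L i)
    (hl : 0 < l) (hgen : ∀ e e' : ι → ℕ, wt L e = wt L e' → e = e')
    (hy : y ∈ mI (zw z fun i => θ (w i)) (GE (ow L l) l)) :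
    ∃ (α β : S) (a : ι → ℕ), (β = 0 ∨ wt L a = l) ∧
      y - (θ α * z + θ (β * mon w a)) ∈ mI (zw z fun i => θ (w i)) (GT (ow L l) l) := by
  classical
  set v : ι → B := fun i => θ (w i) with hv
  -- lifting coefficients
  have hmax : maximalIdeal B ≤ mI (zw z v) (GT (ow L l) 0) := by
    rw [← hB.hw, Ideal.span_le]
    rintro _ ⟨o, rfl⟩
    rw [SetLike.mem_coe, ← mon_single (zw z v) o]
    refine mon_mem ?_
    change 0 < wt (ow L l) (Pi.single o 1)
    refine wt_pos ?_ ?_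
    · intro o; cases o
      · exact hl
      · exact hL _
    · intro h; simpa using congrFun h o
  have lift : ∀ (b : B) (x : B), x ∈ mI (zw z v) (GE (ow L l) l) →
      ∃ s, b * x - θ s * x ∈ mI (zw z v) (GT (ow L l) l) := by
    intro b x hx
    obtain ⟨s, hs⟩ := hres b
    refine ⟨s, ?_⟩
    have := GT_mul (hmax hs) hx
    rw [zero_add] at this
    rwa [← sub_mul]
  have hz : z ∈ mI (zw z v) (GE (ow L l) l) := by
    have e : z = mon (zw z v) (oe (0 : ι → ℕ) 1) := by rw [mon_zw_oe, mon_zero]; simp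
    have h1 : mon (zw z v) (oe (0 : ι → ℕ) 1) ∈ mI (zw z v) (GE (ow L l) l) := by
      refine mon_mem ?_
      change l ≤ wt (ow L l) (oe (0 : ι → ℕ) 1)
      rw [wt_ow_oe, wt_zero]; simp
    rwa [← e] at h1
  -- splitting
  have hcase : ∀ e : Option ι → ℕ, l ≤ wt (ow L l) e → l < wt (ow L l) e ∨ e = oe (0 : ι → ℕ) 1 ∨
      (e none = 0 ∧ wt L (fun i => e (some i)) = l) := by
    intro e he
    rcases he.lt_or_eq with h | h
    · exact Or.inl h
    · right
      rw [wt_ow] at h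
      have h0 := wt_nonneg (fun i => (hL i).le) (fun i => e (some i))
      rcases Nat.lt_or_ge (e none) 1 with h1 | h1
      · right
        have : e none = 0 := by omega
        refine ⟨this, ?_⟩
        rw [h, this]; simp
      · left
        have h2 : (1:ℝ) ≤ (e none) := by exact_mod_cast h1
        have h3 : wt L (fun i => e (some i)) = 0 := by nlinarith
        have h4 : (fun i => e (some i)) = 0 := by
          by_contra hne
          exact (wt_pos hL hne).ne' h3
        have h5 : ((e none : ℕ) : ℝ) = 1 := by
          rw [h3, add_zero] at h
          field_simp at h
          exact h.symm
        rw [← oe_eta e, h4]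
        have : e none = 1 := by exact_mod_cast h5
        rw [this]
  have hsup : mI (zw z v) (GE (ow L l) l) ≤ (Ideal.span {z} ⊔ mI v {a | wt L a = l}) ⊔
      mI (zw z v) (GT (ow L l) l) := by
    refine mI_le fun e he => ?_
    rcases hcase e he with h | rfl | ⟨h, h'⟩
    · exact Ideal.mem_sup_right (mon_mem h)
    · refine Ideal.mem_sup_left (Ideal.mem_sup_left ?_)
      rw [mon_zw_oe, mon_zero, mul_one, pow_one]
      exact Ideal.mem_span_singleton_self z
    · refine Ideal.mem_sup_left (Ideal.mem_sup_right ?_)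
      rw [mon_zw, h, pow_zero, one_mul]
      exact mon_mem h'
  obtain ⟨x, hx, k, hk, hxk⟩ := Submodule.mem_sup.1 (hsup hy)
  obtain ⟨x1, hx1, x2, hx2, hx12⟩ := Submodule.mem_sup.1 hx
  obtain ⟨α', rfl⟩ := Ideal.mem_span_singleton'.1 hx1
  obtain ⟨α, hα⟩ := lift α' z hz
  have hx2' : ∃ (β : S) (a : ι → ℕ), (β = 0 ∨ wt L a = l) ∧
      x2 - θ (β * mon w a) ∈ mI (zw z v) (GT (ow L l) l) := by
    by_cases hex : ∃ a, wt L a = l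
    · obtain ⟨a, ha⟩ := hex
      have hset : {a' : ι → ℕ | wt L a' = l} = {a} := by
        ext a'
        simp only [Set.mem_ofPred_eq, Set.mem_singleton_iff]
        exact ⟨fun h => hgen _ _ (h.trans ha.symm), fun h => h ▸ ha⟩
      rw [hset] at hx2
      unfold mI at hx2
      rw [Set.image_singleton, Ideal.mem_span_singleton'] at hx2
      obtain ⟨β', rfl⟩ := hx2
      have hmv : mon v a ∈ mI (zw z v) (GE (ow L l) l) := by
        have := mon_v_mem (z := z) (v := v) L l a
        rwa [ha] at this
      obtain ⟨β, hβ⟩ := lift β' _ hmv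
      refine ⟨β, a, Or.inr ha, ?_⟩
      rw [map_mul, map_mon]; exact hβ
    · have hset : {a' : ι → ℕ | wt L a' = l} = ∅ := by
        ext a'
        simp only [Set.mem_ofPred_eq, Set.mem_empty_iff_false, iff_false]
        exact fun h => hex ⟨a', h⟩
      rw [hset] at hx2
      have hx20 : x2 = 0 := by simpa [mI] using hx2
      exact ⟨0, 0, Or.inl rfl, by simp [hx20]⟩
  obtain ⟨β, a, ha, hβ⟩ := hx2'
  refine ⟨α, β, a, ha, ?_⟩
  have e1 : y - (θ α * z + θ (β * mon w a)) = (α' * z - θ α * z) + (x2 - θ (β * mon w a)) + k := by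
    rw [← hxk, ← hx12]; ring
  rw [e1]
  exact Ideal.add_mem _ (Ideal.add_mem _ hα hβ) hk

end Cmp

set_option linter.unusedSectionVars false

section Main2

variable {ι : Type} [Fintype ι] {S B : Type u} [CommRing S] [IsLocalRing S] [CommRing B]
  [IsLocalRing B] {θ : S →+* B} {w : ι → S} {z y : B}
  {f : Polynomial S} {m : ℕ} {φ : S}

lemma binom_id (γ : S) {b : ℕ} (hb : b < m) :
    ∑ j ∈ Finset.range m, (j.choose b : S) * ((m.choose j : S) * γ ^ (m - j)) * (-γ) ^ (j - b)
      + (m.choose b : S) * (-γ) ^ (m - b) = 0 := by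
  have h := taylor_sum ((Polynomial.X + Polynomial.C γ) ^ m) m
    (Polynomial.natDegree_pow_le.trans (by simp)) (-γ) b
  have h1 : Polynomial.taylor (-γ) ((Polynomial.X + Polynomial.C γ) ^ m) = Polynomial.X ^ m := by
    rw [Polynomial.taylor_pow, map_add, Polynomial.taylor_X, Polynomial.taylor_C, map_neg]
    ring
  rw [h1, Polynomial.coeff_X_pow, if_neg hb.ne, Finset.sum_range_succ] at h
  rw [h]
  congr 1
  · refine Finset.sum_congr rfl fun j _ => ?_
    rw [Polynomial.coeff_X_add_C_pow]; ring
  · rw [Polynomial.coeff_X_add_C_pow]; simp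

lemma shift_GT (hf : f.Monic) (hd : f.natDegree = m) {L : ι → ℝ} {l : ℝ} {γ : S}
    (hγ : γ ∈ mI w (GE L l))
    (h : ∀ b < m, (Polynomial.taylor φ f).coeff b - (m.choose b : S) * γ ^ (m - b) ∈
      mI w (GT L (((m:ℝ) - b) * l))) (b : ℕ) (hb : b < m) :
    (Polynomial.taylor (φ + -γ) f).coeff b ∈ mI w (GT L (((m:ℝ) - b) * l)) := by
  have e := binom_id γ hb
  rw [taylor_shift hf hd, ← sub_zero (_ + _), ← e]
  rw [add_sub_add_right_eq_sub, ← Finset.sum_sub_distrib]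
  refine Ideal.sum_mem _ fun j hj => ?_
  rcases lt_or_ge j b with hjb | hjb
  · rw [Nat.choose_eq_zero_of_lt hjb]; simp
  · have h1 := h j (Finset.mem_range.1 hj)
    have h2 := GT_mul h1 (GE_pow (neg_mem hγ) (j - b))
    have e2 : (j.choose b : S) * (Polynomial.taylor φ f).coeff j * (-γ) ^ (j - b) -
        (j.choose b : S) * ((m.choose j : S) * γ ^ (m - j)) * (-γ) ^ (j - b)
        = (j.choose b : S) * (((Polynomial.taylor φ f).coeff j - (m.choose j : S) * γ ^ (m - j)) *
          (-γ) ^ (j - b)) := by ring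
    rw [e2]
    refine Ideal.mul_mem_left _ _ ?_
    convert h2 using 3
    rw [Nat.cast_sub hjb]; ring

lemma strict_Gp (hS : MonSys w) {L : ι → ℝ} (hL : ∀ i, 0 ≤ L i) {l : ℝ}
    (h : ∀ b < m, (Polynomial.taylor φ f).coeff b ∈ mI w (GT L (((m:ℝ) - b) * l))) :
    ∃ l' > l, Gp w f m φ L l' := by
  obtain ⟨F, hF, hFP, hdom⟩ := PT_finite w f m φ
  have hlt : ∀ x ∈ F, l < ∑ i, L i * x i := by
    intro x hx
    obtain ⟨b, hb, a, ha, rfl⟩ := hFP hx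
    have hb' : (0:ℝ) < (m:ℝ) - b := by
      have : (b:ℝ) < m := by exact_mod_cast hb
      linarith
    have h1 : ((m:ℝ) - b) * l < wt L a := ES_sub_of_mem (GT_upper hL _) (h b hb) ha
    rw [pair_div, lt_div_iff₀ hb']
    linarith
  have : ∃ l' > l, ∀ x ∈ F, l' ≤ ∑ i, L i * x i := by
    rcases F.eq_empty_or_nonempty with rfl | hne
    · exact ⟨l + 1, by linarith, by simp⟩
    · obtain ⟨x0, hx0, hmin⟩ := hF.exists_minimalFor (fun x => ∑ i, L i * x i) F hne
      refine ⟨_, hlt x0 hx0, fun x hx => ?_⟩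
      rcases le_total (∑ i, L i * x0 i) (∑ i, L i * x i) with h | h
      · exact h
      · exact hmin hx h
  obtain ⟨l', hl', hl2⟩ := this
  refine ⟨l', hl', (Gp_iff_PT hS hL).2 fun x hx => ?_⟩
  obtain ⟨y, hy, hyx⟩ := hdom x hx
  exact (hl2 y hy).trans (pair_mono hL hyx)

lemma contra (hS : MonSys w) (hB : MonSys (zw z fun i => θ (w i)))
    (hres : ∀ b : B, ∃ s, b - θ s ∈ maximalIdeal B) (hm : 0 < m) (hf : f.Monic)
    (hd : f.natDegree = m) (hc : ∀ i < m, f.coeff i ∈ maximalIdeal S) (hφ : φ ∈ maximalIdeal S)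
    (hmin : ∀ φ' ∈ maximalIdeal S, Le w f m φ' φ → Le w f m φ φ') (hy : y ∈ maximalIdeal B)
    {L : ι → ℝ} {l' : ℝ} (hL : ∀ i, 0 ≤ L i) (hl' : 0 < l')
    (hF : TF θ f m φ z ∈ mI (zw y fun i => θ (w i)) (GE (ow L l') (m * l'))) :
    Gp w f m φ L l' := by
  classical
  rw [Gp_iff_PT hS hL]
  by_contra hcon
  push Not at hcon
  obtain ⟨p, hp, hpl⟩ := hcon
  obtain ⟨L', hLL', hL'0, -, hgen', hpl'⟩ := generic L Finset.univ hL (by simp) p l' hpl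
  have hLp : ∀ i, 0 < L' i := fun i => hL'0 i (Finset.mem_univ i)
  have hL0 : ∀ i, 0 ≤ L' i := fun i => (hLp i).le
  have hgen : ∀ e e' : ι → ℕ, wt L' e = wt L' e' → e = e' :=
    fun e e' h => funext fun i => hgen' e e' h i (Finset.mem_univ i)
  have hF' : TF θ f m φ z ∈ mI (zw y fun i => θ (w i)) (GE (ow L' l') (m * l')) := by
    refine mI_mono (fun e he => ?_) hF
    refine le_trans he (wt_mono_left ?_ e)
    intro o; cases o
    · exact le_rfl
    · exact hLL' _
  -- the minimum of `L'` on `PT`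
  obtain ⟨G, hG, hGP, hdom⟩ := PT_finite w f m φ
  obtain ⟨q, hq, hqp⟩ := hdom p hp
  obtain ⟨p0, hp0, hmin0⟩ := hG.exists_minimalFor (fun x => ∑ i, L' i * x i) G ⟨q, hq⟩
  set l := ∑ i, L' i * p0 i with hl
  have hmin1 : ∀ x ∈ PT w f m φ, l ≤ ∑ i, L' i * x i := by
    intro x hx
    obtain ⟨y, hy, hyx⟩ := hdom x hx
    refine le_trans ?_ (pair_mono hL0 hyx)
    rcases le_total l (∑ i, L' i * y i) with h | h
    · exact h
    · exact hmin0 hy h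
  have hGp : Gp w f m φ L' l := (Gp_iff_PT hS hL0).2 hmin1
  have hll' : l < l' := lt_of_le_of_lt (hmin1 p hp) hpl'
  obtain ⟨b0, hb0, a0, ha0, hp0e⟩ := hGP hp0
  have hi0 : (0:ℝ) < (m:ℝ) - b0 := by
    have : (b0:ℝ) < m := by exact_mod_cast hb0
    linarith
  have hwa0 : wt L' a0 = ((m:ℝ) - b0) * l := by
    rw [hl, hp0e, pair_div]; field_simp
  have hlpos : 0 < l := by
    have ha0' : a0 ≠ 0 := by
      rintro rfl
      apply ha0
      have h1 := taylor_coeff_mem hf hd hc hφ b0 hb0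
      have h2 := pow_le_bx hS.hw (k := 1) (e := (0 : ι → ℕ)) (by simp [dg])
      rw [pow_one] at h2
      exact h2 h1
    have := wt_pos hLp ha0'
    rw [hwa0] at this
    exact (mul_pos_iff_of_pos_left hi0).1 this
  -- in `B`
  have hFz : TF θ f m φ z ∈ mI (zw z fun i => θ (w i)) (GE (ow L' l) (m * l)) := TF_of_Gp hL0 hGp
  obtain ⟨ε, K, hFe, hK⟩ := exists_K hF'
  have hKJ : K ∈ Ideal.span (Set.range fun i => θ (w i)) := by
    refine (mI_le ?_ : mI (zw y fun i => θ (w i)) _ ≤ _) hK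
    rintro e ⟨he1, he2⟩
    rw [mon_zw]
    refine Ideal.mul_mem_left _ _ (mon_mem_Ju ?_)
    intro h0
    have he3 : (m:ℝ) * l' ≤ wt (ow L' l') e := he2
    rw [wt_ow, h0, wt_zero] at he3
    have : ((e none : ℕ):ℝ) < m := by exact_mod_cast he1
    nlinarith
  have hε : IsUnit ε := eps_unit hB hy (TF_sub_Ju hS.hw hf hd hc hφ) hFe hm hKJ
  have hyl := claimA hB hm hy hε hFe hLp hlpos hll' hgen hFz hK
  obtain ⟨α, β, v, hβv, hsh⟩ := y_shape hB hres hLp hlpos hgen hyl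
  set x' := θ α * z + θ (β * mon w v) with hx'
  have hx'mem : x' ∈ mI (zw z fun i => θ (w i)) (GE (ow L' l) l) := by
    have := Ideal.sub_mem _ hyl (GT_le_GE _ hsh)
    simpa using this
  have hpow := pow_congr hx'mem hsh m
  have hKm := K_mem (m := m) hyl hll' hK
  obtain ⟨ε0, hε0⟩ := hres ε
  have hε0' : (ε - θ ε0) * x' ^ m ∈ mI (zw z fun i => θ (w i)) (GT (ow L' l) (m * l)) := by
    have hmax : maximalIdeal B ≤ mI (zw z fun i => θ (w i)) (GT (ow L' l) 0) := by
      rw [← hB.hw, Ideal.span_le]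
      rintro _ ⟨o, rfl⟩
      rw [SetLike.mem_coe, ← mon_single (zw z fun i => θ (w i)) o]
      refine mon_mem ?_
      change 0 < wt (ow L' l) (Pi.single o 1)
      refine wt_pos ?_ ?_
      · intro o; cases o
        · exact hlpos
        · exact hLp _
      · intro h; simpa using congrFun h o
    have := GT_mul (hmax hε0) (GE_pow hx'mem m)
    rwa [zero_add] at this
  have hdiff : TF θ f m φ z - θ ε0 * x' ^ m ∈
      mI (zw z fun i => θ (w i)) (GT (ow L' l) (m * l)) := by
    have e1 : TF θ f m φ z - θ ε0 * x' ^ m = ε * (y ^ m - x' ^ m) + (ε - θ ε0) * x' ^ m + K := by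
      rw [hFe]; ring
    rw [e1]
    exact Ideal.add_mem _ (Ideal.add_mem _ (Ideal.mul_mem_left _ _ hpow) hε0') hKm
  set h0 := β * mon w v with hh0
  have hsum : TF θ f m φ z - θ ε0 * x' ^ m = ∑ b ∈ Finset.range (m + 1),
      θ ((Polynomial.taylor φ f).coeff b - ε0 * (α ^ b * h0 ^ (m - b) * (m.choose b : S))) * z ^ b := by
    rw [hx', add_pow, Finset.mul_sum, TF, ← Finset.sum_sub_distrib]
    refine Finset.sum_congr rfl fun b _ => ?_
    simp only [map_sub, map_mul, map_pow, map_natCast]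
    ring
  rw [hsum] at hdiff
  have hQ := lemmaQ hS hB.mp (GT_upper (ow_nonneg hL0 hlpos.le) _) (m + 1) _ hdiff
  simp only [slice_GT] at hQ
  have hQm := hQ m (by omega)
  rw [taylor_monic_coeff hf hd, Nat.choose_self, Nat.sub_self, pow_zero, mul_one, Nat.cast_one,
    mul_one, show (m:ℝ) * l - l * m = 0 by ring] at hQm
  have hα : IsUnit α := by
    by_contra hα
    have h1 := GT_le_max hS.hw le_rfl hQm
    have h2 : ε0 * α ^ m ∈ maximalIdeal S :=
      Ideal.mul_mem_left _ _ (Ideal.pow_mem_of_mem _ ((mem_maximalIdeal α).2 hα) m hm)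
    have h3 := Ideal.add_mem _ h1 h2
    rw [sub_add_cancel] at h3
    exact (Ideal.ne_top_iff_one _).1 (maximalIdeal.isMaximal S).ne_top h3
  obtain ⟨αu, rfl⟩ := hα
  have hh0mem : h0 ∈ mI w (GE L' l) := by
    rcases hβv with h | h
    · rw [hh0, h, zero_mul]; exact zero_mem _
    · exact Ideal.mul_mem_left _ _ (mon_mem h.ge)
  set γ := (↑αu⁻¹ : S) * h0 with hγ
  have hγmem : γ ∈ mI w (GE L' l) := Ideal.mul_mem_left _ _ hh0mem
  have hh0γ : h0 = αu * γ := by rw [hγ, ← mul_assoc, Units.mul_inv, one_mul]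
  have hgb : ∀ b < m, (Polynomial.taylor φ f).coeff b - (m.choose b : S) * γ ^ (m - b) ∈
      mI w (GT L' (((m:ℝ) - b) * l)) := by
    intro b hb
    have h1 := hQ b (by omega)
    have h2 := GT_mul hQm (GE_pow hγmem (m - b))
    have e1 : (Polynomial.taylor φ f).coeff b - (m.choose b : S) * γ ^ (m - b)
        = ((Polynomial.taylor φ f).coeff b - ε0 * ((αu:S) ^ b * h0 ^ (m - b) * (m.choose b : S)))
          - (m.choose b : S) * ((1 - ε0 * (αu:S) ^ m) * γ ^ (m - b)) := by
      have e2 : (αu : S) ^ m = (αu:S) ^ b * (αu:S) ^ (m - b) := by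
        rw [← pow_add]; congr 1; omega
      rw [hh0γ, mul_pow, e2]; ring
    rw [e1]
    refine Ideal.sub_mem _ ?_ (Ideal.mul_mem_left _ _ ?_)
    · convert h1 using 3; ring
    · convert h2 using 3
      rw [Nat.cast_sub hb.le]; ring
  -- the exponent `a0`
  have hv : β ≠ 0 ∧ a0 = (m - b0) • v := by
    have hnot : a0 ∉ GT L' (((m:ℝ) - b0) * l) := by
      intro h
      have h' : ((m:ℝ) - b0) * l < wt L' a0 := h
      rw [hwa0] at h'
      exact lt_irrefl _ h'
    have hm1 : (Polynomial.taylor φ f).coeff b0 ∈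
        Ideal.span {γ ^ (m - b0)} ⊔ mI w (GT L' (((m:ℝ) - b0) * l)) := by
      have := Ideal.add_mem _ (Ideal.mem_sup_right (S := Ideal.span {γ ^ (m - b0)}) (hgb b0 hb0))
        (Ideal.mem_sup_left (T := mI w (GT L' (((m:ℝ) - b0) * l)))
          (Ideal.mul_mem_left _ ((m.choose b0 : S)) (Ideal.mem_span_singleton_self (γ ^ (m - b0)))))
      rwa [sub_add_cancel] at this
    have hβ : β ≠ 0 := by
      intro h
      have : γ ^ (m - b0) = 0 := by
        rw [hγ, hh0, h, zero_mul, mul_zero, zero_pow (by omega)]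
      rw [this, Ideal.span_singleton_eq_bot.2 rfl, bot_sup_eq] at hm1
      exact hnot (ES_sub_of_mem (GT_upper hL0 _) hm1 ha0)
    refine ⟨hβ, ?_⟩
    have hwv := hβv.resolve_left hβ
    have hup : IsUpperSet ({e : ι → ℕ | (m - b0) • v ≤ e} ∪ GT L' (((m:ℝ) - b0) * l)) :=
      IsUpperSet.union (fun _ _ h h' => le_trans h' h) (GT_upper hL0 _)
    have hm2 : (Polynomial.taylor φ f).coeff b0 ∈
        mI w ({e : ι → ℕ | (m - b0) • v ≤ e} ∪ GT L' (((m:ℝ) - b0) * l)) := by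
      rw [mI_union]
      have hle2 : Ideal.span {γ ^ (m - b0)} ≤ mI w {e : ι → ℕ | (m - b0) • v ≤ e} := by
        rw [Ideal.span_singleton_le_iff_mem, hγ, hh0, ← mul_assoc, mul_pow, ← mon_nsmul]
        exact Ideal.mul_mem_left _ _ (mon_mem (le_refl ((m - b0) • v)))
      have hle3 := sup_le_sup_right hle2 (mI w (GT L' (((m:ℝ) - b0) * l)))
      exact hle3 hm1
    rcases ES_sub_of_mem hup hm2 ha0 with h | h
    · refine hgen _ _ ?_
      rw [hwa0, wt_nsmul, hwv, Nat.cast_sub hb0.le]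
    · exact absurd h hnot
  have hvJ : v ∈ JJ w f m φ := by
    intro L1 l1 hL1 hG1
    have h1 := (Gp_iff_PT hS hL1).1 hG1 p0 (hGP hp0)
    rw [hp0e, pair_div, le_div_iff₀ hi0, hv.2, wt_nsmul, Nat.cast_sub hb0.le] at h1
    rw [mul_comm] at h1
    exact le_of_mul_le_mul_left h1 hi0
  have hγJ : γ ∈ mI w (JJ w f m φ) :=
    Ideal.mul_mem_left _ _ (Ideal.mul_mem_left _ _ (mon_mem hvJ))
  have hle : Le w f m (φ + -γ) φ := Le_of_JJ hf hd (by simpa using hγJ)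
  have hφ' : φ + -γ ∈ maximalIdeal S :=
    Ideal.add_mem _ hφ (neg_mem (JJ_le_max hS.hw hm hf hd hc hφ hγJ))
  obtain ⟨l2, hl2, hG2⟩ := strict_Gp hS hL0 (shift_GT hf hd hγmem hgb)
  have hG3 := hmin _ hφ' hle L' l2 hL0 hG2
  have := (Gp_iff_PT hS hL0).1 hG3 p0 (hGP hp0)
  rw [← hl] at this
  linarith

end Main2

section Main3

variable {d : ℕ} {S B : Type u} [CommRing S] [IsLocalRing S] [CommRing B]
  [IsLocalRing B] {θ : S →+* B} {w : Fin d → S} {z y : B}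
  {f : Polynomial S} {m : ℕ} {φ : S}

lemma H_sub (hS : MonSys w) (hB : MonSys (zw z fun i => θ (w i)))
    (hY : MonSys (zw y fun i => θ (w i)))
    (hres : ∀ b : B, ∃ s, b - θ s ∈ maximalIdeal B) (hm : 0 < m) (hf : f.Monic)
    (hd : f.natDegree = m) (hc : ∀ i < m, f.coeff i ∈ maximalIdeal S) (hφ : φ ∈ maximalIdeal S)
    (hmin : ∀ φ' ∈ maximalIdeal S, Le w f m φ' φ → Le w f m φ φ') :
    smallestFSubset (PT w f m φ) ⊆ DeltaOf (TF θ f m φ z) y (fun i => θ (w i)) m := by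
  intro x hx
  by_contra hx'
  obtain ⟨L, l, hL, hl, hxl, hF⟩ := delta_sep hY ((smallest_F _ PT_orth).1 hx) hx'
  have hy : y ∈ maximalIdeal B := by
    rw [← hY.hw]; exact Ideal.subset_span ⟨none, rfl⟩
  have := contra hS hB hres hm hf hd hc hφ hmin hy hL hl hF
  have := smallest_half PT_orth hL ((Gp_iff_PT hS hL).1 this) hx
  linarith

lemma ordRes_eq (hS : MonSys w) (hB : MonSys (zw z fun i => θ (w i))) (hf : f.Monic)
    (hd : f.natDegree = m) (hc : ∀ i < m, f.coeff i ∈ maximalIdeal S) (hφ : φ ∈ maximalIdeal S) :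
    ordRes (TF θ f m φ z) (fun i => θ (w i)) = m := by
  have h1 := TF_sub_Ju (θ := θ) (z := z) hS.hw hf hd hc hφ
  have hz : z ∈ maximalIdeal B := by
    rw [← hB.hw]; exact Ideal.subset_span ⟨none, rfl⟩
  have hmem : m ∈ {n : ℕ | TF θ f m φ z ∈
      (maximalIdeal B) ^ n ⊔ Ideal.span (Set.range fun i => θ (w i))} := by
    have := Ideal.add_mem _ (Ideal.mem_sup_right (S := maximalIdeal B ^ m) h1)
      (Ideal.mem_sup_left (Ideal.pow_mem_pow hz m))
    simpa using this
  have hub : ∀ n ∈ {n : ℕ | TF θ f m φ z ∈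
      (maximalIdeal B) ^ n ⊔ Ideal.span (Set.range fun i => θ (w i))}, n ≤ m := by
    intro n hn
    by_contra hnm
    push Not at hnm
    have h2 : z ^ m ∈ (maximalIdeal B) ^ n ⊔ Ideal.span (Set.range fun i => θ (w i)) := by
      have := Ideal.sub_mem _ hn (Ideal.mem_sup_right (S := maximalIdeal B ^ n) h1)
      simpa using this
    apply hB.mp (oe 0 m)
    rw [mon_zw_oe, mon_zero, mul_one]
    have h3 : maximalIdeal B ^ n ≤ mI (zw z fun i => θ (w i)) (bx (oe 0 m)) :=
      pow_le_bx hB.hw (by simpa [dg, oe, Fintype.sum_option] using hnm)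
    have h4 := sup_le h3 (Ju_le_bx m)
    exact h4 h2
  exact le_antisymm (csSup_le ⟨m, hmem⟩ hub) (le_csSup ⟨m, hub⟩ hmem)

end Main3

set_option linter.unusedSectionVars false

section HatY

lemma compl_approx (A : Type u) [CommRing A] [IsLocalRing A] [IsNoetherianRing A] (k : ℕ)
    (b : Completion A) : ∃ a : A, cmpl a - b ∈ maximalIdeal (Completion A) ^ k := by
  rcases Submodule.Quotient.mk_surjective _ (b.1 k) with ⟨l, hl⟩
  refine ⟨l, ?_⟩
  rw [compl_max, ← Ideal.map_pow]
  change (AdicCompletion.of (maximalIdeal A) A l) - b ∈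
    ((maximalIdeal A) ^ k).map (algebraMap A (AdicCompletion (maximalIdeal A) A))
  rw [← Submodule.restrictScalars_mem A, ← Ideal.smul_top_eq_map]
  simpa [AdicCompletion.pow_smul_top_eq_ker_eval (maximalIdeal A).fg_of_isNoetherianRing,
    AdicCompletion.eval, sub_eq_zero] using hl

lemma MonSys_hat {A : Type u} [CommRing A] [IsLocalRing A] [IsNoetherianRing A] {d : ℕ}
    {v : Fin d → A} (hdim : ((d + 1 : ℕ) : WithBot ℕ∞) ≤ ringKrullDim A) {yh : Completion A}
    (hy : Ideal.span (insert yh (Set.range fun i => cmpl (v i)))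
      = (maximalIdeal A).map (cmpl (R := A))) :
    MonSys (zw yh fun i => cmpl (v i)) := by
  have hw : Ideal.span (Set.range (zw yh fun i => cmpl (v i))) = maximalIdeal (Completion A) := by
    rw [span_zw, hy, compl_max]
  refine monSys_of_complete hw ?_
  intro e he
  obtain ⟨y', hy'⟩ := compl_approx A (dg e + 2) yh
  have hM2 : maximalIdeal (Completion A) ^ (dg e + 2) ≤ maximalIdeal (Completion A) ^ 2 :=
    Ideal.pow_le_pow_right (by omega)
  have hyh : yh ∈ maximalIdeal (Completion A) := by
    rw [← hw]; exact Ideal.subset_span ⟨none, rfl⟩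
  have hvh : ∀ i, cmpl (v i) ∈ maximalIdeal (Completion A) := by
    intro i
    rw [← hw]; exact Ideal.subset_span ⟨some i, rfl⟩
  have hback : ∀ a : A, cmpl a ∈ maximalIdeal (Completion A) → a ∈ maximalIdeal A := by
    intro a ha
    rw [compl_max] at ha
    rw [← compl_contr A (maximalIdeal A)]
    exact ha
  have hyM : y' ∈ maximalIdeal A := by
    apply hback
    have h1 := Ideal.add_mem _ (Ideal.pow_le_self (by omega) hy') hyh
    rwa [sub_add_cancel] at h1
  have hsp : Ideal.span (Set.range (zw y' v)) = maximalIdeal A := by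
    apply le_antisymm
    · rw [Ideal.span_le]
      rintro _ ⟨(_ | i), rfl⟩
      · exact hyM
      · exact hback _ (hvh i)
    · refine Submodule.le_of_le_smul_of_le_jacobson_bot (I := maximalIdeal A)
        (IsNoetherian.noetherian _) (IsLocalRing.maximalIdeal_le_jacobson _) ?_
      have h1 : (maximalIdeal A).map (cmpl (R := A)) ≤
          (Ideal.span (Set.range (zw y' v)) ⊔ maximalIdeal A ^ 2).map cmpl := by
        rw [← hy, Ideal.span_le]
        rintro x (rfl | ⟨i, rfl⟩)
        · have h2 : x = cmpl y' - (cmpl y' - x) := by ring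
          rw [h2]
          refine Ideal.sub_mem _ ?_ ?_
          · exact Ideal.mem_map_of_mem _ (Ideal.mem_sup_left (Ideal.subset_span ⟨none, rfl⟩))
          · have h3 := hM2 hy'
            rw [compl_max, ← Ideal.map_pow] at h3
            exact Ideal.map_mono le_sup_right h3
        · exact Ideal.mem_map_of_mem _ (Ideal.mem_sup_left (Ideal.subset_span ⟨some i, rfl⟩))
      have h4 := Ideal.comap_mono (f := cmpl (R := A)) h1
      rw [compl_contr, compl_contr, pow_two] at h4
      exact h4
  have hMS : MonSys (zw y' v) := monSys_of_dim hsp (by simpa using hdim)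
  have hMSh := MonSys_compl hMS
  apply hMSh.mp e
  set ψ := Ideal.Quotient.mk (maximalIdeal (Completion A) ^ (dg e + 2)) with hψ
  have hww : (fun o => ψ (zw yh (fun i => cmpl (v i)) o)) = fun o => ψ (cmpl (zw y' v o)) := by
    funext o
    cases o with
    | none => exact ((Ideal.Quotient.mk_eq_mk_iff_sub_mem _ _).2 hy').symm
    | some i => rfl
  have h5 := Ideal.mem_map_of_mem ψ he
  rw [map_mon, map_mI, hww] at h5
  have h6 : ψ (mon (fun o => cmpl (zw y' v o)) e) ∈
      (mI (fun o => cmpl (zw y' v o)) (bx e)).map ψ := by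
    rw [map_mon, map_mI]; exact h5
  rw [← Ideal.mem_comap, Ideal.comap_map_of_surjective _ Ideal.Quotient.mk_surjective,
    ← RingHom.ker_eq_comap_bot, Ideal.mk_ker] at h6
  have h7 : maximalIdeal (Completion A) ^ (dg e + 2) ≤
      mI (fun o => cmpl (zw y' v o)) (bx e) := pow_le_bx hMSh.hw (by omega)
  have h8 := sup_le le_rfl h7
  exact h8 h6

end HatY

section Conc

variable {d : ℕ} {S : Type u} [CommRing S] [IsLocalRing S] {u : Fin d → S}

/-- The structure map of `S` into the localization. -/
abbrev thR (Q : Ideal (Polynomial S)) [Q.IsPrime] : S →+* Localization.AtPrime Q :=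
  (algebraMap (Polynomial S) (Localization.AtPrime Q)).comp Polynomial.C

lemma Q_iff (hu : Ideal.span (Set.range u) = maximalIdeal S) {Q : Ideal (Polynomial S)}
    (hQ : Q = Ideal.span (insert Polynomial.X (Set.range fun i => Polynomial.C (u i))))
    (p : Polynomial S) : p ∈ Q ↔ p.coeff 0 ∈ maximalIdeal S := by
  have hC : ∀ a ∈ maximalIdeal S, Polynomial.C a ∈ Q := by
    intro a ha
    rw [← hu] at ha
    have h1 := Ideal.mem_map_of_mem (Polynomial.C : S →+* Polynomial S) ha
    rw [span_map] at h1
    rw [hQ]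
    exact Ideal.span_mono (Set.subset_insert _ _) h1
  have hX : (Polynomial.X : Polynomial S) ∈ Q := by
    rw [hQ]; exact Ideal.subset_span (Set.mem_insert _ _)
  constructor
  · intro hp
    have hle : Q ≤ (maximalIdeal S).comap (Polynomial.constantCoeff : Polynomial S →+* S) := by
      rw [hQ, Ideal.span_le]
      rintro x (rfl | ⟨i, rfl⟩)
      · simp
      · have : u i ∈ maximalIdeal S := by rw [← hu]; exact Ideal.subset_span ⟨i, rfl⟩
        simpa using this
    exact hle hp
  · intro hp
    rw [← Polynomial.divX_mul_X_add p]
    exact Ideal.add_mem _ (Ideal.mul_mem_left _ _ hX) (hC _ hp)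

lemma conc_dim [IsNoetherianRing S] (hu : IsSysOfParams S u) {Q : Ideal (Polynomial S)}
    (hQ : Q = Ideal.span (insert Polynomial.X (Set.range fun i => Polynomial.C (u i))))
    [Q.IsPrime] : ((d + 1 : ℕ) : WithBot ℕ∞) ≤ ringKrullDim (Localization.AtPrime Q) := by
  have hmax : Q.IsMaximal := by
    have : Q = (maximalIdeal S).comap (Polynomial.constantCoeff : Polynomial S →+* S) := by
      ext p; rw [Q_iff hu.1 hQ, Ideal.mem_comap]; rfl
    rw [this]
    exact Ideal.comap_isMaximal_of_surjective _ Polynomial.constantCoeff_surjective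
  have hlo : Q.LiesOver (maximalIdeal S) := by
    constructor
    ext a
    rw [Ideal.mem_comap, Polynomial.algebraMap_apply, Q_iff hu.1 hQ]
    simp
  rw [IsLocalization.AtPrime.ringKrullDim_eq_height Q,
    Polynomial.height_eq_height_add_one (maximalIdeal S) Q]
  have h := hu.2
  rw [← IsLocalRing.maximalIdeal_height_eq_ringKrullDim] at h
  push_cast
  rw [h]

lemma conc_span (hu : Ideal.span (Set.range u) = maximalIdeal S) {Q : Ideal (Polynomial S)}
    (hQ : Q = Ideal.span (insert Polynomial.X (Set.range fun i => Polynomial.C (u i))))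
    [Q.IsPrime] {φ : S} (hφ : φ ∈ maximalIdeal S) :
    Ideal.span (Set.range (zw (algebraMap (Polynomial S) (Localization.AtPrime Q)
      (Polynomial.X - Polynomial.C φ)) fun i => thR Q (u i)))
      = maximalIdeal (Localization.AtPrime Q) := by
  have h1 : Ideal.span (Set.range (zw (Polynomial.X - Polynomial.C φ)
      fun i => (Polynomial.C (u i) : Polynomial S))) = Q := by
    apply le_antisymm
    · rw [Ideal.span_le]
      rintro _ ⟨(_ | i), rfl⟩
      · change Polynomial.X - Polynomial.C φ ∈ Q
        rw [Q_iff hu hQ]; simpa using hφ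
      · change Polynomial.C (u i) ∈ Q
        rw [hQ]; exact Ideal.subset_span (Set.mem_insert_of_mem _ ⟨i, rfl⟩)
    · rw [hQ, Ideal.span_le]
      have hC : Ideal.span (Set.range fun i => (Polynomial.C (u i) : Polynomial S)) ≤
          Ideal.span (Set.range (zw (Polynomial.X - Polynomial.C φ)
            fun i => (Polynomial.C (u i) : Polynomial S))) := by
        apply Ideal.span_mono
        rintro _ ⟨i, rfl⟩
        exact ⟨some i, rfl⟩
      rintro x (rfl | ⟨i, rfl⟩)
      · have h2 := Ideal.mem_map_of_mem (Polynomial.C : S →+* Polynomial S) hφ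
        rw [← hu, span_map] at h2
        have h4 : Polynomial.X - Polynomial.C φ ∈
            Ideal.span (Set.range (zw (Polynomial.X - Polynomial.C φ)
            fun i => (Polynomial.C (u i) : Polynomial S))) := Ideal.subset_span ⟨none, rfl⟩
        have h5 := Ideal.add_mem _ h4 (hC h2)
        rwa [sub_add_cancel] at h5
      · exact hC (Ideal.subset_span ⟨i, rfl⟩)
  have h3 : maximalIdeal (Localization.AtPrime Q) = Q.map (algebraMap _ _) :=
    Localization.AtPrime.map_eq_maximalIdeal.symm
  have h6 := congrArg (Ideal.map (algebraMap (Polynomial S) (Localization.AtPrime Q))) h1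
  rw [h3, ← h6, span_map]
  congr 2
  funext o
  cases o <;> rfl

lemma conc_res (hu : Ideal.span (Set.range u) = maximalIdeal S) {Q : Ideal (Polynomial S)}
    (hQ : Q = Ideal.span (insert Polynomial.X (Set.range fun i => Polynomial.C (u i))))
    [Q.IsPrime] (r : Localization.AtPrime Q) :
    ∃ s, r - thR Q s ∈ maximalIdeal (Localization.AtPrime Q) := by
  obtain ⟨p, q, rfl⟩ := IsLocalization.exists_mk'_eq Q.primeCompl r
  have hq : IsUnit ((q : Polynomial S).coeff 0) := by
    have h1 := q.2
    by_contra h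
    exact h1 ((Q_iff hu hQ _).2 ((IsLocalRing.mem_maximalIdeal _).2 h))
  obtain ⟨c, hc⟩ := hq.exists_right_inv
  refine ⟨p.coeff 0 * c, ?_⟩
  have hqu : IsUnit (algebraMap (Polynomial S) (Localization.AtPrime Q) q) :=
    IsLocalization.map_units _ q
  rw [← Ideal.unit_mul_mem_iff_mem _ hqu, mul_sub, IsLocalization.mk'_spec']
  have h3 : maximalIdeal (Localization.AtPrime Q) = Q.map (algebraMap _ _) :=
    Localization.AtPrime.map_eq_maximalIdeal.symm
  rw [h3]
  have h4 : p - q * Polynomial.C (p.coeff 0 * c) ∈ Q := by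
    rw [Q_iff hu hQ]
    have : (p - q * Polynomial.C (p.coeff 0 * c)).coeff 0 = 0 := by
      rw [Polynomial.coeff_sub, Polynomial.coeff_mul_C]
      linear_combination (-p.coeff 0) * hc
    rw [this]; exact Ideal.zero_mem _
  have h5 := Ideal.mem_map_of_mem (algebraMap (Polynomial S) (Localization.AtPrime Q)) h4
  rwa [map_sub, map_mul] at h5

lemma conc_TF {B : Type u} [CommRing B] (θ : Polynomial S →+* B) (f : Polynomial S) {m : ℕ}
    (hd : f.natDegree = m) (φ : S) :
    θ f = TF (θ.comp Polynomial.C) f m φ (θ (Polynomial.X - Polynomial.C φ)) := by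
  conv_lhs => rw [← Polynomial.sum_taylor_eq f φ]
  rw [Polynomial.sum_over_range' _ _ (m + 1) (by rw [Polynomial.natDegree_taylor]; omega), map_sum]
  · simp [TF]
  · simp

end Conc

/-- **Corollary II.4** (monic version). Let `(S, N)` be a regular local G-ring with
r.s.p. `(u_1, ..., u_d)`, `R := S[y]_{(N, y)}`, and `f = y^m + f_1 y^{m-1} + ⋯ + f_m`
monic with `f_i ∈ N`. Then there is `z = y - φ`, `φ ∈ N`, with
`Δ(f; u; z) = Δ(f; u)`. -/
theorem monic_characteristic_polyhedron_without_completion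
    {d : ℕ} (S : Type u) [CommRing S] [IsLocalRing S]
    (hreg : IsRegularLocalRing S) (hG : IsGRing S)
    (u : Fin d → S) (hu : IsSysOfParams S u)
    (Q : Ideal (Polynomial S))
    (hQ : Q = Ideal.span (insert Polynomial.X (Set.range fun i => Polynomial.C (u i))))
    [Q.IsPrime]
    (m : ℕ) (hm : 0 < m) (f : Polynomial S) (hmonic : f.Monic) (hdeg : f.natDegree = m)
    (hcoeff : ∀ i < m, f.coeff i ∈ maximalIdeal S) :
    ∃ φ : S, φ ∈ maximalIdeal S ∧
      Delta (algebraMap (Polynomial S) (Localization.AtPrime Q) f)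
          (algebraMap (Polynomial S) (Localization.AtPrime Q)
            (Polynomial.X - Polynomial.C φ))
          (fun i => algebraMap (Polynomial S) (Localization.AtPrime Q) (Polynomial.C (u i)))
        = CharPolyhedron (algebraMap (Polynomial S) (Localization.AtPrime Q) f)
          (fun i => algebraMap (Polynomial S) (Localization.AtPrime Q)
            (Polynomial.C (u i))) := by
  haveI := hreg.1
  obtain ⟨φ, hφ, hmin⟩ := exists_min_S hG u hu hm hmonic hdeg hcoeff
  refine ⟨φ, hφ, ?_⟩
  have hS : MonSys u := monSys_of_dim hu.1 (by rw [hu.2]; simp)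
  haveI : IsNoetherianRing (Localization.AtPrime Q) :=
    IsLocalization.isNoetherianRing Q.primeCompl _ inferInstance
  have hdim := conc_dim hu hQ
  have hB : MonSys (zw (algebraMap (Polynomial S) (Localization.AtPrime Q)
      (Polynomial.X - Polynomial.C φ)) fun i => thR Q (u i)) :=
    monSys_of_dim (conc_span hu.1 hQ hφ) (by simpa using hdim)
  have hF := conc_TF (algebraMap (Polynomial S) (Localization.AtPrime Q)) f hdeg φ
  have hord : ordRes (algebraMap (Polynomial S) (Localization.AtPrime Q) f)
      (fun i => algebraMap (Polynomial S) (Localization.AtPrime Q) (Polynomial.C (u i))) = m := by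
    rw [hF]
    exact ordRes_eq hS hB hmonic hdeg hcoeff hφ
  have hFh : cmpl (algebraMap (Polynomial S) (Localization.AtPrime Q) f) =
      TF (cmpl.comp (thR Q)) f m φ (cmpl (algebraMap (Polynomial S) (Localization.AtPrime Q)
        (Polynomial.X - Polynomial.C φ))) :=
    conc_TF (cmpl.comp (algebraMap (Polynomial S) (Localization.AtPrime Q))) f hdeg φ
  have hrsp : IsRSPhat (Localization.AtPrime Q)
      (cmpl (algebraMap (Polynomial S) (Localization.AtPrime Q)
        (Polynomial.X - Polynomial.C φ)))
      (fun i => algebraMap (Polynomial S) (Localization.AtPrime Q) (Polynomial.C (u i))) := by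
    have h1 := congrArg (Ideal.map (cmpl (R := Localization.AtPrime Q))) hB.hw
    rw [span_zw, Ideal.map_span, Set.image_insert_eq, ← Set.range_comp] at h1
    exact h1
  have hBh : ∀ yh : Completion (Localization.AtPrime Q), IsRSPhat (Localization.AtPrime Q) yh
      (fun i => algebraMap (Polynomial S) (Localization.AtPrime Q) (Polynomial.C (u i))) →
      MonSys (zw yh fun i => (cmpl.comp (thR Q)) (u i)) := fun yh h => MonSys_hat hdim h
  have hresh : ∀ b : Completion (Localization.AtPrime Q), ∃ s, b - (cmpl.comp (thR Q)) s ∈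
      maximalIdeal (Completion (Localization.AtPrime Q)) := by
    intro b
    obtain ⟨a, ha⟩ := compl_approx (Localization.AtPrime Q) 1 b
    rw [pow_one] at ha
    obtain ⟨s, hs⟩ := conc_res hu.1 hQ a
    have h1 := Ideal.mem_map_of_mem (cmpl (R := Localization.AtPrime Q)) hs
    rw [← compl_max, map_sub] at h1
    refine ⟨s, ?_⟩
    have h2 := Ideal.sub_mem _ h1 ha
    rw [sub_sub_sub_cancel_left] at h2
    exact h2
  have hD : Delta (algebraMap (Polynomial S) (Localization.AtPrime Q) f)
      (algebraMap (Polynomial S) (Localization.AtPrime Q) (Polynomial.X - Polynomial.C φ))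
      (fun i => algebraMap (Polynomial S) (Localization.AtPrime Q) (Polynomial.C (u i)))
      = smallestFSubset (PT u f m φ) := by
    unfold Delta
    rw [hord, hF]
    exact delta_eq_H hS hB
  rw [hD]
  unfold CharPolyhedron
  rw [hord, hFh]
  apply Set.Subset.antisymm
  · refine Set.subset_iInter₂ fun yh hyh => ?_
    exact H_sub hS (hBh _ hrsp) (hBh yh hyh) hresh hm hmonic hdeg hcoeff hφ hmin
  · intro x hx
    have h1 := Set.mem_iInter₂.1 hx _ hrsp
    exact (delta_eq_H hS (hBh _ hrsp)).subset h1

end CharPolyhedra
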